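/- If the conjugacy class in Out(F) of an involution f ∈ Out(F) is anti-commutative, then f is a soft involution of Out(F). -/

import Mathlib

open Pointwise

/-- A subset `S` of a free group is a basis if the canonical homomorphism
`FreeGroup S →* FreeGroup X` extending the inclusion is bijective. -/
def FreeGroup.IsBasis {X : Type*} (S : Set (FreeGroup X)) : Prop :=
  Function.Bijective (FreeGroup.lift (fun s : S => (s : FreeGroup X)))

/-- The subgroup of inner automorphisms of a group `G`, as a subgroup of `MulAut G`. -/
def Inn (G : Type*) [Group G] : Subgroup (MulAut G) :=
  (MulAut.conj : G →* MulAut G).range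

instance Inn.normal (G : Type*) [Group G] : (Inn G).Normal := by
  constructor
  rintro - ⟨g, rfl⟩ σ
  refine ⟨σ g, ?_⟩
  ext x
  simp [MulAut.conj, MulAut.mul_apply, mul_assoc]

/-- The outer automorphism group `Out G = Aut G / Inn G`. -/
abbrev OutAut (G : Type*) [Group G] := MulAut G ⧸ Inn G

/-- The natural homomorphism `Aut G → Out G`. -/
def toOut {G : Type*} [Group G] : MulAut G →* OutAut G :=
  QuotientGroup.mk' (Inn G)

/-- `g` is an involution of the group `G`. -/
def IsInvolution {G : Type*} [Group G] (g : G) : Prop :=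
  g ≠ 1 ∧ g ^ 2 = 1

/-- A subset of a group is anti-commutative if its elements pairwise do not commute. -/
def AntiCommSet {G : Type*} [Group G] (s : Set G) : Prop :=
  ∀ a ∈ s, ∀ b ∈ s, a ≠ b → a * b ≠ b * a

/-- A decomposition `U ⊔ S ⊔ ⊔_{x ∈ S} Y x` of a basis of a free group. -/
structure IsBasisDecomposition {X : Type*} (U S : Set (FreeGroup X))
    (Y : FreeGroup X → Set (FreeGroup X)) : Prop where
  isBasis : FreeGroup.IsBasis (U ∪ S ∪ ⋃ x ∈ S, Y x)
  disjUS : Disjoint U S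
  disjUY : ∀ x ∈ S, Disjoint U (Y x)
  disjSY : ∀ x ∈ S, Disjoint S (Y x)
  disjYY : ∀ x ∈ S, ∀ x' ∈ S, x ≠ x' → Disjoint (Y x) (Y x')

/-- `U ⊔ S ⊔ ⊔_{x ∈ S} Y x` is a canonical basis for the (soft) involution `φ`:
`φ` fixes `U` pointwise, inverts the elements of `S` and conjugates the elements of
`Y x` by `x`. -/
def IsCanonicalBasis {X : Type*} (φ : MulAut (FreeGroup X)) (U S : Set (FreeGroup X))
    (Y : FreeGroup X → Set (FreeGroup X)) : Prop :=
  IsBasisDecomposition U S Y ∧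
    (∀ u ∈ U, φ u = u) ∧ (∀ x ∈ S, φ x = x⁻¹) ∧
    (∀ x ∈ S, ∀ y ∈ Y x, φ y = x * y * x⁻¹)

/-- A soft involution of `Aut F`: an involution admitting a canonical basis. -/
def IsSoftInvolution {X : Type*} (φ : MulAut (FreeGroup X)) : Prop :=
  IsInvolution φ ∧ ∃ U S Y, IsCanonicalBasis φ U S Y

/-- A soft involution of `Out F`: an involution induced by a soft involution of `Aut F`. -/
def IsSoftOutInvolution {X : Type*} (f : OutAut (FreeGroup X)) : Prop :=
  IsInvolution f ∧ ∃ φ, IsSoftInvolution φ ∧ toOut φ = f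

/-- A `1`-involution of `Aut F`: a soft involution whose canonical bases have exactly
one block. -/
def IsOneInvolution {X : Type*} (ψ : MulAut (FreeGroup X)) : Prop :=
  IsInvolution ψ ∧ ∃ (U Y : Set (FreeGroup X)) (x : FreeGroup X),
    IsCanonicalBasis ψ U {x} (fun _ => Y)

/-- A `1`-involution of `Out F`: an involution induced by a `1`-involution of `Aut F`. -/
def IsOneOutInvolution {X : Type*} (f : OutAut (FreeGroup X)) : Prop :=
  IsInvolution f ∧ ∃ ψ, IsOneInvolution ψ ∧ toOut ψ = f

/-- An extremal involution of `Aut F`: an involution inverting one element of a suitable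
basis and fixing all other elements of that basis. -/
def IsExtremalInvolution {X : Type*} (φ : MulAut (FreeGroup X)) : Prop :=
  IsInvolution φ ∧ ∃ (B : Set (FreeGroup X)) (x : FreeGroup X),
    FreeGroup.IsBasis B ∧ x ∈ B ∧ φ x = x⁻¹ ∧ ∀ b ∈ B, b ≠ x → φ b = b

/-- An extremal involution of `Out F`: an involution induced by an extremal involution
of `Aut F`. -/
def IsExtremalOutInvolution {X : Type*} (f : OutAut (FreeGroup X)) : Prop :=
  IsInvolution f ∧ ∃ φ, IsExtremalInvolution φ ∧ toOut φ = f

/-- A symmetry of `Aut F`: an involution inverting all elements of some basis. -/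
def IsSymmetryAut {X : Type*} (θ : MulAut (FreeGroup X)) : Prop :=
  IsInvolution θ ∧ ∃ B : Set (FreeGroup X), FreeGroup.IsBasis B ∧ ∀ b ∈ B, θ b = b⁻¹

/-- A symmetry of `Out F`: an involution whose full preimage in `Aut F` contains a
symmetry. -/
def IsSymmetryOut {X : Type*} (f : OutAut (FreeGroup X)) : Prop :=
  IsInvolution f ∧ ∃ θ, IsSymmetryAut θ ∧ toOut θ = f

/-- Condition (★): the product set `K·K` contains exactly one conjugacy class of
involutions, and no element of `K` is a square. -/
def StarCondition {G : Type*} [Group G] (K : Set G) : Prop :=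
  (∃ c ∈ K * K, IsInvolution c ∧ ∀ d ∈ K * K, IsInvolution d → IsConj c d) ∧
    ∀ k ∈ K, ¬ ∃ g : G, g ^ 2 = k

universe u

/-! ### Cuts in a graph -/

/-- The oriented edges of the relation `r` that leave the set `C`. -/
def edgeBoundary {V : Type*} (r : V → V → Prop) (C : Set V) : Set (V × V) :=
  {e | r e.1 e.2 ∧ e.1 ∈ C ∧ e.2 ∉ C}

/-- Two sets cross if all four of their corners are nonempty. -/
def Crosses {V : Type*} (C D : Set V) : Prop :=
  (C ∩ D).Nonempty ∧ (C ∩ Dᶜ).Nonempty ∧ (Cᶜ ∩ D).Nonempty ∧ (Cᶜ ∩ Dᶜ).Nonempty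

/-- A set is connected for `r` if it admits no partition without edges between its parts. -/
def ConnIn {V : Type*} (r : V → V → Prop) (C : Set V) : Prop :=
  ∀ A ⊆ C, A.Nonempty → (C \ A).Nonempty → ∃ a ∈ A, ∃ b ∈ C \ A, r a b

/-- A set is tight if it and its complement are connected. -/
def Tight {V : Type*} (r : V → V → Prop) (C : Set V) : Prop :=
  ConnIn r C ∧ ConnIn r Cᶜ

/-- The Boolean algebra of sets generated by a family. -/
inductive BoolGen {V : Type*} (S : Set (Set V)) : Set V → Prop
  | basic {C} : C ∈ S → BoolGen S C
  | empty : BoolGen S ∅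
  | compl {C} : BoolGen S C → BoolGen S Cᶜ
  | inter {C D} : BoolGen S C → BoolGen S D → BoolGen S (C ∩ D)

/-- The tight cuts with at most `N` edges that cross `C`. -/
def crossingCuts {V : Type*} (r : V → V → Prop) (N : ℕ) (C : Set V) : Set (Set V) :=
  {D | Tight r D ∧ (edgeBoundary r D).encard ≤ N ∧ Crosses D C}

/-- The weight of a cut: its number of edges, then its number of crossings. -/
noncomputable def cutWeight {V : Type*} (r : V → V → Prop) (N : ℕ) (C : Set V) : ℕ ×ₗ ℕ :=
  toLex ((edgeBoundary r C).ncard, (crossingCuts r N C).ncard)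

/-- The cuts with at most `N` edges that are not generated by cuts of smaller weight. -/
def optimalCuts {V : Type*} (r : V → V → Prop) (N : ℕ) : Set (Set V) :=
  {C | (edgeBoundary r C).encard ≤ N ∧
    ¬ BoolGen {D | (edgeBoundary r D).encard ≤ N ∧ cutWeight r N D < cutWeight r N C} C}

section Cuts

variable {V : Type*}

theorem BoolGen.mono {S S' : Set (Set V)} {C : Set V} (h : BoolGen S C) (hS : S ⊆ S') :
    BoolGen S' C := by
  induction h with
  | basic h => exact .basic (hS h)
  | empty => exact .empty
  | compl _ ih => exact .compl ih
  | inter _ _ ih₁ ih₂ => exact .inter ih₁ ih₂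

theorem BoolGen.bind {S S' : Set (Set V)} {C : Set V} (h : BoolGen S C)
    (hS : ∀ D ∈ S, BoolGen S' D) : BoolGen S' C := by
  induction h with
  | basic h => exact hS _ h
  | empty => exact .empty
  | compl _ ih => exact .compl ih
  | inter _ _ ih₁ ih₂ => exact .inter ih₁ ih₂

theorem BoolGen.union {S : Set (Set V)} {C D : Set V} (hC : BoolGen S C) (hD : BoolGen S D) :
    BoolGen S (C ∪ D) := by
  have := (hC.compl.inter hD.compl).compl
  rwa [Set.compl_inter, compl_compl, compl_compl] at this

theorem BoolGen.preimage {W : Type*} {S : Set (Set V)} {S' : Set (Set W)} (σ : W → V) {C : Set V}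
    (h : BoolGen S C) (hS : ∀ D ∈ S, σ ⁻¹' D ∈ S') : BoolGen S' (σ ⁻¹' C) := by
  induction h with
  | basic h => exact .basic (hS _ h)
  | empty => exact .empty
  | compl _ ih => exact .compl ih
  | inter _ _ ih₁ ih₂ => exact .inter ih₁ ih₂

theorem Crosses.symm {C D : Set V} (h : Crosses C D) : Crosses D C := by
  obtain ⟨h1, h2, h3, h4⟩ := h
  exact ⟨by rwa [Set.inter_comm], by rwa [Set.inter_comm], by rwa [Set.inter_comm],
    by rwa [Set.inter_comm]⟩

theorem Crosses.compl_left {C D : Set V} (h : Crosses C D) : Crosses Cᶜ D := by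
  obtain ⟨h1, h2, h3, h4⟩ := h
  exact ⟨h3, h4, by rwa [compl_compl], by rwa [compl_compl]⟩

theorem Crosses.compl_right {C D : Set V} (h : Crosses C D) : Crosses C Dᶜ :=
  h.symm.compl_left.symm

theorem not_crosses_cases {C D : Set V} (h : ¬ Crosses C D) :
    C ⊆ D ∨ D ⊆ C ∨ C ⊆ Dᶜ ∨ Dᶜ ⊆ C := by
  by_contra! hc
  obtain ⟨h1, h2, h3, h4⟩ := hc
  rw [Set.not_subset] at h1 h2 h3 h4
  obtain ⟨a, ha, ha'⟩ := h1
  obtain ⟨b, hb, hb'⟩ := h2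
  obtain ⟨c, hc, hc'⟩ := h3
  obtain ⟨d, hd, hd'⟩ := h4
  exact h ⟨⟨c, hc, by simpa using hc'⟩, ⟨a, ha, ha'⟩, ⟨b, hb', hb⟩, ⟨d, hd', hd⟩⟩

variable {r : V → V → Prop} {N : ℕ}

theorem edgeBoundary_compl (hr : ∀ ⦃a b⦄, r a b → r b a) (C : Set V) :
    edgeBoundary r Cᶜ = Prod.swap '' edgeBoundary r C := by
  ext ⟨a, b⟩
  simp only [edgeBoundary, Set.mem_ofPred_eq, Set.mem_compl_iff, not_not, Set.mem_image,
    Prod.exists, Prod.swap_prod_mk, Prod.mk.injEq]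
  constructor
  · rintro ⟨h, ha, hb⟩
    exact ⟨b, a, ⟨hr h, hb, ha⟩, rfl, rfl⟩
  · rintro ⟨_, _, ⟨h, hb, ha⟩, rfl, rfl⟩
    exact ⟨hr h, ha, hb⟩

theorem encard_edgeBoundary_compl (hr : ∀ ⦃a b⦄, r a b → r b a) (C : Set V) :
    (edgeBoundary r Cᶜ).encard = (edgeBoundary r C).encard := by
  rw [edgeBoundary_compl hr, Prod.swap_injective.encard_image]

theorem crossingCuts_compl (C : Set V) : crossingCuts r N Cᶜ = crossingCuts r N C := by
  ext D
  constructor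
  · rintro ⟨h1, h2, h3⟩
    exact ⟨h1, h2, by simpa using h3.compl_right⟩
  · rintro ⟨h1, h2, h3⟩
    exact ⟨h1, h2, h3.compl_right⟩

theorem cutWeight_compl (hr : ∀ ⦃a b⦄, r a b → r b a) (C : Set V) :
    cutWeight r N Cᶜ = cutWeight r N C := by
  rw [cutWeight, cutWeight, crossingCuts_compl, Set.ncard, encard_edgeBoundary_compl hr, Set.ncard,
    Set.ncard]

theorem optimalCuts_compl (hr : ∀ ⦃a b⦄, r a b → r b a) {C : Set V} (hC : C ∈ optimalCuts r N) :
    Cᶜ ∈ optimalCuts r N := by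
  refine ⟨by rw [encard_edgeBoundary_compl hr]; exact hC.1, fun h => hC.2 ?_⟩
  rw [cutWeight_compl hr] at h
  simpa using h.compl

theorem boolGen_optimalCuts (C : Set V) (hC : (edgeBoundary r C).encard ≤ N) :
    BoolGen (optimalCuts r N) C := by
  induction hw : cutWeight r N C using WellFoundedLT.induction generalizing C with
  | ind w ih =>
    by_cases h : C ∈ optimalCuts r N
    · exact .basic h
    · simp only [optimalCuts, Set.mem_ofPred_eq, not_and, not_not] at h
      exact (h hC).bind fun D hD => ih _ (hw ▸ hD.2) D hD.1 rfl

theorem ncard_edgeBoundary_submodular {C D : Set V} (hC : (edgeBoundary r C).Finite)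
    (hD : (edgeBoundary r D).Finite) :
    (edgeBoundary r (C ∩ D)).ncard + (edgeBoundary r (C ∪ D)).ncard ≤
      (edgeBoundary r C).ncard + (edgeBoundary r D).ncard := by
  have hU : edgeBoundary r (C ∩ D) ∪ edgeBoundary r (C ∪ D) ⊆
      edgeBoundary r C ∪ edgeBoundary r D := by
    rintro e (⟨h, h1, h2⟩ | ⟨h, h1, h2⟩) <;> simp [edgeBoundary] at * <;> tauto
  have hI : edgeBoundary r (C ∩ D) ∩ edgeBoundary r (C ∪ D) ⊆
      edgeBoundary r C ∩ edgeBoundary r D := by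
    rintro e ⟨⟨h, h1, h2⟩, ⟨h', h3, h4⟩⟩
    simp [edgeBoundary] at *; tauto
  have hf := hC.union hD
  have hf' := hf.subset hU
  rw [← Set.ncard_union_add_ncard_inter _ _ (hf'.subset Set.subset_union_left)
    (hf'.subset Set.subset_union_right), ← Set.ncard_union_add_ncard_inter _ _ hC hD]
  exact add_le_add (Set.ncard_le_ncard hU hf)
    (Set.ncard_le_ncard hI (hC.subset Set.inter_subset_left))

theorem finite_edgeBoundary_inter {C D : Set V} (hC : (edgeBoundary r C).Finite)
    (hD : (edgeBoundary r D).Finite) : (edgeBoundary r (C ∩ D)).Finite := by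
  refine (hC.union hD).subset ?_
  rintro e ⟨h, h1, h2⟩
  simp [edgeBoundary] at *; tauto

theorem finite_edgeBoundary_compl (hr : ∀ ⦃a b⦄, r a b → r b a) {C : Set V}
    (hC : (edgeBoundary r C).Finite) :
    (edgeBoundary r Cᶜ).Finite := by
  rw [edgeBoundary_compl hr]; exact hC.image _

/-- A path gives a finite set of edges meeting the boundary of every set separating its ends. -/
theorem exists_finite_separating_edges {x y : V} (h : Relation.ReflTransGen r x y) :
    ∃ P : Set (V × V), P.Finite ∧ ∀ D : Set V, x ∈ D → y ∉ D → ∃ e ∈ P, e ∈ edgeBoundary r D := by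
  induction h with
  | refl => exact ⟨∅, Set.finite_empty, fun D h h' => absurd h h'⟩
  | @tail b c _ hbc ih =>
    obtain ⟨P, hP, h⟩ := ih
    refine ⟨insert (b, c) P, hP.insert _, fun D hx hc => ?_⟩
    by_cases hb : b ∈ D
    · exact ⟨(b, c), Set.mem_insert _ _, hbc, hb, hc⟩
    · obtain ⟨e, he, he'⟩ := h D hx hb
      exact ⟨e, Set.mem_insert_of_mem _ he, he'⟩

/-- Only finitely many tight cuts of bounded size contain a given edge. -/
theorem finite_tight_through (n : ℕ) : ∀ (r : V → V → Prop), (∀ ⦃a b⦄, r a b → r b a) → ∀ e : V × V,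
    {D : Set V | Tight r D ∧ e ∈ edgeBoundary r D ∧ (edgeBoundary r D).encard ≤ n}.Finite := by
  induction n with
  | zero =>
    intro r _ e
    convert Set.finite_empty
    ext D
    simp only [Set.mem_ofPred_eq, Set.mem_empty_iff_false, iff_false]
    rintro ⟨-, he, h⟩
    simp at h
    simp [h] at he
  | succ n ih =>
    intro r hr e
    obtain ⟨x, y⟩ := e
    let r' : V → V → Prop := fun a b => r a b ∧ ¬ (a = x ∧ b = y) ∧ ¬ (a = y ∧ b = x)
    have hr' : ∀ ⦃a b⦄, r' a b → r' b a := fun a b h => ⟨hr h.1, fun h' => h.2.2 ⟨h'.2, h'.1⟩,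
      fun h' => h.2.1 ⟨h'.2, h'.1⟩⟩
    have key : ∀ D : Set V, Tight r D → (x, y) ∈ edgeBoundary r D → Tight r' D := by
      rintro D ⟨h1, h2⟩ ⟨_, hx, hy⟩
      simp only at hx hy
      constructor
      · intro A hA hne hne'
        obtain ⟨a, ha, b, hb, hab⟩ := h1 A hA hne hne'
        refine ⟨a, ha, b, hb, hab, ?_, ?_⟩
        · rintro ⟨rfl, rfl⟩; exact hy hb.1
        · rintro ⟨rfl, rfl⟩; exact hy (hA ha)
      · intro A hA hne hne'
        obtain ⟨a, ha, b, hb, hab⟩ := h2 A hA hne hne'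
        refine ⟨a, ha, b, hb, hab, ?_, ?_⟩
        · rintro ⟨rfl, rfl⟩; exact hA ha hx
        · rintro ⟨rfl, rfl⟩; exact hb.1 hx
    by_cases hxy : Relation.ReflTransGen r' x y
    · obtain ⟨P, hP, hsep⟩ := exists_finite_separating_edges hxy
      refine (hP.biUnion fun e _ => ih r' hr' e).subset ?_
      rintro D ⟨hD, he, hc⟩
      obtain ⟨e', he', heD⟩ := hsep D he.2.1 he.2.2
      refine Set.mem_biUnion he' ⟨key D hD he, heD, ?_⟩
      have hsub : insert (x, y) (edgeBoundary r' D) ⊆ edgeBoundary r D :=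
        Set.insert_subset he fun f hf => ⟨hf.1.1, hf.2⟩
      have hnot : (x, y) ∉ edgeBoundary r' D := fun h => h.1.2.1 ⟨rfl, rfl⟩
      have := (Set.encard_le_encard hsub).trans hc
      rw [Set.encard_insert_of_notMem hnot] at this
      push_cast at this
      exact (ENat.add_le_add_iff_right (by simp)).1 this
    · refine (Set.finite_singleton {v | Relation.ReflTransGen r' x v}).subset ?_
      rintro D ⟨hD, he, -⟩
      have ht := key D hD he
      set A := {v | Relation.ReflTransGen r' x v}
      have hA : ∀ a ∈ A, ∀ b, r' a b → b ∈ A := fun a ha b hab => Relation.ReflTransGen.tail ha hab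
      have hxA : x ∈ A := Relation.ReflTransGen.refl
      apply Set.Subset.antisymm
      · by_contra hcon
        obtain ⟨d, hd, hdA⟩ := Set.not_subset.1 hcon
        obtain ⟨a, ha, b, hb, hab⟩ := ht.1 (D ∩ A) Set.inter_subset_left ⟨x, he.2.1, hxA⟩
          ⟨d, hd, fun h => hdA h.2⟩
        exact hb.2 ⟨hb.1, hA a ha.2 b hab⟩
      · by_contra hcon
        obtain ⟨d, hd, hdA⟩ := Set.not_subset.1 hcon
        obtain ⟨a, ha, b, hb, hab⟩ := ht.2 (Dᶜ ∩ A) Set.inter_subset_left ⟨d, hdA, hd⟩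
          ⟨y, he.2.2, fun h => hxy h.2⟩
        exact hb.2 ⟨hb.1, hA a ha.2 b hab⟩

theorem finite_tight_separating (hr : ∀ ⦃a b⦄, r a b → r b a)
    (hconn : ∀ x y, Relation.ReflTransGen r x y)
    (N : ℕ) (x y : V) :
    {D : Set V | Tight r D ∧ (edgeBoundary r D).encard ≤ N ∧ x ∈ D ∧ y ∉ D}.Finite := by
  obtain ⟨P, hP, h⟩ := exists_finite_separating_edges (hconn x y)
  refine (hP.biUnion fun e _ => finite_tight_through N r hr e).subset ?_
  rintro D ⟨h1, h2, hx, hy⟩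
  obtain ⟨e, he, he'⟩ := h D hx hy
  exact Set.mem_biUnion he ⟨h1, he', h2⟩

theorem finite_crossingCuts (hr : ∀ ⦃a b⦄, r a b → r b a)
    (hconn : ∀ x y, Relation.ReflTransGen r x y)
    {C : Set V} (hC : (edgeBoundary r C).Finite) : (crossingCuts r N C).Finite := by
  set S : Set V := Prod.fst '' edgeBoundary r C ∪ Prod.snd '' edgeBoundary r C
  have hS : S.Finite := (hC.image _).union (hC.image _)
  refine (hS.biUnion fun p _ => hS.biUnion fun q _ =>
    finite_tight_separating hr hconn N p q).subset ?_
  rintro X ⟨hX, hN, hX1, hX2, hX3, hX4⟩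
  have hp : ∃ p ∈ S, p ∈ X := by
    obtain ⟨a, ha, b, hb, hab⟩ := hX.1 (X ∩ C) Set.inter_subset_left hX1
      (by obtain ⟨v, hv⟩ := hX2; exact ⟨v, hv.1, fun h => hv.2 h.2⟩)
    exact ⟨a, Or.inl ⟨(a, b), ⟨hab, ha.2, fun h => hb.2 ⟨hb.1, h⟩⟩, rfl⟩, ha.1⟩
  have hq : ∃ q ∈ S, q ∉ X := by
    obtain ⟨a, ha, b, hb, hab⟩ := hX.2 (Xᶜ ∩ C) Set.inter_subset_left hX3
      (by obtain ⟨v, hv⟩ := hX4; exact ⟨v, hv.1, fun h => hv.2 h.2⟩)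
    exact ⟨a, Or.inl ⟨(a, b), ⟨hab, ha.2, fun h => hb.2 ⟨hb.1, h⟩⟩, rfl⟩, ha.1⟩
  obtain ⟨p, hpS, hp⟩ := hp
  obtain ⟨q, hqS, hq⟩ := hq
  exact Set.mem_biUnion hpS (Set.mem_biUnion hqS ⟨hX, hN, hp, hq⟩)

theorem edgeBoundary_nonempty (hconn : ∀ x y, Relation.ReflTransGen r x y) {C : Set V}
    (h : C.Nonempty) (h' : Cᶜ.Nonempty) : (edgeBoundary r C).Nonempty := by
  obtain ⟨x, hx⟩ := h
  obtain ⟨y, hy⟩ := h'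
  obtain ⟨P, -, hP⟩ := exists_finite_separating_edges (hconn x y)
  obtain ⟨e, -, he⟩ := hP C hx hy
  exact ⟨e, he⟩

theorem finite_of_mem_optimalCuts {C : Set V} (hC : C ∈ optimalCuts r N) :
    (edgeBoundary r C).Finite :=
  Set.finite_of_encard_le_coe hC.1

theorem optimalCuts_nonempty {C : Set V} (hC : C ∈ optimalCuts r N) : C.Nonempty := by
  rw [Set.nonempty_iff_ne_empty]
  rintro rfl
  exact hC.2 .empty

theorem connIn_of_mem_optimalCuts (hr : ∀ ⦃a b⦄, r a b → r b a)
    (hconn : ∀ x y, Relation.ReflTransGen r x y) {C : Set V} (hC : C ∈ optimalCuts r N) :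
    ConnIn r C := by
  intro A hA hne hne'
  by_contra! hcon
  have hfin := finite_of_mem_optimalCuts hC
  have hCc : Cᶜ.Nonempty := optimalCuts_nonempty (optimalCuts_compl hr hC)
  have h1 : edgeBoundary r A ⊆ edgeBoundary r C := by
    rintro e ⟨h, ha, hb⟩
    exact ⟨h, hA ha, fun hb' => hcon _ ha _ ⟨hb', hb⟩ h⟩
  have h2 : edgeBoundary r (C \ A) ⊆ edgeBoundary r C := by
    rintro e ⟨h, ha, hb⟩
    refine ⟨h, ha.1, fun hb' => ?_⟩
    by_cases hbA : e.2 ∈ A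
    · exact hcon _ hbA _ ha (hr h)
    · exact hb ⟨hb', hbA⟩
  have hdisj : ∀ e, e ∈ edgeBoundary r A → e ∉ edgeBoundary r (C \ A) :=
    fun e h h' => h'.2.1.2 h.2.1
  obtain ⟨e1, he1⟩ := edgeBoundary_nonempty hconn hne
    (hCc.mono (Set.compl_subset_compl.2 hA))
  obtain ⟨e2, he2⟩ := edgeBoundary_nonempty hconn hne'
    (hCc.mono (Set.compl_subset_compl.2 Set.sdiff_subset))
  have key : ∀ B : Set V, edgeBoundary r B ⊆ edgeBoundary r C →
      (∃ e ∈ edgeBoundary r C, e ∉ edgeBoundary r B) →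
      BoolGen {D | (edgeBoundary r D).encard ≤ N ∧ cutWeight r N D < cutWeight r N C} B := by
    rintro B hB ⟨e, he, he'⟩
    refine .basic ⟨(Set.encard_le_encard hB).trans hC.1, ?_⟩
    refine Prod.Lex.toLex_lt_toLex.2 (Or.inl (Set.ncard_lt_ncard ?_ hfin))
    exact ⟨hB, fun h => he' (h he)⟩
  have := (key A h1 ⟨e2, h2 he2, fun h => hdisj _ h he2⟩).union
    (key _ h2 ⟨e1, h1 he1, hdisj _ he1⟩)
  rw [Set.union_sdiff_cancel hA] at this
  exact hC.2 this

theorem tight_of_mem_optimalCuts (hr : ∀ ⦃a b⦄, r a b → r b a)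
    (hconn : ∀ x y, Relation.ReflTransGen r x y) {C : Set V} (hC : C ∈ optimalCuts r N) :
    Tight r C :=
  ⟨connIn_of_mem_optimalCuts hr hconn hC,
    connIn_of_mem_optimalCuts hr hconn (optimalCuts_compl hr hC)⟩

theorem crossing_corner_cases {C D X : Set V} (hne : (Cᶜ ∩ Dᶜ).Nonempty)
    (h : Crosses X (C ∩ D)) : Crosses X C ∨ Crosses X D := by
  obtain ⟨o, hoC, hoD⟩ := hne
  obtain ⟨⟨a, ha, haC, haD⟩, ⟨b, hb, hb'⟩, ⟨c, hc, hcC, hcD⟩, ⟨d, hd, hd'⟩⟩ := h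
  by_contra! hcon
  have h1 := not_crosses_cases hcon.1
  have h2 := not_crosses_cases hcon.2
  simp only [Set.subset_def, Set.mem_compl_iff, Set.mem_inter_iff, not_and] at *
  grind

theorem crossing_opposite_corners {C D X : Set V} (h : Crosses X (C ∩ D))
    (h' : Crosses X (C ∪ D)) : Crosses X C := by
  obtain ⟨⟨a, ha, haC, haD⟩, -, ⟨c, hc, hcC, hcD⟩, -⟩ := h
  obtain ⟨-, ⟨b, hb, hb'⟩, -, ⟨d, hd, hd'⟩⟩ := h'
  exact ⟨⟨a, ha, haC⟩, ⟨b, hb, fun h => hb' (Or.inl h)⟩, ⟨c, hc, hcC⟩,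
    ⟨d, hd, fun h => hd' (Or.inl h)⟩⟩

theorem not_crosses_optimalCuts_of_corners (hr : ∀ ⦃a b⦄, r a b → r b a)
    (hconn : ∀ x y, Relation.ReflTransGen r x y) {C D : Set V}
    (hC : C ∈ optimalCuts r N) (hD : D ∈ optimalCuts r N) (hCD : Crosses C D)
    (h1 : ¬ BoolGen {X | (edgeBoundary r X).encard ≤ N ∧ cutWeight r N X < cutWeight r N C} (C ∩ D))
    (h2 : ¬ BoolGen {X | (edgeBoundary r X).encard ≤ N ∧ cutWeight r N X < cutWeight r N D}
      (C ∪ D)) : False := by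
  have hCf := finite_of_mem_optimalCuts hC
  have hDf := finite_of_mem_optimalCuts hD
  have hIf := finite_edgeBoundary_inter hCf hDf
  have hUf : (edgeBoundary r (C ∪ D)).Finite := by
    have := finite_edgeBoundary_compl hr (finite_edgeBoundary_inter
      (finite_edgeBoundary_compl hr hCf) (finite_edgeBoundary_compl hr hDf))
    simpa [Set.compl_inter] using this
  have hsub := ncard_edgeBoundary_submodular hCf hDf
  have hCN : (edgeBoundary r C).ncard ≤ N := by
    have := hC.1; rw [← hCf.cast_ncard_eq] at this; exact_mod_cast this
  have hDN : (edgeBoundary r D).ncard ≤ N := by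
    have := hD.1; rw [← hDf.cast_ncard_eq] at this; exact_mod_cast this
  have w1 : (edgeBoundary r (C ∩ D)).ncard ≤ N → cutWeight r N C ≤ cutWeight r N (C ∩ D) := by
    intro h
    by_contra! hlt
    exact h1 (.basic ⟨by rw [← hIf.cast_ncard_eq]; exact_mod_cast h, hlt⟩)
  have w2 : (edgeBoundary r (C ∪ D)).ncard ≤ N → cutWeight r N D ≤ cutWeight r N (C ∪ D) := by
    intro h
    by_contra! hlt
    exact h2 (.basic ⟨by rw [← hUf.cast_ncard_eq]; exact_mod_cast h, hlt⟩)
  rw [cutWeight, cutWeight, Prod.Lex.toLex_le_toLex] at w1 w2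
  simp only at w1 w2
  have hfC := finite_crossingCuts (N := N) hr hconn hCf
  have hfD := finite_crossingCuts (N := N) hr hconn hDf
  have hlt : (crossingCuts r N (C ∩ D)).ncard + (crossingCuts r N (C ∪ D)).ncard <
      (crossingCuts r N C).ncard + (crossingCuts r N D).ncard := by
    have hU : crossingCuts r N (C ∩ D) ∪ crossingCuts r N (C ∪ D) ⊂
        crossingCuts r N C ∪ crossingCuts r N D := by
      refine ⟨?_, fun hsub' => ?_⟩
      · rintro X (⟨ht, hn, hx⟩ | ⟨ht, hn, hx⟩)
        · exact (crossing_corner_cases hCD.2.2.2 hx).imp (fun h => ⟨ht, hn, h⟩)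
            (fun h => ⟨ht, hn, h⟩)
        · have : Crosses X (Cᶜ ∩ Dᶜ) := by
            have := hx.compl_right
            rwa [Set.compl_union] at this
          refine (crossing_corner_cases (by simpa using hCD.1) this).imp (fun h => ⟨ht, hn, ?_⟩)
              (fun h => ⟨ht, hn, ?_⟩)
          · simpa using h.compl_right
          · simpa using h.compl_right
      · have hmem : C ∈ crossingCuts r N C ∪ crossingCuts r N D :=
          Or.inr ⟨tight_of_mem_optimalCuts hr hconn hC, hC.1, hCD⟩
        rcases hsub' hmem with ⟨-, -, h⟩ | ⟨-, -, h⟩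
        · obtain ⟨-, -, ⟨v, hv, hv'⟩, -⟩ := h
          exact hv hv'.1
        · obtain ⟨-, ⟨v, hv, hv'⟩, -, -⟩ := h
          exact hv' (Or.inl hv)
    have hI : crossingCuts r N (C ∩ D) ∩ crossingCuts r N (C ∪ D) ⊆
        crossingCuts r N C ∩ crossingCuts r N D := by
      rintro X ⟨⟨ht, hn, hx⟩, ⟨-, -, hx'⟩⟩
      refine ⟨⟨ht, hn, crossing_opposite_corners hx hx'⟩, ⟨ht, hn, ?_⟩⟩
      rw [Set.inter_comm] at hx
      rw [Set.union_comm] at hx'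
      exact crossing_opposite_corners hx hx'
    rw [← Set.ncard_union_add_ncard_inter _ _ (finite_crossingCuts hr hconn hIf)
      (finite_crossingCuts hr hconn hUf), ← Set.ncard_union_add_ncard_inter _ _ hfC hfD]
    exact add_lt_add_of_lt_of_le (Set.ncard_lt_ncard hU (hfC.union hfD))
      (Set.ncard_le_ncard hI (hfC.subset Set.inter_subset_left))
  omega

/-- Optimal cuts are pairwise nested. -/
theorem not_crosses_optimalCuts (hr : ∀ ⦃a b⦄, r a b → r b a)
    (hconn : ∀ x y, Relation.ReflTransGen r x y) {C D : Set V}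
    (hC : C ∈ optimalCuts r N) (hD : D ∈ optimalCuts r N) : ¬ Crosses C D := by
  wlog hw : cutWeight r N D ≤ cutWeight r N C generalizing C D
  · exact fun h => this hD hC (le_of_not_ge hw) h.symm
  intro hCD
  set R := BoolGen {X | (edgeBoundary r X).encard ≤ N ∧ cutWeight r N X < cutWeight r N C}
  set R' := BoolGen {X | (edgeBoundary r X).encard ≤ N ∧ cutWeight r N X < cutWeight r N D}
  have hRR : ∀ X, R' X → R X := fun X h => h.mono fun Y hY => ⟨hY.1, hY.2.trans_le hw⟩
  have hCR : ¬ R C := hC.2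
  have hDR : ¬ R' D := hD.2
  have hu : ∀ {S : Set (Set V)} {A B : Set V}, BoolGen S (A ∩ B) → BoolGen S (A ∩ Bᶜ) →
      BoolGen S A := fun h h' => by simpa [Set.inter_union_compl] using h.union h'
  have hc12 : ¬ (R (C ∩ D) ∧ R (C ∩ Dᶜ)) := fun h => hCR (hu h.1 h.2)
  have hc34 : ¬ (R (Cᶜ ∩ Dᶜ) ∧ R (Cᶜ ∩ D)) := fun h => hCR (by simpa using (hu h.2 h.1).compl)
  have hd14 : ¬ (R' (C ∩ D) ∧ R' (Cᶜ ∩ D)) := fun h => hDR (by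
    refine hu (B := C) ?_ ?_
    · rw [Set.inter_comm]; exact h.1
    · rw [Set.inter_comm]; exact h.2)
  have hd23 : ¬ (R' (C ∩ Dᶜ) ∧ R' (Cᶜ ∩ Dᶜ)) := fun h => hDR (by
    rw [← compl_compl D]
    refine (hu (B := C) ?_ ?_).compl
    · rw [Set.inter_comm]; exact h.1
    · rw [Set.inter_comm]; exact h.2)
  have hCc := optimalCuts_compl hr hC
  have hDc := optimalCuts_compl hr hD
  have e1 : (Cᶜ ∩ Dᶜ)ᶜ = C ∪ D := by simp [Set.compl_inter]
  have e2 : (Cᶜ ∩ D)ᶜ = C ∪ Dᶜ := by simp [Set.compl_inter]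
  have e3 : (C ∩ D)ᶜ = Cᶜ ∪ Dᶜ := by simp [Set.compl_inter]
  have e4 : (C ∩ Dᶜ)ᶜ = Cᶜ ∪ D := by simp [Set.compl_inter]
  have f1 : ¬ R (C ∩ D) → ¬ R' (Cᶜ ∩ Dᶜ) → False := fun h h' =>
    not_crosses_optimalCuts_of_corners hr hconn hC hD hCD h
      (by rw [← e1]; exact fun hh => h' (by simpa using hh.compl))
  have f2 : ¬ R (C ∩ Dᶜ) → ¬ R' (Cᶜ ∩ D) → False := fun h h' =>
    not_crosses_optimalCuts_of_corners hr hconn hC hDc hCD.compl_right h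
      (by rw [← e2, cutWeight_compl hr]; exact fun hh => h' (by simpa using hh.compl))
  have f3 : ¬ R (Cᶜ ∩ Dᶜ) → ¬ R' (C ∩ D) → False := fun h h' =>
    not_crosses_optimalCuts_of_corners hr hconn hCc hDc hCD.compl_right.compl_left
      (by rwa [cutWeight_compl hr])
      (by rw [← e3, cutWeight_compl hr]; exact fun hh => h' (by simpa using hh.compl))
  have f4 : ¬ R (Cᶜ ∩ D) → ¬ R' (C ∩ Dᶜ) → False := fun h h' =>
    not_crosses_optimalCuts_of_corners hr hconn hCc hD hCD.compl_left
      (by rwa [cutWeight_compl hr])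
      (by rw [← e4]; exact fun hh => h' (by simpa using hh.compl))
  have g3 := hRR (Cᶜ ∩ D)
  have g4 := hRR (Cᶜ ∩ Dᶜ)
  by_cases r1 : R (C ∩ D)
  · have r2 : ¬ R (C ∩ Dᶜ) := fun h => hc12 ⟨r1, h⟩
    by_cases r4 : R' (Cᶜ ∩ D)
    · have r1' : ¬ R' (C ∩ D) := fun h => hd14 ⟨h, r4⟩
      exact f3 (fun h => hc34 ⟨h, g3 r4⟩) r1'
    · exact f2 r2 r4
  · by_cases r3 : R' (Cᶜ ∩ Dᶜ)
    · have r2' : ¬ R' (C ∩ Dᶜ) := fun h => hd23 ⟨h, r3⟩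
      exact f4 (fun h => hc34 ⟨g4 r3, h⟩) r2'
    · exact f1 r1 r3

section Invariance

variable (σ : Equiv.Perm V)

theorem edgeBoundary_preimage (hσ : ∀ a b, r (σ a) (σ b) ↔ r a b) (C : Set V) :
    edgeBoundary r (σ ⁻¹' C) = Prod.map σ σ ⁻¹' edgeBoundary r C := by
  ext ⟨a, b⟩
  simp [edgeBoundary, hσ]

theorem encard_edgeBoundary_preimage (hσ : ∀ a b, r (σ a) (σ b) ↔ r a b) (C : Set V) :
    (edgeBoundary r (σ ⁻¹' C)).encard = (edgeBoundary r C).encard := by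
  rw [edgeBoundary_preimage σ hσ]
  exact Set.encard_preimage_of_bijective (σ.prodCongr σ).bijective _

theorem connIn_preimage (hσ : ∀ a b, r (σ a) (σ b) ↔ r a b) {C : Set V} (h : ConnIn r C) :
    ConnIn r (σ ⁻¹' C) := by
  intro A hA hne hne'
  obtain ⟨a, ⟨a', ha', rfl⟩, b, hb, hab⟩ := h (σ '' A) (by rwa [Set.image_subset_iff])
    (hne.image _) (by
      obtain ⟨v, hv, hv'⟩ := hne'
      exact ⟨σ v, hv, by simpa using hv'⟩)
  refine ⟨a', ha', σ.symm b, ⟨by simpa using hb.1, fun h => hb.2 ⟨_, h, by simp⟩⟩, ?_⟩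
  rw [← hσ]; simpa using hab

theorem crosses_preimage_iff (C D : Set V) : Crosses (σ ⁻¹' C) (σ ⁻¹' D) ↔ Crosses C D := by
  have : ∀ A : Set V, (σ ⁻¹' A).Nonempty ↔ A.Nonempty := fun A =>
    σ.surjective.nonempty_preimage
  simp only [Crosses, ← Set.preimage_compl, ← Set.preimage_inter, this]

theorem crossingCuts_preimage_subset (hσ : ∀ a b, r (σ a) (σ b) ↔ r a b) (C : Set V) :
    (fun D => σ ⁻¹' D) '' crossingCuts r N C ⊆ crossingCuts r N (σ ⁻¹' C) := by
  rintro _ ⟨D, ⟨ht, hn, hx⟩, rfl⟩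
  exact ⟨⟨connIn_preimage σ hσ ht.1, connIn_preimage σ hσ ht.2⟩,
    by rwa [encard_edgeBoundary_preimage σ hσ], (crosses_preimage_iff σ D C).2 hx⟩

theorem cutWeight_preimage (hσ : ∀ a b, r (σ a) (σ b) ↔ r a b) (C : Set V) :
    cutWeight r N (σ ⁻¹' C) = cutWeight r N C := by
  have hσ' : ∀ a b, r (σ.symm a) (σ.symm b) ↔ r a b := fun a b => by rw [← hσ]; simp
  have hinj : ∀ ρ : Equiv.Perm V, Function.Injective fun D : Set V => ρ ⁻¹' D := fun ρ =>
    ρ.surjective.preimage_injective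
  have h1 := Set.encard_le_encard (crossingCuts_preimage_subset (N := N) σ hσ C)
  have h2 := Set.encard_le_encard (crossingCuts_preimage_subset (N := N) σ.symm hσ' (σ ⁻¹' C))
  rw [(hinj σ).encard_image] at h1
  rw [(hinj σ.symm).encard_image, ← Set.preimage_comp, Equiv.self_comp_symm,
    Set.preimage_id] at h2
  rw [cutWeight, cutWeight, Set.ncard, encard_edgeBoundary_preimage σ hσ, Set.ncard, Set.ncard,
    Set.ncard, le_antisymm h2 h1]

theorem preimage_mem_optimalCuts (hσ : ∀ a b, r (σ a) (σ b) ↔ r a b) {C : Set V}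
    (hC : C ∈ optimalCuts r N) : σ ⁻¹' C ∈ optimalCuts r N := by
  have hσ' : ∀ a b, r (σ.symm a) (σ.symm b) ↔ r a b := fun a b => by rw [← hσ]; simp
  refine ⟨by rw [encard_edgeBoundary_preimage σ hσ]; exact hC.1, fun h => hC.2 ?_⟩
  have := h.preimage (S' := {D | (edgeBoundary r D).encard ≤ N ∧
    cutWeight r N D < cutWeight r N C}) σ.symm (by
      rintro D ⟨h1, h2⟩
      refine ⟨by rwa [encard_edgeBoundary_preimage σ.symm hσ'], ?_⟩
      rw [cutWeight_preimage σ.symm hσ']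
      exact h2.trans_eq (cutWeight_preimage σ hσ C))
  rwa [← Set.preimage_comp, Equiv.self_comp_symm, Set.preimage_id] at this

end Invariance

end Cuts

/-! ### Free extensions of subgroups -/

/-- `K'` is the free product of its subgroup `K` and of the free group on the subset `Z`,
expressed by the universal property. -/
def IsExt {G : Type u} [Group G] (K : Subgroup G) (Z : Set G) (K' : Subgroup G) : Prop :=
  K' = K ⊔ Subgroup.closure Z ∧ ∀ (P : Type u) [Group P] (α : K →* P) (β : G → P),
    ∃ f : K' →* P, (∀ x (h : x ∈ K) (h' : x ∈ K'), f ⟨x, h'⟩ = α ⟨x, h⟩) ∧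
      ∀ x ∈ Z, ∀ h' : x ∈ K', f ⟨x, h'⟩ = β x

namespace IsExt

variable {G : Type u} [Group G] {K K' K'' : Subgroup G} {Z Z' : Set G}

theorem le (h : IsExt K Z K') : K ≤ K' := h.1 ▸ le_sup_left

theorem subset (h : IsExt K Z K') : Z ⊆ K' :=
  Subgroup.subset_closure.trans (h.1 ▸ (le_sup_right : Subgroup.closure Z ≤ K ⊔ Subgroup.closure Z))

/-- An induction principle for elements of an extension. -/
theorem le_of (h : IsExt K Z K') {L : Subgroup G} (hK : K ≤ L) (hZ : Z ⊆ L) : K' ≤ L := by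
  rw [h.1]; exact sup_le hK ((Subgroup.closure_le _).2 hZ)

theorem exists_hom (h : IsExt K Z K') {P : Type} [Group P] (α : K →* P) (β : G → P) :
    ∃ f : K' →* P, (∀ x (h : x ∈ K) (h' : x ∈ K'), f ⟨x, h'⟩ = α ⟨x, h⟩) ∧
      ∀ x ∈ Z, ∀ h' : x ∈ K', f ⟨x, h'⟩ = β x := by
  obtain ⟨f, h1, h2⟩ := h.2 (ULift.{u} P) (MulEquiv.ulift.symm.toMonoidHom.comp α)
    (fun x => ⟨β x⟩)
  refine ⟨MulEquiv.ulift.toMonoidHom.comp f, fun x hx hx' => ?_, fun x hx hx' => ?_⟩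
  · simp [h1 x hx hx']
  · simp only [MonoidHom.comp_apply, h2 x hx hx']; rfl

theorem notMem (h : IsExt K Z K') {z : G} (hz : z ∈ Z) :
    z ∉ K ⊔ Subgroup.closure (Z \ {z}) := by
  classical
  obtain ⟨f, h1, h2⟩ := h.exists_hom (P := Multiplicative ℤ) 1
    (fun x => if x = z then Multiplicative.ofAdd 1 else 1)
  have hle : K ⊔ Subgroup.closure (Z \ {z}) ≤ f.ker.map K'.subtype := by
    refine sup_le (fun x hx => ⟨⟨x, h.le hx⟩, ?_, rfl⟩) ((Subgroup.closure_le _).2 fun x hx =>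
      ⟨⟨x, h.subset hx.1⟩, ?_, rfl⟩)
    · exact h1 x hx _
    · have := h2 x hx.1 (h.subset hx.1)
      rwa [if_neg (show x ≠ z from hx.2)] at this
  intro hz'
  obtain ⟨⟨y, hy⟩, hy', hyz⟩ := hle hz'
  obtain rfl : y = z := hyz
  have := h2 _ hz hy
  rw [if_pos rfl, show f ⟨y, hy⟩ = 1 from hy'] at this
  exact absurd this (by decide)

theorem notMem_base (h : IsExt K Z K') {z : G} (hz : z ∈ Z) : z ∉ K := fun hK =>
  h.notMem hz (Subgroup.mem_sup_left hK)

theorem empty (K : Subgroup G) : IsExt K ∅ K :=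
  ⟨by simp, fun P _ α _ => ⟨α, fun _ _ _ => rfl, fun _ h => absurd h (by simp)⟩⟩

theorem trans (h : IsExt K Z K') (h' : IsExt K' Z' K'') : IsExt K (Z ∪ Z') K'' := by
  refine ⟨by rw [h'.1, h.1, Subgroup.closure_union, sup_assoc], fun P _ α β => ?_⟩
  obtain ⟨f, h1, h2⟩ := h.2 P α β
  obtain ⟨f', h1', h2'⟩ := h'.2 P f β
  refine ⟨f', fun x hx hx' => by rw [h1' x (h.le hx), h1], ?_⟩
  rintro x (hx | hx) hx'
  · rw [h1' x (h.subset hx), h2 x hx]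
  · exact h2' x hx hx'

/-- Two homomorphisms on an extension agree if they agree on the generators. -/
theorem hom_ext {P : Type*} [Group P] (h : IsExt K Z K') {f g : K' →* P}
    (hK : ∀ x (_ : x ∈ K) (h' : x ∈ K'), f ⟨x, h'⟩ = g ⟨x, h'⟩)
    (hZ : ∀ x ∈ Z, ∀ h' : x ∈ K', f ⟨x, h'⟩ = g ⟨x, h'⟩) : f = g := by
  have hle : K' ≤ (f.eqLocus g).map K'.subtype := h.le_of
    (fun x hx => ⟨⟨x, h.le hx⟩, hK x hx _, rfl⟩) (fun x hx => ⟨⟨x, h.subset hx⟩, hZ x hx _, rfl⟩)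
  ext ⟨x, hx⟩
  obtain ⟨⟨y, hy⟩, hy', rfl⟩ := hle hx
  exact hy'

theorem right_of_union (h : IsExt K (Z ∪ Z') K'') (hd : Disjoint Z Z') :
    IsExt (K ⊔ Subgroup.closure Z) Z' K'' := by
  classical
  suffices ∀ L, L = K ⊔ Subgroup.closure Z → IsExt L Z' K'' from this _ rfl
  intro L hL
  refine ⟨by rw [h.1, hL, Subgroup.closure_union, sup_assoc], fun P _ α β => ?_⟩
  have hKL : K ≤ L := hL ▸ le_sup_left
  have hZL : Z ⊆ L := fun z hz => hL ▸ Subgroup.mem_sup_right (Subgroup.subset_closure hz)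
  obtain ⟨f, h1, h2⟩ := h.2 P (α.comp (Subgroup.inclusion hKL))
    (fun x => if hx : x ∈ Z then α ⟨x, hZL hx⟩ else β x)
  have hLK : L ≤ K'' := hL ▸ sup_le h.le ((Subgroup.closure_le _).2
      (Set.subset_union_left.trans h.subset))
  refine ⟨f, fun x hx hx' => ?_, fun x hx hx' => ?_⟩
  · have hle : L ≤ ((f.comp (Subgroup.inclusion hLK)).eqLocus α).map L.subtype := by
      conv_lhs => rw [hL]
      refine sup_le (fun y hy => ⟨⟨y, hKL hy⟩, ?_, rfl⟩)
        ((Subgroup.closure_le _).2 fun y hy => ⟨⟨y, hZL hy⟩, ?_, rfl⟩)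
      · exact h1 y hy _
      · have := h2 y (Or.inl hy) (hLK (hZL hy))
        rwa [dif_pos hy] at this
    obtain ⟨⟨y, hy⟩, hy', rfl⟩ := hle hx
    exact hy'
  · have := h2 x (Or.inr hx) hx'
    rwa [dif_neg (fun h => Set.disjoint_left.1 hd h hx)] at this

theorem left_of_union (h : IsExt K (Z ∪ Z') K'') : IsExt K Z (K ⊔ Subgroup.closure Z) := by
  refine ⟨rfl, fun P _ α β => ?_⟩
  obtain ⟨f, h1, h2⟩ := h.2 P α β
  have hLK : K ⊔ Subgroup.closure Z ≤ K'' :=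
    sup_le h.le ((Subgroup.closure_le _).2 (Set.subset_union_left.trans h.subset))
  exact ⟨f.comp (Subgroup.inclusion hLK), fun x hx hx' => h1 x hx _,
    fun x hx hx' => h2 x (Or.inl hx) _⟩

theorem map {G' : Type u} [Group G'] (h : IsExt K Z K') (j : G →* G') (hj : Function.Injective j) :
    IsExt (K.map j) (j '' Z) (K'.map j) := by
  refine ⟨by rw [h.1, Subgroup.map_sup, MonoidHom.map_closure], fun P _ α β => ?_⟩
  obtain ⟨f, h1, h2⟩ := h.2 P (α.comp (K.equivMapOfInjective j hj).toMonoidHom) (β ∘ j)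
  refine ⟨f.comp (K'.equivMapOfInjective j hj).symm.toMonoidHom, ?_, ?_⟩
  · rintro _ ⟨x, hx, rfl⟩ hx'
    have hxK' := h.le hx
    have : (K'.equivMapOfInjective j hj).symm ⟨j x, hx'⟩ = ⟨x, hxK'⟩ := by
      rw [MulEquiv.symm_apply_eq]; rfl
    simp only [MonoidHom.comp_apply, MulEquiv.coe_toMonoidHom, this, h1 x hx hxK']
    rfl
  · rintro _ ⟨x, hx, rfl⟩ hx'
    have hxK' := h.subset hx
    have : (K'.equivMapOfInjective j hj).symm ⟨j x, hx'⟩ = ⟨x, hxK'⟩ := by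
      rw [MulEquiv.symm_apply_eq]; rfl
    simp only [MonoidHom.comp_apply, MulEquiv.coe_toMonoidHom, this, h2 x hx hxK', Function.comp]

theorem subgroupOf (h : IsExt K Z K') :
    IsExt (K.subgroupOf K') (((↑) : K' → G) ⁻¹' Z) (⊤ : Subgroup K') := by
  classical
  have hgen : (⊤ : Subgroup K') = K.subgroupOf K' ⊔ Subgroup.closure (((↑) : K' → G) ⁻¹' Z) := by
    symm
    rw [eq_top_iff]
    intro x _
    have hle : K' ≤ (K.subgroupOf K' ⊔ Subgroup.closure (((↑) : K' → G) ⁻¹' Z)).map K'.subtype :=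
      h.le_of (fun y hy => ⟨⟨y, h.le hy⟩, Subgroup.mem_sup_left hy, rfl⟩)
        (fun y hy => ⟨⟨y, h.subset hy⟩,
          Subgroup.mem_sup_right (Subgroup.subset_closure hy), rfl⟩)
    obtain ⟨y, hy, hyx⟩ := hle x.2
    rwa [← Subtype.ext hyx]
  refine ⟨hgen, fun P _ α β => ?_⟩
  obtain ⟨f, h1, h2⟩ := h.2 P
    (α.comp (Subgroup.subgroupOfEquivOfLe h.le).symm.toMonoidHom)
    (fun x => if hx : x ∈ K' then β ⟨x, hx⟩ else 1)
  refine ⟨f.comp (Subgroup.topEquiv.toMonoidHom), ?_, ?_⟩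
  · rintro ⟨x, hx⟩ hxK hx'
    exact h1 x hxK hx
  · rintro ⟨x, hx⟩ hxZ hx'
    have := h2 x hxZ hx
    rw [dif_pos hx] at this
    exact this

/-- For an extension that is the whole group, the homomorphism can be defined on the group. -/
theorem exists_hom_top (h : IsExt K Z ⊤) {P : Type u} [Group P] (α : K →* P) (β : G → P) :
    ∃ f : G →* P, (∀ x (h : x ∈ K), f x = α ⟨x, h⟩) ∧ ∀ x ∈ Z, f x = β x := by
  obtain ⟨f, h1, h2⟩ := h.2 P α β
  exact ⟨f.comp (Subgroup.topEquiv (G := G)).symm.toMonoidHom, fun x hx => h1 x hx trivial,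
    fun x hx => h2 x hx trivial⟩

end IsExt

/-- An elementary extension of `K` by generators adapted to the automorphism `φ`. -/
def Step {G : Type u} [Group G] (φ : MulAut G) (w : G) (K K' : Subgroup G) : Prop :=
  (∃ z, z ≠ φ z ∧ IsExt K {z, φ z} K') ∨ (∃ s, s * φ s * w = 1 ∧ IsExt K {s} K') ∨
    ∃ y, ∃ a ∈ K, ∃ c ∈ K, a * φ a * w = 1 ∧ c * φ c * w = 1 ∧ φ y = a⁻¹ * y * c ∧
      IsExt K {y} K'

section Step

variable {G : Type u} [Group G] {φ : MulAut G} {w : G} {K K' : Subgroup G}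

theorem apply_mem_iff_of_invariant (hφ : ∀ x, φ (φ x) = w * x * w⁻¹) (hw : w ∈ K)
    (hK : ∀ x ∈ K, φ x ∈ K) (x : G) : φ x ∈ K ↔ x ∈ K := by
  refine ⟨fun h => ?_, hK x⟩
  have := hK _ h
  rw [hφ] at this
  have h2 := K.mul_mem (K.mul_mem (K.inv_mem hw) this) hw
  rwa [show w⁻¹ * (w * x * w⁻¹) * w = x by group] at h2

/-- The restriction of an automorphism to an invariant subgroup. -/
def restrictAut (φ : MulAut G) (L : Subgroup G) (hL : ∀ x, φ x ∈ L ↔ x ∈ L) : MulAut L where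
  toFun x := ⟨φ x, (hL x).2 x.2⟩
  invFun x := ⟨φ.symm x, (hL _).1 (by rw [MulEquiv.apply_symm_apply]; exact x.2)⟩
  left_inv x := by simp
  right_inv x := by simp
  map_mul' x y := by simp

@[simp] theorem coe_restrictAut (φ : MulAut G) (L : Subgroup G) (hL : ∀ x, φ x ∈ L ↔ x ∈ L)
    (x : L) : (restrictAut φ L hL x : G) = φ x := rfl

/-- Steps inside an invariant subgroup are steps of the ambient group. -/
theorem Step.map_subtype (L : Subgroup G) (hL : ∀ x, φ x ∈ L ↔ x ∈ L) {w : L} {A A' : Subgroup L}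
    (h : Step (restrictAut φ L hL) w A A') :
    Step φ w (A.map L.subtype) (A'.map L.subtype) := by
  obtain ⟨z, hz, h⟩ | ⟨s, hs, h⟩ | ⟨y, a, ha, c, hc, ha', hc', hy, h⟩ := h
  · refine Or.inl ⟨z, fun h' => hz (Subtype.ext h'), ?_⟩
    simpa [Set.image_pair] using h.map L.subtype L.subtype_injective
  · exact Or.inr (Or.inl ⟨s, congrArg Subtype.val hs,
      by simpa using h.map L.subtype L.subtype_injective⟩)
  · exact Or.inr (Or.inr ⟨y, a, ⟨a, ha, rfl⟩, c, ⟨c, hc, rfl⟩, congrArg Subtype.val ha',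
      congrArg Subtype.val hc', congrArg Subtype.val hy,
      by simpa using h.map L.subtype L.subtype_injective⟩)

end Step

/-! ### Ping-pong -/

/-- A set of elements playing ping-pong against a subgroup `K` extends `K` freely. -/
theorem isExt_of_ping_pong {G : Type u} [Group G] {V : Type*} [MulAction G V] {K : Subgroup G}
    {Z : Set G} (hZ : Z.Nonempty) (P Q : G → Set V) {v₀ : V} (hP₀ : ∀ z ∈ Z, v₀ ∉ P z)
    (hQ₀ : ∀ z ∈ Z, v₀ ∉ Q z)
    (hPP : ∀ z ∈ Z, ∀ z' ∈ Z, z ≠ z' → Disjoint (P z) (P z'))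
    (hQQ : ∀ z ∈ Z, ∀ z' ∈ Z, z ≠ z' → Disjoint (Q z) (Q z'))
    (hPQ : ∀ z ∈ Z, ∀ z' ∈ Z, Disjoint (P z) (Q z'))
    (hKP : ∀ k ∈ K, k ≠ 1 → ∀ z ∈ Z, ∀ z' ∈ Z,
      Disjoint (k • P z) (P z') ∧ Disjoint (k • P z) (Q z'))
    (hKQ : ∀ k ∈ K, k ≠ 1 → ∀ z ∈ Z, ∀ z' ∈ Z,
      Disjoint (k • Q z) (P z') ∧ Disjoint (k • Q z) (Q z'))
    (hz : ∀ z ∈ Z, ∀ v, v ∉ Q z → z • v ∈ P z) :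
    IsExt K Z (K ⊔ Subgroup.closure Z) := by
  classical
  have hz' : ∀ z ∈ Z, ∀ v, v ∉ P z → z⁻¹ • v ∈ Q z := by
    intro z hzZ v hv
    by_contra hcon
    exact hv (by simpa using hz z hzZ _ hcon)
  have hpos : ∀ z ∈ Z, ∀ v, v ∉ Q z → ∀ n : ℕ, z ^ (n + 1) • v ∈ P z := by
    intro z hzZ v hv n
    induction n with
    | zero => simpa using hz z hzZ v hv
    | succ n ih =>
      rw [pow_succ', mul_smul]
      exact hz z hzZ _ (Set.disjoint_left.1 (hPQ z hzZ z hzZ) ih)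
  have hneg : ∀ z ∈ Z, ∀ v, v ∉ P z → ∀ n : ℕ, z⁻¹ ^ (n + 1) • v ∈ Q z := by
    intro z hzZ v hv n
    induction n with
    | zero => simpa using hz' z hzZ v hv
    | succ n ih =>
      rw [pow_succ', mul_smul]
      exact hz' z hzZ _ (Set.disjoint_right.1 (hPQ z hzZ z hzZ) ih)
  have hzpow : ∀ z ∈ Z, ∀ v, v ∉ P z → v ∉ Q z → ∀ n : ℤ, n ≠ 0 → z ^ n • v ∈ P z ∪ Q z := by
    intro z hzZ v hv hv' n hn
    obtain ⟨m, rfl | rfl⟩ := n.eq_nat_or_neg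
    · obtain ⟨m, rfl⟩ := Nat.exists_eq_succ_of_ne_zero (n := m) (by simpa using hn)
      exact Or.inl (by exact_mod_cast hpos z hzZ v hv' m)
    · obtain ⟨m, rfl⟩ := Nat.exists_eq_succ_of_ne_zero (n := m) (by simpa using hn)
      refine Or.inr ?_
      have := hneg z hzZ v hv m
      rw [inv_pow] at this
      rw [zpow_neg, zpow_natCast]; exact this
  have hinj : ∀ z ∈ Z, Function.Injective (zpowersHom G z) := by
    intro z hzZ
    rw [injective_iff_map_eq_one]
    intro n hn
    rw [zpowersHom_apply] at hn
    by_contra hne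
    have := hzpow z hzZ v₀ (hP₀ z hzZ) (hQ₀ z hzZ) n.toAdd (by simpa using hne)
    rw [hn, one_smul] at this
    exact this.elim (hP₀ z hzZ) (hQ₀ z hzZ)
  let S : Option Z → Subgroup G := fun i => i.elim K fun z => (zpowersHom G (z : G)).range
  let W : Option Z → Set V := fun i => i.elim (⋃ z ∈ Z, P z ∪ Q z)ᶜ fun z => P z ∪ Q z
  have hZnt : Nontrivial (Option Z) := ⟨none, some ⟨_, hZ.some_mem⟩, by simp⟩
  have hinjΦ : Function.Injective (Monoid.CoprodI.lift fun i => (S i).subtype) := by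
    refine Monoid.CoprodI.lift_injective_of_ping_pong (fun i => (S i).subtype) ?_ W ?_ ?_ ?_
    · obtain ⟨z, hzZ⟩ := hZ
      refine Or.inr ⟨some ⟨z, hzZ⟩, ?_⟩
      have : Infinite (S (some ⟨z, hzZ⟩)) :=
        Infinite.of_injective _ (MonoidHom.ofInjective (hinj z hzZ)).injective
      exact (Cardinal.ofNat_le_aleph0 (n := 3)).trans (Cardinal.aleph0_le_mk _)
    · rintro (_ | ⟨z, hzZ⟩)
      · exact ⟨v₀, by simpa [W] using fun z hzZ => ⟨hP₀ z hzZ, hQ₀ z hzZ⟩⟩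
      · exact ⟨z • v₀, Or.inl (hz z hzZ _ (hQ₀ z hzZ))⟩
    · have hnone : ∀ z : Z, Disjoint (W none) (W (some z)) := fun z =>
        Set.disjoint_left.2 fun v hv hv' => hv (Set.mem_biUnion z.2 hv')
      rintro (_ | z) (_ | z') hne
      · exact absurd rfl hne
      · exact hnone z'
      · exact (hnone z).symm
      · have hzz : (z : G) ≠ z' := fun h => hne (by rw [Subtype.ext h])
        simp only [W, Option.elim, Function.onFun, Set.disjoint_union_left,
          Set.disjoint_union_right]
        exact ⟨⟨hPP z z.2 z' z'.2 hzz, (hPQ z' z'.2 z z.2).symm⟩, hPQ z z.2 z' z'.2,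
          hQQ z z.2 z' z'.2 hzz⟩
    · rintro (_ | z) (_ | z') hne h hh
      · exact absurd rfl hne
      · have hk1 : (h : G) ≠ 1 := fun h' => hh (Subtype.ext h')
        rintro _ ⟨v, hv, rfl⟩ hv'
        obtain ⟨z, hzZ, hv'⟩ := Set.mem_iUnion₂.1 hv'
        rcases hv with hv | hv
        · have := hKP h h.2 hk1 z' z'.2 z hzZ
          exact hv'.elim (Set.disjoint_left.1 this.1 ⟨v, hv, rfl⟩)
            (Set.disjoint_left.1 this.2 ⟨v, hv, rfl⟩)
        · have := hKQ h h.2 hk1 z' z'.2 z hzZ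
          exact hv'.elim (Set.disjoint_left.1 this.1 ⟨v, hv, rfl⟩)
            (Set.disjoint_left.1 this.2 ⟨v, hv, rfl⟩)
      all_goals
        obtain ⟨h, n, rfl⟩ := h
        have hn : n.toAdd ≠ 0 := by
          intro hn
          refine hh (Subtype.ext ?_)
          change zpowersHom G (z : G) n = 1
          rw [zpowersHom_apply, hn, zpow_zero]
        rintro _ ⟨v, hv, rfl⟩
        change (zpowersHom G (z : G) n) • v ∈ P z ∪ Q z
        rw [zpowersHom_apply]
      · have hv1 : v ∉ P z := fun h => hv (Set.mem_biUnion z.2 (Or.inl h))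
        have hv2 : v ∉ Q z := fun h => hv (Set.mem_biUnion z.2 (Or.inr h))
        exact hzpow z z.2 v hv1 hv2 _ hn
      · have hzz : (z' : G) ≠ z := fun h => hne (by rw [Subtype.ext h])
        refine hzpow z z.2 v ?_ ?_ _ hn
        · exact hv.elim (fun h => Set.disjoint_left.1 (hPP _ z'.2 _ z.2 hzz) h)
            (fun h => Set.disjoint_right.1 (hPQ _ z.2 _ z'.2) h)
        · exact hv.elim (fun h => Set.disjoint_left.1 (hPQ _ z'.2 _ z.2) h)
            (fun h => Set.disjoint_left.1 (hQQ _ z'.2 _ z.2 hzz) h)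
  have hrange : K ⊔ Subgroup.closure Z ≤ (Monoid.CoprodI.lift fun i => (S i).subtype).range := by
    refine sup_le (fun k hk => ⟨Monoid.CoprodI.of (i := none) ⟨k, hk⟩, by simp⟩)
      ((Subgroup.closure_le _).2 fun z hzZ => ?_)
    refine ⟨Monoid.CoprodI.of (i := some ⟨z, hzZ⟩) ⟨z, Multiplicative.ofAdd 1, by simp⟩, by simp⟩
  refine ⟨rfl, fun T _ α β => ?_⟩
  let αs : ∀ i, S i →* T := fun i => match i with
    | none => α
    | some z => (zpowersHom T (β z)).comp (MonoidHom.ofInjective (hinj z z.2)).symm.toMonoidHom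
  let f := ((Monoid.CoprodI.lift αs).comp (MonoidHom.ofInjective hinjΦ).symm.toMonoidHom).comp
    (Subgroup.inclusion hrange)
  have hf : ∀ (i : Option Z) (x : S i) (hx : (x : G) ∈ K ⊔ Subgroup.closure Z),
      f ⟨x, hx⟩ = αs i x := by
    intro i x hx
    have : (MonoidHom.ofInjective hinjΦ).symm ⟨x, hrange hx⟩ =
        Monoid.CoprodI.of (M := fun i => S i) x := by
      rw [MulEquiv.symm_apply_eq]
      ext
      rw [MonoidHom.ofInjective_apply, Monoid.CoprodI.lift_of]
      rfl
    change Monoid.CoprodI.lift αs ((MonoidHom.ofInjective hinjΦ).symm ⟨x, hrange hx⟩) = _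
    rw [this, Monoid.CoprodI.lift_of]
  refine ⟨f, fun x hx hx' => hf none ⟨x, hx⟩ hx', fun x hx hx' => ?_⟩
  have hxS : x ∈ (zpowersHom G x).range := ⟨Multiplicative.ofAdd 1, by simp⟩
  rw [hf (some ⟨x, hx⟩) ⟨x, hxS⟩ hx']
  have : (MonoidHom.ofInjective (hinj x hx)).symm ⟨x, hxS⟩ = Multiplicative.ofAdd 1 := by
    rw [MulEquiv.symm_apply_eq]
    ext
    rw [MonoidHom.ofInjective_apply]
    simp
  change zpowersHom T (β x) ((MonoidHom.ofInjective (hinj x hx)).symm ⟨x, hxS⟩) = _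
  rw [this]; simp

/-! ### Nested systems of cuts -/

/-- A nested discrete system of cuts closed under complements. -/
structure CutSystem {V : Type*} (𝒟 : Set (Set V)) : Prop where
  nonempty : ∀ D ∈ 𝒟, D.Nonempty
  compl : ∀ D ∈ 𝒟, Dᶜ ∈ 𝒟
  nested : ∀ C ∈ 𝒟, ∀ D ∈ 𝒟, C ⊆ D ∨ D ⊆ C ∨ C ⊆ Dᶜ ∨ Dᶜ ⊆ C
  finite : ∀ x y, {D | D ∈ 𝒟 ∧ x ∉ D ∧ y ∈ D}.Finite

/-- The cuts containing `y` but not `x`. -/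
def sepCuts {V : Type*} (𝒟 : Set (Set V)) (x y : V) : Set (Set V) := {D | D ∈ 𝒟 ∧ x ∉ D ∧ y ∈ D}

/-- The maximal cuts that do not contain `v`. -/
def outerCuts {V : Type*} (𝒟 : Set (Set V)) (v : V) : Set (Set V) :=
  {D | D ∈ 𝒟 ∧ v ∉ D ∧ ∀ E ∈ 𝒟, v ∉ E → D ⊆ E → E = D}

/-- Two distinct cuts are coadjacent if the second is the complement of a cut covering the first. -/
def Coadj {V : Type*} (𝒟 : Set (Set V)) (D D' : Set V) : Prop :=
  D ⊂ D'ᶜ ∧ ∀ E ∈ 𝒟, D ⊆ E → E ⊆ D'ᶜ → E = D ∨ E = D'ᶜ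

section CutSystem

variable {V : Type*} {𝒟 : Set (Set V)} {C D D' D'' : Set V} {v v' : V}

theorem CutSystem.cases_of_notMem (h𝒟 : CutSystem 𝒟) (hC : C ∈ 𝒟) (hD : D ∈ 𝒟) (hv : v ∉ C)
    (hv' : v ∉ D) : C ⊆ D ∨ D ⊆ C ∨ C ⊆ Dᶜ := by
  rcases h𝒟.nested C hC D hD with h | h | h | h
  · exact Or.inl h
  · exact Or.inr (Or.inl h)
  · exact Or.inr (Or.inr h)
  · exact absurd (h hv') hv

theorem CutSystem.exists_maximal_sepCuts (h𝒟 : CutSystem 𝒟) (hD : D ∈ sepCuts 𝒟 v v') :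
    ∃ A ∈ outerCuts 𝒟 v, D ⊆ A ∧ A ∈ sepCuts 𝒟 v v' := by
  obtain ⟨A, hA, hmax⟩ := (Set.Finite.subset (h𝒟.finite v v')
    (fun E hE => hE.1 : {E | E ∈ sepCuts 𝒟 v v' ∧ D ⊆ E} ⊆ sepCuts 𝒟 v v')).exists_maximal
    ⟨D, hD, subset_rfl⟩
  refine ⟨A, ⟨hA.1.1, hA.1.2.1, fun E hE hvE hAE => ?_⟩, hA.2, hA.1⟩
  exact (hmax ⟨⟨hE, hvE, hAE hA.1.2.2⟩, hA.2.trans hAE⟩ hAE).antisymm hAE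

theorem CutSystem.exists_outerCuts (h𝒟 : CutSystem 𝒟) (hD : D ∈ 𝒟) (hv : v ∉ D) :
    ∃ A ∈ outerCuts 𝒟 v, D ⊆ A := by
  obtain ⟨u, hu⟩ := h𝒟.nonempty D hD
  obtain ⟨A, hA, h, -⟩ := h𝒟.exists_maximal_sepCuts (v' := u) ⟨hD, hv, hu⟩
  exact ⟨A, hA, h⟩

theorem CutSystem.disjoint_outerCuts (h𝒟 : CutSystem 𝒟) (hD : D ∈ outerCuts 𝒟 v)
    (hD' : D' ∈ outerCuts 𝒟 v) (hne : D ≠ D') : Disjoint D D' := by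
  rcases h𝒟.cases_of_notMem hD.1 hD'.1 hD.2.1 hD'.2.1 with h | h | h
  · exact absurd (hD.2.2 _ hD'.1 hD'.2.1 h).symm hne
  · exact absurd (hD'.2.2 _ hD.1 hD.2.1 h) hne
  · exact Set.disjoint_left.2 h

theorem CutSystem.mem_of_mem_outerCuts (h𝒟 : CutSystem 𝒟) {A : Set V} (hA : A ∈ outerCuts 𝒟 v)
    (hA' : A ∈ outerCuts 𝒟 v') (hD : D ∈ 𝒟) (hv : v' ∈ D) : v ∈ D := by
  by_contra hvD
  rcases h𝒟.cases_of_notMem hA.1 hD hA.2.1 hvD with h | h | h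
  · exact hA'.2.1 (hA.2.2 D hD hvD h ▸ hv)
  · exact hA'.2.1 (h hv)
  · have := hA'.2.2 _ (h𝒟.compl D hD) (fun h => h hv) h
    exact hA.2.1 (this ▸ hvD)

theorem CutSystem.mem_iff_of_mem_outerCuts (h𝒟 : CutSystem 𝒟) {A : Set V}
    (hA : A ∈ outerCuts 𝒟 v) (hA' : A ∈ outerCuts 𝒟 v') (hD : D ∈ 𝒟) : v' ∈ D ↔ v ∈ D :=
  ⟨h𝒟.mem_of_mem_outerCuts hA hA' hD, h𝒟.mem_of_mem_outerCuts hA' hA hD⟩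

theorem Coadj.symm (h𝒟 : CutSystem 𝒟) (h : Coadj 𝒟 D D') : Coadj 𝒟 D' D := by
  refine ⟨⟨Set.subset_compl_comm.1 h.1.subset,
    fun h' => h.1.2 (Set.compl_subset_comm.1 h')⟩, fun E hE h1 h2 => ?_⟩
  rcases h.2 Eᶜ (h𝒟.compl E hE) (Set.subset_compl_comm.1 h2) (Set.compl_subset_compl.2 h1)
    with h | h
  · exact Or.inr (by rw [← h, compl_compl])
  · exact Or.inl (compl_injective h)

theorem Coadj.trans (h𝒟 : CutSystem 𝒟) (hD : D ∈ 𝒟) (hD' : D' ∈ 𝒟) (hD'' : D'' ∈ 𝒟)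
    (h : Coadj 𝒟 D D') (h' : Coadj 𝒟 D' D'') (hne : D ≠ D'') : Coadj 𝒟 D D'' := by
  have h's := h'.symm h𝒟
  obtain ⟨x, hx⟩ := h𝒟.nonempty D hD
  obtain ⟨x', hx'⟩ := h𝒟.nonempty D' hD'
  obtain ⟨x'', hx''⟩ := h𝒟.nonempty D'' hD''
  have hsub : D ⊆ D''ᶜ := by
    rcases h𝒟.nested D hD D'' hD'' with h1 | h1 | h1 | h1
    · rcases h.2 D'' hD'' h1 h's.1.subset with h2 | h2
      · exact absurd h2.symm hne
      · exact absurd h2 h's.1.ne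
    · rcases h's.2 D hD h1 h.1.subset with h2 | h2
      · exact absurd h2 hne
      · exact absurd h2 h.1.ne
    · exact h1
    · exact absurd hx' (h.1.subset (h1 (h'.1.subset hx')))
  have hne' : D ≠ D''ᶜ := by
    intro h1
    exact absurd hx' (h.1.subset (h1 ▸ h'.1.subset hx'))
  refine ⟨hsub.ssubset_of_ne hne', fun E hE h1 h2 => ?_⟩
  rcases h𝒟.nested E hE D' hD' with h3 | h3 | h3 | h3
  · exact absurd (h3 (h1 hx)) (h.1.subset hx)
  · rcases h's.2 Eᶜ (h𝒟.compl E hE) (Set.subset_compl_comm.1 h2)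
      (Set.compl_subset_compl.2 h3) with h4 | h4
    · exact Or.inr (by rw [← h4, compl_compl])
    · exact absurd (compl_injective h4 ▸ h1 hx) (h.1.subset hx)
  · rcases h.2 E hE h1 h3 with h4 | h4
    · exact Or.inl h4
    · exact absurd hx'' (h2 (h4 ▸ h's.1.subset hx''))
  · exact absurd hx'' (h2 (h3 (h's.1.subset hx'')))

theorem Coadj.mem_outerCuts (h𝒟 : CutSystem 𝒟) (hD' : D' ∈ 𝒟) (h : Coadj 𝒟 D D')
    (hD : D ∈ outerCuts 𝒟 v) : D' ∈ outerCuts 𝒟 v := by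
  have hv : v ∉ D' := fun hv => h.1.ne (hD.2.2 _ (h𝒟.compl D' hD') (fun h => h hv) h.1.subset).symm
  refine ⟨hD', hv, fun E hE hvE hsub => ?_⟩
  obtain ⟨x', hx'⟩ := h𝒟.nonempty D' hD'
  rcases h𝒟.cases_of_notMem hE hD.1 hvE hD.2.1 with h1 | h1 | h1
  · exact absurd hx' (h.1.subset (h1 (hsub hx')))
  · exact absurd hx' (h.1.subset (hD.2.2 E hE hvE h1 ▸ hsub hx'))
  · rcases (h.symm h𝒟).2 E hE hsub h1 with h2 | h2
    · exact h2
    · exact absurd (h2 ▸ hD.2.1) hvE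

theorem outerCuts_congr (h : ∀ D ∈ 𝒟, v' ∈ D ↔ v ∈ D) : outerCuts 𝒟 v' = outerCuts 𝒟 v := by
  ext D
  constructor
  · rintro ⟨h1, h2, h3⟩
    exact ⟨h1, fun hv => h2 ((h D h1).2 hv), fun E hE hv => h3 E hE fun hv' => hv ((h E hE).1 hv')⟩
  · rintro ⟨h1, h2, h3⟩
    exact ⟨h1, fun hv => h2 ((h D h1).1 hv), fun E hE hv => h3 E hE fun hv' => hv ((h E hE).2 hv')⟩

section Perm

variable (σ : Equiv.Perm V)

theorem image_mem_outerCuts_iff (hσ : ∀ D, σ '' D ∈ 𝒟 ↔ D ∈ 𝒟) :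
    σ '' D ∈ outerCuts 𝒟 (σ v) ↔ D ∈ outerCuts 𝒟 v := by
  simp only [outerCuts, Set.mem_ofPred_eq, hσ, σ.injective.mem_set_image]
  refine and_congr_right fun _ => and_congr_right fun _ => ⟨fun h E hE hv hD => ?_,
    fun h E hE hv hD => ?_⟩
  · exact σ.injective.image_injective (h (σ '' E) ((hσ E).2 hE)
      (by rwa [σ.injective.mem_set_image]) (Set.image_mono hD))
  · obtain ⟨E, rfl⟩ : ∃ E', E = σ '' E' := ⟨σ ⁻¹' E, (σ.image_preimage E).symm⟩
    rw [h E ((hσ E).1 hE) (by rwa [σ.injective.mem_set_image] at hv)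
      ((Set.image_subset_image_iff σ.injective).1 hD)]

theorem Coadj.image (hσ : ∀ D, σ '' D ∈ 𝒟 ↔ D ∈ 𝒟) (h : Coadj 𝒟 D D') :
    Coadj 𝒟 (σ '' D) (σ '' D') := by
  rw [Coadj, ← Set.image_compl_eq σ.bijective]
  refine ⟨⟨Set.image_mono h.1.subset,
      fun h' => h.1.2 ((Set.image_subset_image_iff σ.injective).1 h')⟩,
    fun E hE h1 h2 => ?_⟩
  obtain ⟨E, rfl⟩ : ∃ E', E = σ '' E' := ⟨σ ⁻¹' E, (σ.image_preimage E).symm⟩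
  rw [Set.image_subset_image_iff σ.injective] at h1 h2
  exact (h.2 E ((hσ E).1 hE) h1 h2).imp (congrArg _) (congrArg _)

theorem mem_sepCuts_image_iff (hσ : ∀ D, σ '' D ∈ 𝒟 ↔ D ∈ 𝒟) :
    σ '' D ∈ sepCuts 𝒟 (σ v) (σ v') ↔ D ∈ sepCuts 𝒟 v v' := by
  simp only [sepCuts, Set.mem_ofPred_eq, hσ, σ.injective.mem_set_image]

end Perm

end CutSystem

/-! ### Twisted actions and equivariant cut systems -/

/-- A permutation `τ` of a transitive `G`-set realising the automorphism `φ`, whose square is the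
translation by `w`. -/
structure TwistedAction {G : Type*} [Group G] {V : Type*} [MulAction G V] (φ : MulAut G) (w : G)
    (τ : Equiv.Perm V) (v₀ : V) : Prop where
  map_smul : ∀ (g : G) (v : V), τ (g • v) = φ g • τ v
  sq : ∀ v, τ (τ v) = w • v
  base : τ v₀ = v₀
  trans : ∀ v, ∃ g : G, g • v₀ = v
  aut_sq : ∀ x, φ (φ x) = w * x * w⁻¹
  aut_fix : φ w = w

/-- A cut system on which `G` acts freely and which is invariant under `τ`. -/
structure EquivCuts (G : Type*) [Group G] {V : Type*} [MulAction G V] (τ : Equiv.Perm V)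
    (𝒟 : Set (Set V)) : Prop extends CutSystem 𝒟 where
  smul_mem : ∀ (g : G), ∀ D ∈ 𝒟, g • D ∈ 𝒟
  image_mem : ∀ D ∈ 𝒟, τ '' D ∈ 𝒟
  free : ∀ (g : G), ∀ D ∈ 𝒟, g • D = D → g = 1

/-- The elements moving `v₀` to a point that is not separated from `v₀`. -/
def cutStab (G : Type*) [Group G] {V : Type*} [MulAction G V] (𝒟 : Set (Set V)) (v₀ : V) :
    Subgroup G where
  carrier := {g | ∀ h : G, ∀ D ∈ 𝒟, h • g • v₀ ∈ D ↔ h • v₀ ∈ D}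
  one_mem' := fun h D _ => by simp
  mul_mem' := fun {a b} ha hb h D hD => by
    have := hb (h * a) D hD
    rw [mul_smul, mul_smul] at this
    rw [mul_smul, this, ha h D hD]
  inv_mem' := fun {a} ha h D hD => by
    have := ha (h * a⁻¹) D hD
    rw [smul_smul, inv_mul_cancel_right, mul_smul] at this
    exact this.symm

/-- The cuts whose class under `G` and `τ` and complementation is that of `C`. -/
def cutOrbit (G : Type*) [Group G] {V : Type*} [MulAction G V] (τ : Equiv.Perm V) (C : Set V) :
    Set (Set V) :=
  {D | ∃ g : G, D = g • C ∨ D = g • Cᶜ ∨ D = g • τ '' C ∨ D = g • (τ '' C)ᶜ}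

/-- A cut which is not maximal at any point has no coadjacent translates. -/
def RigidCuts (G : Type*) [Group G] {V : Type*} [MulAction G V] (𝒟 : Set (Set V)) : Prop :=
  ∀ Q ∈ 𝒟, (∀ v, Q ∉ outerCuts 𝒟 v) → ∀ g : G, Coadj 𝒟 Q (g • Q) → g = 1

section Twisted

variable {G : Type u} [Group G] {V : Type*} [MulAction G V] {φ : MulAut G} {w : G}
  {τ : Equiv.Perm V} {v₀ : V} {𝒟 : Set (Set V)} {C D Q R : Set V}

theorem image_image_eq (hτ : TwistedAction φ w τ v₀) (D : Set V) : τ '' (τ '' D) = w • D := by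
  rw [Set.image_image]
  exact Set.image_congr fun v _ => hτ.sq v

theorem image_smul_eq (hτ : TwistedAction φ w τ v₀) (g : G) (D : Set V) :
    τ '' (g • D) = φ g • τ '' D := by
  rw [← Set.image_smul, ← Set.image_smul, Set.image_image, Set.image_image]
  exact Set.image_congr fun v _ => hτ.map_smul g v

theorem image_compl_perm (τ : Equiv.Perm V) (D : Set V) : τ '' Dᶜ = (τ '' D)ᶜ :=
  Set.image_compl_eq τ.bijective

theorem TwistedAction.smul_base (hτ : TwistedAction φ w τ v₀) : w • v₀ = v₀ := by
  rw [← hτ.sq, hτ.base, hτ.base]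

theorem TwistedAction.map_smul_base (hτ : TwistedAction φ w τ v₀) (g : G) :
    τ (g • v₀) = φ g • v₀ := by
  rw [hτ.map_smul, hτ.base]

namespace EquivCuts

theorem smul_mem_iff (h𝒟 : EquivCuts G τ 𝒟) (g : G) (D : Set V) : g • D ∈ 𝒟 ↔ D ∈ 𝒟 :=
  ⟨fun h => by simpa using h𝒟.smul_mem g⁻¹ _ h, h𝒟.smul_mem g D⟩

theorem image_mem_iff (h𝒟 : EquivCuts G τ 𝒟) (hτ : TwistedAction φ w τ v₀) (D : Set V) :
    τ '' D ∈ 𝒟 ↔ D ∈ 𝒟 := by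
  refine ⟨fun h => ?_, h𝒟.image_mem D⟩
  have := h𝒟.image_mem _ h
  rwa [image_image_eq hτ, h𝒟.smul_mem_iff] at this

theorem smul_mem_outerCuts_iff (h𝒟 : EquivCuts G τ 𝒟) (g : G) (v : V) :
    g • D ∈ outerCuts 𝒟 (g • v) ↔ D ∈ outerCuts 𝒟 v :=
  image_mem_outerCuts_iff (MulAction.toPerm g) (h𝒟.smul_mem_iff g)

theorem smul_mem_outerCuts_iff' (h𝒟 : EquivCuts G τ 𝒟) (g : G) (v : V) :
    g • D ∈ outerCuts 𝒟 v ↔ D ∈ outerCuts 𝒟 (g⁻¹ • v) := by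
  rw [← h𝒟.smul_mem_outerCuts_iff g (g⁻¹ • v), smul_inv_smul]

theorem image_mem_outerCuts (h𝒟 : EquivCuts G τ 𝒟) (hτ : TwistedAction φ w τ v₀) {v : V} :
    τ '' D ∈ outerCuts 𝒟 (τ v) ↔ D ∈ outerCuts 𝒟 v :=
  image_mem_outerCuts_iff τ (h𝒟.image_mem_iff hτ)

theorem image_mem_outerCuts_base (h𝒟 : EquivCuts G τ 𝒟) (hτ : TwistedAction φ w τ v₀) :
    τ '' D ∈ outerCuts 𝒟 v₀ ↔ D ∈ outerCuts 𝒟 v₀ := by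
  rw [← h𝒟.image_mem_outerCuts hτ (D := D), hτ.base]

theorem coadj_smul (h𝒟 : EquivCuts G τ 𝒟) (g : G) (h : Coadj 𝒟 Q R) :
    Coadj 𝒟 (g • Q) (g • R) :=
  Coadj.image (MulAction.toPerm g) (h𝒟.smul_mem_iff g) h

theorem coadj_image (h𝒟 : EquivCuts G τ 𝒟) (hτ : TwistedAction φ w τ v₀) (h : Coadj 𝒟 Q R) :
    Coadj 𝒟 (τ '' Q) (τ '' R) :=
  Coadj.image τ (h𝒟.image_mem_iff hτ) h

theorem smul_mem_sepCuts_iff (h𝒟 : EquivCuts G τ 𝒟) (g : G) {x y : V} :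
    g • D ∈ sepCuts 𝒟 (g • x) (g • y) ↔ D ∈ sepCuts 𝒟 x y :=
  mem_sepCuts_image_iff (MulAction.toPerm g) (h𝒟.smul_mem_iff g)

theorem mem_cutStab_iff (h𝒟 : EquivCuts G τ 𝒟) {g : G} :
    g ∈ cutStab G 𝒟 v₀ ↔ ∀ D ∈ 𝒟, g • v₀ ∈ D ↔ v₀ ∈ D := by
  refine ⟨fun h D hD => by simpa using h 1 D hD, fun h a D hD => ?_⟩
  have := h (a⁻¹ • D) (h𝒟.smul_mem _ _ hD)
  simpa [Set.mem_inv_smul_set_iff] using this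

theorem mem_cutStab_iff_sepCuts (h𝒟 : EquivCuts G τ 𝒟) {g : G} :
    g ∈ cutStab G 𝒟 v₀ ↔ sepCuts 𝒟 v₀ (g • v₀) = ∅ := by
  rw [h𝒟.mem_cutStab_iff, Set.eq_empty_iff_forall_notMem]
  refine ⟨fun h D hD => hD.2.1 ((h D hD.1).1 hD.2.2), fun h D hD => ⟨fun h1 => ?_, fun h1 => ?_⟩⟩
  · by_contra h2
    exact h D ⟨hD, h2, h1⟩
  · by_contra h2
    exact h Dᶜ ⟨h𝒟.compl D hD, fun h => h h1, h2⟩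

theorem inv_mul_mem_cutStab (h𝒟 : EquivCuts G τ 𝒟) {g h : G} (hg : D ∈ outerCuts 𝒟 (g • v₀))
    (hh : D ∈ outerCuts 𝒟 (h • v₀)) : g⁻¹ * h ∈ cutStab G 𝒟 v₀ := by
  rw [h𝒟.mem_cutStab_iff]
  intro E hE
  have := h𝒟.mem_iff_of_mem_outerCuts hg hh (h𝒟.smul_mem g E hE)
  rw [mul_smul, Set.mem_smul_set_iff_inv_smul_mem, Set.mem_smul_set_iff_inv_smul_mem] at *
  simpa using this

theorem mem_cutStab_of_smul (h𝒟 : EquivCuts G τ 𝒟) {g : G} (hD : D ∈ outerCuts 𝒟 v₀)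
    (hg : g • D ∈ outerCuts 𝒟 v₀) : g ∈ cutStab G 𝒟 v₀ := by
  rw [h𝒟.smul_mem_outerCuts_iff'] at hg
  have := h𝒟.inv_mul_mem_cutStab hg ((one_smul G v₀).symm ▸ hD : D ∈ outerCuts 𝒟 ((1 : G) • v₀))
  simpa using this

theorem outerCuts_smul_base (h𝒟 : EquivCuts G τ 𝒟) {k : G} (hk : k ∈ cutStab G 𝒟 v₀) :
    outerCuts 𝒟 (k • v₀) = outerCuts 𝒟 v₀ :=
  outerCuts_congr (h𝒟.mem_cutStab_iff.1 hk)

theorem smul_mem_outerCuts_base (h𝒟 : EquivCuts G τ 𝒟) {k : G} (hk : k ∈ cutStab G 𝒟 v₀)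
    (hD : D ∈ outerCuts 𝒟 v₀) : k • D ∈ outerCuts 𝒟 v₀ := by
  rw [← h𝒟.outerCuts_smul_base hk]
  exact (h𝒟.smul_mem_outerCuts_iff k v₀).2 hD

theorem smul_ne_compl (h𝒟 : EquivCuts G τ 𝒟) (htf : ∀ g : G, g * g = 1 → g = 1) (hD : D ∈ 𝒟)
    (g : G) : g • D ≠ Dᶜ := by
  intro h
  have h2 : (g * g) • D = D := by rw [mul_smul, h, Set.smul_set_compl, h, compl_compl]
  have h1 := htf g (h𝒟.free _ D hD h2)
  rw [h1, one_smul] at h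
  obtain ⟨x, hx⟩ := h𝒟.nonempty D hD
  exact absurd hx (h ▸ hx : x ∈ Dᶜ)

theorem eq_of_smul_eq (h𝒟 : EquivCuts G τ 𝒟) (hD : D ∈ 𝒟) {g h : G} (heq : g • D = h • D) :
    g = h := by
  have : (h⁻¹ * g) • D = D := by rw [mul_smul, heq, inv_smul_smul]
  exact (inv_mul_eq_one.1 (h𝒟.free _ D hD this)).symm

theorem mem_cutStab_of_fix (h𝒟 : EquivCuts G τ 𝒟) {g : G} (hg : g • v₀ = v₀) :
    g ∈ cutStab G 𝒟 v₀ := by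
  rw [h𝒟.mem_cutStab_iff, hg]
  simp

theorem smul_sepCuts_subset (h𝒟 : EquivCuts G τ 𝒟) {g h : G} {T : Set (Set V)}
    (hg : g ∈ cutStab G 𝒟 v₀) (hT : sepCuts 𝒟 v₀ (h • v₀) ⊆ T) {E : Set V}
    (hE : E ∈ sepCuts 𝒟 v₀ ((g * h) • v₀)) : ∃ E' ∈ T, E = g • E' := by
  refine ⟨g⁻¹ • E, hT ?_, by simp⟩
  have h1 : E ∈ sepCuts 𝒟 (g • v₀) ((g * h) • v₀) := ⟨hE.1,
    fun h => hE.2.1 ((h𝒟.mem_cutStab_iff.1 hg E hE.1).1 h), hE.2.2⟩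
  rw [mul_smul] at h1
  rw [← h𝒟.smul_mem_sepCuts_iff g]
  simpa using h1

theorem sepCuts_inv_subset (h𝒟 : EquivCuts G τ 𝒟) {h : G} {T : Set (Set V)}
    (hT : sepCuts 𝒟 v₀ (h • v₀) ⊆ T) {E : Set V}
    (hE : E ∈ sepCuts 𝒟 v₀ (h⁻¹ • v₀)) : ∃ E' ∈ T, E = h⁻¹ • E'ᶜ := by
  have h1 := (h𝒟.smul_mem_sepCuts_iff h).2 hE
  rw [smul_inv_smul] at h1
  refine ⟨(h • E)ᶜ, hT ⟨h𝒟.compl _ h1.1, fun h => h h1.2.2, h1.2.1⟩, by simp⟩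

/-- A subgroup containing the stabilizer is large if it realises enough separations. -/
theorem cutStab_le_of_sepCuts (h𝒟 : EquivCuts G τ 𝒟) {K' L : Subgroup G}
    (hKL : cutStab G 𝒟 v₀ ≤ L) (hLK : L ≤ K')
    (hgen : ∀ g ∈ K', g ∉ cutStab G 𝒟 v₀ → ∃ l ∈ L, (sepCuts 𝒟 v₀ (l • v₀)).Nonempty ∧
      sepCuts 𝒟 v₀ (l • v₀) ⊆ sepCuts 𝒟 v₀ (g • v₀)) : K' ≤ L := by
  suffices ∀ n, ∀ g ∈ K', (sepCuts 𝒟 v₀ (g • v₀)).ncard = n → g ∈ L from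
    fun g hg => this _ g hg rfl
  intro n
  induction n using Nat.strong_induction_on with
  | _ n ih =>
    intro g hg hn
    by_cases hgK : g ∈ cutStab G 𝒟 v₀
    · exact hKL hgK
    obtain ⟨l, hl, ⟨A, hA⟩, hsub⟩ := hgen g hg hgK
    have key : (l • · ) '' sepCuts 𝒟 v₀ ((l⁻¹ * g) • v₀) ⊆ sepCuts 𝒟 v₀ (g • v₀) \ {A} := by
      rintro _ ⟨E, hE, rfl⟩
      have h1 := (h𝒟.smul_mem_sepCuts_iff l).2 hE
      rw [smul_smul, mul_inv_cancel_left] at h1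
      refine ⟨⟨h1.1, fun h2 => ?_, h1.2.2⟩, fun h2 => ?_⟩
      · exact (hsub ⟨h𝒟.compl _ h1.1, fun h => h h2, h1.2.1⟩).2.2 h1.2.2
      · exact h1.2.1 ((show l • E = A from h2) ▸ hA.2.2)
    have hfin : (sepCuts 𝒟 v₀ (g • v₀)).Finite := h𝒟.finite _ _
    have hlt : (sepCuts 𝒟 v₀ ((l⁻¹ * g) • v₀)).ncard < n := by
      rw [← Set.ncard_image_of_injective _ (MulAction.injective l), ← hn]
      refine (Set.ncard_le_ncard key (hfin.subset Set.sdiff_subset)).trans_lt ?_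
      exact Set.ncard_sdiff_singleton_lt_of_mem (hsub hA) hfin
    have := ih _ hlt _ (K'.mul_mem (K'.inv_mem (hLK hl)) hg) rfl
    simpa using L.mul_mem hl this

end EquivCuts

end Twisted

section Growth

variable {G : Type u} [Group G] {V : Type*} [MulAction G V] {φ : MulAut G} {w : G}
  {τ : Equiv.Perm V} {v₀ : V} {𝒟 : Set (Set V)} {C D Q R : Set V}

theorem compl_mem_cutOrbit (hD : D ∈ cutOrbit G τ C) : Dᶜ ∈ cutOrbit G τ C := by
  obtain ⟨g, rfl | rfl | rfl | rfl⟩ := hD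
  · exact ⟨g, Or.inr (Or.inl Set.smul_set_compl.symm)⟩
  · exact ⟨g, Or.inl (by rw [Set.smul_set_compl, compl_compl])⟩
  · exact ⟨g, Or.inr (Or.inr (Or.inr Set.smul_set_compl.symm))⟩
  · exact ⟨g, Or.inr (Or.inr (Or.inl (by rw [Set.smul_set_compl, compl_compl])))⟩

theorem smul_mem_cutOrbit (h : G) (hD : D ∈ cutOrbit G τ C) : h • D ∈ cutOrbit G τ C := by
  obtain ⟨g, hg⟩ := hD
  refine ⟨h * g, ?_⟩
  simp only [mul_smul]
  exact hg.imp (congrArg _) (Or.imp (congrArg _) (Or.imp (congrArg _) (congrArg _)))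

theorem image_mem_cutOrbit (hτ : TwistedAction φ w τ v₀) (hD : D ∈ cutOrbit G τ C) :
    τ '' D ∈ cutOrbit G τ C := by
  obtain ⟨g, rfl | rfl | rfl | rfl⟩ := hD
  · exact ⟨φ g, Or.inr (Or.inr (Or.inl (image_smul_eq hτ _ _)))⟩
  · exact ⟨φ g, Or.inr (Or.inr (Or.inr (by rw [image_smul_eq hτ, image_compl_perm])))⟩
  · exact ⟨φ g * w, Or.inl (by rw [image_smul_eq hτ, image_image_eq hτ, mul_smul])⟩
  · exact ⟨φ g * w, Or.inr (Or.inl (by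
      rw [image_smul_eq hτ, image_compl_perm, image_image_eq hτ, mul_smul, Set.smul_set_compl,
        Set.smul_set_compl, Set.smul_set_compl]))⟩

namespace EquivCuts

theorem diff_cutOrbit (h𝒟 : EquivCuts G τ 𝒟) (hτ : TwistedAction φ w τ v₀) :
    EquivCuts G τ (𝒟 \ cutOrbit G τ C) where
  nonempty D hD := h𝒟.nonempty D hD.1
  compl D hD := ⟨h𝒟.compl D hD.1, fun h => hD.2 (by simpa using compl_mem_cutOrbit h)⟩
  nested D hD E hE := h𝒟.nested D hD.1 E hE.1
  finite x y := (h𝒟.finite x y).subset fun D hD => ⟨hD.1.1, hD.2⟩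
  smul_mem g D hD := ⟨h𝒟.smul_mem g D hD.1, fun h => hD.2 (by
    simpa using smul_mem_cutOrbit g⁻¹ h)⟩
  image_mem D hD := ⟨h𝒟.image_mem D hD.1, fun h => hD.2 (by
    have := smul_mem_cutOrbit w⁻¹ (image_mem_cutOrbit hτ h)
    rwa [image_image_eq hτ, inv_smul_smul] at this)⟩
  free g D hD := h𝒟.free g D hD.1

theorem mem_outerCuts_diff_of_coadj (h𝒟 : EquivCuts G τ 𝒟) {T : Set (Set V)} {E : Set V} {v : V}
    (hQ : Q ∈ 𝒟 \ T) (hE : E ∈ T) (hQR : Coadj (𝒟 \ T) Q R) (h1 : Q ⊆ E) (h2 : E ⊆ Rᶜ)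
    (hv : E ∈ outerCuts 𝒟 v) : Q ∈ outerCuts (𝒟 \ T) v := by
  refine ⟨hQ, fun h => hv.2.1 (h1 h), fun D hD hvD hQD => ?_⟩
  rcases h𝒟.cases_of_notMem hv.1 hD.1 hv.2.1 hvD with h | h | h
  · exact absurd (hv.2.2 D hD.1 hvD h ▸ hE) hD.2
  · rcases hQR.2 D hD hQD (h.trans h2) with h3 | h3
    · exact h3
    · exact absurd (h.antisymm (h3 ▸ h2) ▸ hE) hD.2
  · obtain ⟨x, hx⟩ := h𝒟.nonempty Q hQ.1
    exact absurd (hQD hx) (h (h1 hx))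

theorem mem_outerCuts_or_compl_of_mem_cutOrbit (h𝒟 : EquivCuts G τ 𝒟)
    (hτ : TwistedAction φ w τ v₀) (hC : C ∈ outerCuts 𝒟 v₀) (hD : D ∈ cutOrbit G τ C) :
    ∃ v, D ∈ outerCuts 𝒟 v ∨ Dᶜ ∈ outerCuts 𝒟 v := by
  have hC' := (h𝒟.image_mem_outerCuts_base hτ).2 hC
  obtain ⟨g, rfl | rfl | rfl | rfl⟩ := hD
  · exact ⟨g • v₀, Or.inl ((h𝒟.smul_mem_outerCuts_iff g v₀).2 hC)⟩
  · exact ⟨g • v₀, Or.inr (by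
      rw [Set.smul_set_compl, compl_compl]; exact (h𝒟.smul_mem_outerCuts_iff g v₀).2 hC)⟩
  · exact ⟨g • v₀, Or.inl ((h𝒟.smul_mem_outerCuts_iff g v₀).2 hC')⟩
  · exact ⟨g • v₀, Or.inr (by
      rw [Set.smul_set_compl, compl_compl]; exact (h𝒟.smul_mem_outerCuts_iff g v₀).2 hC')⟩

theorem rigidCuts_diff (h𝒟 : EquivCuts G τ 𝒟) (hτ : TwistedAction φ w τ v₀)
    (hr : RigidCuts G 𝒟) (hC : C ∈ outerCuts 𝒟 v₀) : RigidCuts G (𝒟 \ cutOrbit G τ C) := by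
  intro Q hQ hout g hco
  have h𝒟' := h𝒟.diff_cutOrbit hτ (C := C)
  by_cases hbt : ∃ E ∈ 𝒟, Q ⊆ E ∧ E ⊆ (g • Q)ᶜ ∧ E ≠ Q ∧ E ≠ (g • Q)ᶜ
  · exfalso
    obtain ⟨E, hE, h1, h2, h3, h4⟩ := hbt
    have hEO : E ∈ cutOrbit G τ C := by
      by_contra hEO
      exact (hco.2 E ⟨hE, hEO⟩ h1 h2).elim h3 h4
    obtain ⟨v, hv | hv⟩ := h𝒟.mem_outerCuts_or_compl_of_mem_cutOrbit hτ hC hEO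
    · exact hout v (h𝒟.mem_outerCuts_diff_of_coadj hQ hEO hco h1 h2 hv)
    · have := h𝒟.mem_outerCuts_diff_of_coadj (h𝒟'.smul_mem g Q hQ) (compl_mem_cutOrbit hEO)
        (hco.symm h𝒟'.toCutSystem) (Set.subset_compl_comm.1 h2) (Set.compl_subset_compl.2 h1) hv
      rw [h𝒟'.smul_mem_outerCuts_iff'] at this
      exact hout _ this
  · refine hr Q hQ.1 (fun v hv => hout v ⟨hQ, hv.2.1, fun E hE => hv.2.2 E hE.1⟩) g
      ⟨hco.1, fun E hE h1 h2 => ?_⟩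
    by_contra hne
    rw [not_or] at hne
    exact hbt ⟨E, hE, h1, h2, hne⟩

/-- The ping-pong lemma for translates of maximal cuts. -/
theorem isExt_of_outerCuts (h𝒟 : EquivCuts G τ 𝒟) {Z : Set G} (hZ : Z.Nonempty)
    (A B P Q : G → Set V) (hA : ∀ z ∈ Z, A z ∈ outerCuts 𝒟 v₀)
    (hB : ∀ z ∈ Z, B z ∈ outerCuts 𝒟 v₀) (hPA : ∀ z ∈ Z, P z ⊆ A z) (hQB : ∀ z ∈ Z, Q z ⊆ B z)
    (hAA : ∀ z ∈ Z, ∀ z' ∈ Z, z ≠ z' → ∀ k : G, k • A z ≠ A z')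
    (hBB : ∀ z ∈ Z, ∀ z' ∈ Z, z ≠ z' → ∀ k : G, k • B z ≠ B z')
    (hAB : ∀ z ∈ Z, ∀ z' ∈ Z, ∀ k : G, k • A z ≠ B z')
    (hz : ∀ z ∈ Z, ∀ v, v ∉ Q z → z • v ∈ P z) :
    IsExt (cutStab G 𝒟 v₀) Z (cutStab G 𝒟 v₀ ⊔ Subgroup.closure Z) := by
  have hdisj : ∀ {D D' : Set V}, D ∈ outerCuts 𝒟 v₀ → D' ∈ outerCuts 𝒟 v₀ →
      ∀ k ∈ cutStab G 𝒟 v₀, k • D ≠ D' → Disjoint (k • D) D' := fun hD hD' k hk hne =>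
    h𝒟.disjoint_outerCuts (h𝒟.smul_mem_outerCuts_base hk hD) hD' hne
  have hone := (cutStab G 𝒟 v₀).one_mem
  have hsm : ∀ {D D' : Set V} (k : G), D ⊆ D' → k • D ⊆ k • D' := fun k h => Set.image_mono h
  have hAA' : ∀ z ∈ Z, ∀ z' ∈ Z, ∀ k : G, k ≠ 1 → k • A z ≠ A z' := by
    intro z hz z' hz' k hk
    rcases eq_or_ne z z' with rfl | h
    · exact fun h => hk (h𝒟.free k _ (hA z hz).1 h)
    · exact hAA z hz z' hz' h k
  have hBB' : ∀ z ∈ Z, ∀ z' ∈ Z, ∀ k : G, k ≠ 1 → k • B z ≠ B z' := by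
    intro z hz z' hz' k hk
    rcases eq_or_ne z z' with rfl | h
    · exact fun h => hk (h𝒟.free k _ (hB z hz).1 h)
    · exact hBB z hz z' hz' h k
  have hBA : ∀ z ∈ Z, ∀ z' ∈ Z, ∀ k : G, k • B z ≠ A z' := by
    intro z hz z' hz' k h
    exact hAB z' hz' z hz k⁻¹ (by rw [← h, inv_smul_smul])
  refine isExt_of_ping_pong (v₀ := v₀) hZ P Q (fun z hz h => (hA z hz).2.1 (hPA z hz h))
    (fun z hz h => (hB z hz).2.1 (hQB z hz h)) ?_ ?_ ?_ ?_ ?_ hz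
  · intro z hz z' hz' hne
    have := hdisj (hA z hz) (hA z' hz') 1 hone (hAA z hz z' hz' hne 1)
    rw [one_smul] at this
    exact this.mono (hPA z hz) (hPA z' hz')
  · intro z hz z' hz' hne
    have := hdisj (hB z hz) (hB z' hz') 1 hone (hBB z hz z' hz' hne 1)
    rw [one_smul] at this
    exact this.mono (hQB z hz) (hQB z' hz')
  · intro z hz z' hz'
    have := hdisj (hA z hz) (hB z' hz') 1 hone (hAB z hz z' hz' 1)
    rw [one_smul] at this
    exact this.mono (hPA z hz) (hQB z' hz')
  · intro k hk hk1 z hz z' hz'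
    exact ⟨(hdisj (hA z hz) (hA z' hz') k hk (hAA' z hz z' hz' k hk1)).mono
        (hsm k (hPA z hz)) (hPA z' hz'),
      (hdisj (hA z hz) (hB z' hz') k hk (hAB z hz z' hz' k)).mono
        (hsm k (hPA z hz)) (hQB z' hz')⟩
  · intro k hk hk1 z hz z' hz'
    exact ⟨(hdisj (hB z hz) (hA z' hz') k hk (hBA z hz z' hz' k)).mono
        (hsm k (hQB z hz)) (hPA z' hz'),
      (hdisj (hB z hz) (hB z' hz') k hk (hBB' z hz z' hz' k hk1)).mono
        (hsm k (hQB z hz)) (hQB z' hz')⟩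

end EquivCuts

end Growth

section Growth

variable {G : Type u} [Group G] {V : Type*} [MulAction G V] {φ : MulAut G} {w : G}
  {τ : Equiv.Perm V} {v₀ : V} {𝒟 : Set (Set V)} {C D Q R : Set V}

namespace EquivCuts

theorem cutStab_le_diff (h𝒟 : EquivCuts G τ 𝒟) (hτ : TwistedAction φ w τ v₀) :
    cutStab G 𝒟 v₀ ≤ cutStab G (𝒟 \ cutOrbit G τ C) v₀ := fun g hg => by
  rw [(h𝒟.diff_cutOrbit hτ).mem_cutStab_iff]
  exact fun D hD => h𝒟.mem_cutStab_iff.1 hg D hD.1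

theorem mem_cutStab_diff_iff (h𝒟 : EquivCuts G τ 𝒟) (hτ : TwistedAction φ w τ v₀) {g : G} :
    g ∈ cutStab G (𝒟 \ cutOrbit G τ C) v₀ ↔ sepCuts 𝒟 v₀ (g • v₀) ⊆ cutOrbit G τ C := by
  rw [(h𝒟.diff_cutOrbit hτ).mem_cutStab_iff_sepCuts, Set.eq_empty_iff_forall_notMem]
  refine ⟨fun h D hD => ?_, fun h D hD => hD.1.2 (h ⟨hD.1.1, hD.2⟩)⟩
  by_contra hne
  exact h D ⟨⟨hD.1, hne⟩, hD.2⟩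

theorem sepCuts_eq_singleton (h𝒟 : EquivCuts G τ 𝒟) (hC : C ∈ outerCuts 𝒟 v₀) {v : V}
    (hb : Cᶜ ∈ outerCuts 𝒟 v) : sepCuts 𝒟 v₀ v = {C} := by
  have hbC : v ∈ C := by by_contra h; exact hb.2.1 h
  ext D
  simp only [Set.mem_singleton_iff]
  constructor
  · rintro ⟨hD, h1, h2⟩
    rcases h𝒟.cases_of_notMem hC.1 hD hC.2.1 h1 with h | h | h
    · exact hC.2.2 D hD h1 h
    · have := hb.2.2 Dᶜ (h𝒟.compl D hD) (fun h => h h2) (Set.compl_subset_compl.2 h)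
      exact compl_injective this
    · exact absurd h2 (h hbC)
  · rintro rfl
    exact ⟨hC.1, hC.2.1, hbC⟩

theorem exists_sepCuts_eq_singleton (h𝒟 : EquivCuts G τ 𝒟) (hC : C ∈ outerCuts 𝒟 v₀) {b : G}
    (hb : Cᶜ ∈ outerCuts 𝒟 (b • v₀)) (hD : D ∈ outerCuts 𝒟 v₀) {g : G}
    (hg : D = g • C ∨ D = g • Cᶜ) :
    ∃ l ∈ cutStab G 𝒟 v₀ ⊔ Subgroup.closure {b}, sepCuts 𝒟 v₀ (l • v₀) = {D} := by
  have hbmem : b ∈ cutStab G 𝒟 v₀ ⊔ Subgroup.closure {b} :=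
    Subgroup.mem_sup_right (Subgroup.subset_closure rfl)
  obtain rfl | rfl := hg
  · have hg := h𝒟.mem_cutStab_of_smul hC hD
    refine ⟨g * b, Subgroup.mul_mem _ (Subgroup.mem_sup_left hg) hbmem,
      h𝒟.sepCuts_eq_singleton hD ?_⟩
    rw [← Set.smul_set_compl, mul_smul]
    exact (h𝒟.smul_mem_outerCuts_iff g _).2 hb
  · have h1 := (h𝒟.smul_mem_outerCuts_iff' g v₀).1 hD
    have h2 := h𝒟.inv_mul_mem_cutStab h1 hb
    rw [inv_inv] at h2
    refine ⟨g, ?_, h𝒟.sepCuts_eq_singleton hD ?_⟩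
    · have := Subgroup.mul_mem _ (Subgroup.mem_sup_left h2) (Subgroup.inv_mem _ hbmem)
      rwa [mul_inv_cancel_right] at this
    · rw [← Set.smul_set_compl, compl_compl]
      exact (h𝒟.smul_mem_outerCuts_iff g v₀).2 hC

theorem image_compl_mem_outerCuts (h𝒟 : EquivCuts G τ 𝒟) (hτ : TwistedAction φ w τ v₀) {b : G}
    (hb : Cᶜ ∈ outerCuts 𝒟 (b • v₀)) : (τ '' C)ᶜ ∈ outerCuts 𝒟 (φ b • v₀) := by
  rw [← image_compl_perm, ← hτ.map_smul_base]
  exact (h𝒟.image_mem_outerCuts hτ).2 hb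

theorem cutStab_diff_eq (h𝒟 : EquivCuts G τ 𝒟) (hτ : TwistedAction φ w τ v₀)
    (hC : C ∈ outerCuts 𝒟 v₀) {b : G} (hb : Cᶜ ∈ outerCuts 𝒟 (b • v₀)) :
    cutStab G (𝒟 \ cutOrbit G τ C) v₀ = cutStab G 𝒟 v₀ ⊔ Subgroup.closure {b, φ b} := by
  have hC' := (h𝒟.image_mem_outerCuts_base hτ).2 hC
  have hb' := h𝒟.image_compl_mem_outerCuts hτ hb
  have hle : cutStab G 𝒟 v₀ ⊔ Subgroup.closure {b, φ b} ≤
      cutStab G (𝒟 \ cutOrbit G τ C) v₀ := by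
    refine sup_le (h𝒟.cutStab_le_diff hτ) ((Subgroup.closure_le _).2 ?_)
    rintro x (rfl | rfl)
    · rw [SetLike.mem_coe, h𝒟.mem_cutStab_diff_iff hτ, h𝒟.sepCuts_eq_singleton hC hb]
      rintro _ rfl
      exact ⟨1, Or.inl (one_smul _ _).symm⟩
    · rw [SetLike.mem_coe, h𝒟.mem_cutStab_diff_iff hτ, h𝒟.sepCuts_eq_singleton hC' hb']
      rintro _ rfl
      exact ⟨1, Or.inr (Or.inr (Or.inl (one_smul _ _).symm))⟩
  refine le_antisymm (h𝒟.cutStab_le_of_sepCuts le_sup_left hle fun g hg hgK => ?_) hle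
  rw [h𝒟.mem_cutStab_iff_sepCuts, ← Ne, ← Set.nonempty_iff_ne_empty] at hgK
  obtain ⟨D, hD⟩ := hgK
  obtain ⟨A, hA, -, hA'⟩ := h𝒟.exists_maximal_sepCuts hD
  suffices ∃ l ∈ cutStab G 𝒟 v₀ ⊔ Subgroup.closure {b, φ b}, sepCuts 𝒟 v₀ (l • v₀) = {A} by
    obtain ⟨l, hl, hlA⟩ := this
    refine ⟨l, hl, hlA ▸ Set.singleton_nonempty A, hlA ▸ Set.singleton_subset_iff.2 hA'⟩
  obtain ⟨g₁, hg₁⟩ := (h𝒟.mem_cutStab_diff_iff hτ).1 hg hA'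
  rw [← or_assoc] at hg₁
  rcases hg₁ with h | h
  · obtain ⟨l, hl, h⟩ := h𝒟.exists_sepCuts_eq_singleton hC hb hA h
    exact ⟨l, sup_le_sup_left (Subgroup.closure_mono (by simp)) _ hl, h⟩
  · obtain ⟨l, hl, h⟩ := h𝒟.exists_sepCuts_eq_singleton hC' hb' hA h
    exact ⟨l, sup_le_sup_left (Subgroup.closure_mono (by simp)) _ hl, h⟩

theorem isExt_singleton_of_outerCuts (h𝒟 : EquivCuts G τ 𝒟)
    (htf : ∀ g : G, g * g = 1 → g = 1) (hC : C ∈ outerCuts 𝒟 v₀) {b : G}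
    (hb : Cᶜ ∈ outerCuts 𝒟 (b • v₀)) :
    IsExt (cutStab G 𝒟 v₀) {b} (cutStab G 𝒟 v₀ ⊔ Subgroup.closure {b}) := by
  have hB : b⁻¹ • Cᶜ ∈ outerCuts 𝒟 v₀ := by rwa [h𝒟.smul_mem_outerCuts_iff', inv_inv]
  refine h𝒟.isExt_of_outerCuts ⟨b, rfl⟩ (fun _ => C) (fun _ => b⁻¹ • Cᶜ) (fun _ => C)
    (fun _ => b⁻¹ • Cᶜ) (fun _ _ => hC) (fun _ _ => hB) (fun _ _ => subset_rfl)
    (fun _ _ => subset_rfl) ?_ ?_ ?_ ?_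
  · rintro z rfl z' rfl h
    exact absurd rfl h
  · rintro z rfl z' rfl h
    exact absurd rfl h
  · intro z _ z' _ k h
    exact h𝒟.smul_ne_compl htf hC.1 (b * k) (by rw [mul_smul, h, smul_inv_smul])
  · rintro z rfl v hv
    rw [Set.mem_inv_smul_set_iff] at hv
    simpa using hv

theorem isExt_pair_of_outerCuts (h𝒟 : EquivCuts G τ 𝒟) (hτ : TwistedAction φ w τ v₀)
    (htf : ∀ g : G, g * g = 1 → g = 1) (hC : C ∈ outerCuts 𝒟 v₀) {b : G}
    (hb : Cᶜ ∈ outerCuts 𝒟 (b • v₀)) (h1 : ∀ g : G, g • C ≠ τ '' C)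
    (h2 : ∀ g : G, g • C ≠ (τ '' C)ᶜ) :
    b ≠ φ b ∧ IsExt (cutStab G 𝒟 v₀) {b, φ b} (cutStab G 𝒟 v₀ ⊔ Subgroup.closure {b, φ b}) := by
  classical
  have hC' := (h𝒟.image_mem_outerCuts_base hτ).2 hC
  have hb' := h𝒟.image_compl_mem_outerCuts hτ hb
  have hne : b ≠ φ b := by
    intro h
    rw [← h] at hb'
    have e1 := h𝒟.sepCuts_eq_singleton hC hb
    rw [h𝒟.sepCuts_eq_singleton hC' hb', Set.singleton_eq_singleton_iff] at e1
    exact h1 1 (by rw [one_smul, e1])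
  refine ⟨hne, ?_⟩
  obtain ⟨c, hc⟩ : ∃ c : G → Set V, c = fun z => if z = b then C else τ '' C := ⟨_, rfl⟩
  have hcb : c b = C := by simp [hc]
  have hcb' : c (φ b) = τ '' C := by simp [hc, hne.symm]
  have hc1 : ∀ z ∈ ({b, φ b} : Set G), c z ∈ outerCuts 𝒟 v₀ ∧ (c z)ᶜ ∈ outerCuts 𝒟 (z • v₀) := by
    rintro z (rfl | rfl)
    · rw [hcb]; exact ⟨hC, hb⟩
    · rw [hcb']; exact ⟨hC', hb'⟩
  have hc2 : ∀ z ∈ ({b, φ b} : Set G), ∀ z' ∈ ({b, φ b} : Set G), z ≠ z' → ∀ g : G,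
      g • c z ≠ c z' ∧ g • c z ≠ (c z')ᶜ := by
    rintro z (rfl | rfl) z' (rfl | rfl) hzz g
    · exact absurd rfl hzz
    · rw [hcb, hcb']; exact ⟨h1 g, h2 g⟩
    · rw [hcb, hcb']
      refine ⟨fun h => h1 g⁻¹ (inv_smul_eq_iff.2 h.symm),
        fun h => h2 g⁻¹ (inv_smul_eq_iff.2 ?_)⟩
      rw [Set.smul_set_compl, h, compl_compl]
    · exact absurd rfl hzz
  refine h𝒟.isExt_of_outerCuts ⟨b, by simp⟩ c (fun z => z⁻¹ • (c z)ᶜ) c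
    (fun z => z⁻¹ • (c z)ᶜ) (fun z hz => (hc1 z hz).1) (fun z hz => ?_) (fun _ _ => subset_rfl)
    (fun _ _ => subset_rfl) (fun z hz z' hz' hne k => (hc2 z hz z' hz' hne k).1)
    (fun z hz z' hz' hne k h => ?_) (fun z hz z' hz' k h => ?_) (fun z hz v hv => ?_)
  · rw [h𝒟.smul_mem_outerCuts_iff', inv_inv]; exact (hc1 z hz).2
  · refine (hc2 z hz z' hz' hne (z' * k * z⁻¹)).1 (compl_injective ?_)
    rw [← Set.smul_set_compl, mul_smul, mul_smul, h, smul_inv_smul]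
  · have h' : (z' * k) • c z = (c z')ᶜ := by rw [mul_smul, h, smul_inv_smul]
    rcases eq_or_ne z z' with rfl | hne
    · exact h𝒟.smul_ne_compl htf (hc1 z hz).1.1 _ h'
    · exact (hc2 z hz z' hz' hne _).2 h'
  · rw [Set.mem_inv_smul_set_iff] at hv
    simpa using hv

/-- The growth of the stabilizer when the complement of the removed cut is maximal somewhere. -/
theorem step_of_compl_mem_outerCuts (h𝒟 : EquivCuts G τ 𝒟) (hτ : TwistedAction φ w τ v₀)
    (htf : ∀ g : G, g * g = 1 → g = 1) (hC : C ∈ outerCuts 𝒟 v₀) {b : G}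
    (hb : Cᶜ ∈ outerCuts 𝒟 (b • v₀)) :
    Step φ w (cutStab G 𝒟 v₀) (cutStab G (𝒟 \ cutOrbit G τ C) v₀) := by
  have hC' := (h𝒟.image_mem_outerCuts_base hτ).2 hC
  by_cases h2 : ∃ g : G, g • C = (τ '' C)ᶜ
  · obtain ⟨g, hg⟩ := h2
    have hgc : g • Cᶜ = τ '' C := by rw [Set.smul_set_compl, hg, compl_compl]
    have hgw : φ g * g = w := by
      refine h𝒟.eq_of_smul_eq hC.1 ?_
      rw [mul_smul, hg, ← image_image_eq hτ, ← image_compl_perm, ← image_smul_eq hτ, hgc]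
    have hs : Cᶜ ∈ outerCuts 𝒟 (g⁻¹ • v₀) := by
      rw [← h𝒟.smul_mem_outerCuts_iff', hgc]; exact hC'
    have hφs : φ g⁻¹ = g⁻¹⁻¹ * w⁻¹ := by rw [← hgw, map_inv]; group
    refine Or.inr (Or.inl ⟨g⁻¹, by rw [← hgw, map_inv]; group, ?_⟩)
    have := h𝒟.isExt_singleton_of_outerCuts htf hC hs
    rw [h𝒟.cutStab_diff_eq hτ hC hs]
    convert this using 1
    refine le_antisymm (sup_le le_sup_left ((Subgroup.closure_le _).2 ?_))
      (sup_le_sup_left (Subgroup.closure_mono (by simp)) _)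
    rintro x (rfl | rfl)
    · exact this.subset rfl
    · rw [hφs]
      exact mul_mem (inv_mem (this.subset rfl))
        (this.le (inv_mem (h𝒟.mem_cutStab_of_fix hτ.smul_base)))
  by_cases h1 : ∃ g : G, g • C = τ '' C
  · obtain ⟨k, hk⟩ := h1
    have hkK : k ∈ cutStab G 𝒟 v₀ := h𝒟.mem_cutStab_of_smul hC (hk ▸ hC')
    have hkw : φ k * k = w := h𝒟.eq_of_smul_eq hC.1
      (by rw [mul_smul, hk, ← image_smul_eq hτ, hk, image_image_eq hτ])
    have hcK : b⁻¹ * (k⁻¹ * φ b) ∈ cutStab G 𝒟 v₀ := by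
      refine h𝒟.inv_mul_mem_cutStab hb ?_
      rw [mul_smul, ← h𝒟.smul_mem_outerCuts_iff k, smul_inv_smul, Set.smul_set_compl, hk]
      exact h𝒟.image_compl_mem_outerCuts hτ hb
    have hφb : φ b = k⁻¹⁻¹ * b * (b⁻¹ * (k⁻¹ * φ b)) := by group
    refine Or.inr (Or.inr ⟨b, k⁻¹, inv_mem hkK, _, hcK, ?_, ?_, hφb, ?_⟩)
    · rw [← hkw, map_inv]; group
    · simp only [map_mul, map_inv, hτ.aut_sq, ← hkw]; group
    · have := h𝒟.isExt_singleton_of_outerCuts htf hC hb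
      rw [h𝒟.cutStab_diff_eq hτ hC hb]
      convert this using 1
      refine le_antisymm (sup_le le_sup_left ((Subgroup.closure_le _).2 ?_))
        (sup_le_sup_left (Subgroup.closure_mono (by simp)) _)
      rintro x (rfl | rfl)
      · exact this.subset rfl
      · rw [hφb]
        exact mul_mem (mul_mem (this.le (inv_mem (inv_mem hkK))) (this.subset rfl)) (this.le hcK)
  · push Not at h1 h2
    rw [h𝒟.cutStab_diff_eq hτ hC hb]
    exact Or.inl ⟨b, h𝒟.isExt_pair_of_outerCuts hτ htf hC hb h1 h2⟩

end EquivCuts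

end Growth

section Growth

variable {G : Type u} [Group G] {V : Type*} [MulAction G V] {φ : MulAut G} {w : G}
  {τ : Equiv.Perm V} {v₀ : V} {𝒟 : Set (Set V)} {C D Q R : Set V}

theorem not_coadj_compl_self (h𝒟 : CutSystem 𝒟) (hC : C ∈ 𝒟) : ¬ Coadj 𝒟 Cᶜ Cᶜ := by
  intro h
  obtain ⟨x, hx⟩ := h𝒟.nonempty _ (h𝒟.compl C hC)
  exact absurd hx (h.1.subset hx)

theorem CutSystem.exists_coadj_compl (h𝒟 : CutSystem 𝒟) {v : V} (hC : C ∈ outerCuts 𝒟 v₀)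
    (hv : v ∈ C) (hout : Cᶜ ∉ outerCuts 𝒟 v) :
    ∃ D ∈ sepCuts 𝒟 v₀ v, Coadj 𝒟 Cᶜ D := by
  have h1 : ∃ E ∈ 𝒟, v ∉ E ∧ Cᶜ ⊆ E ∧ E ≠ Cᶜ := by
    by_contra hcon
    push Not at hcon
    exact hout ⟨h𝒟.compl C hC.1, fun h => h hv, hcon⟩
  obtain ⟨E, hE, hvE, hCE, hne⟩ := h1
  have hEs : Eᶜ ∈ {D | D ∈ sepCuts 𝒟 v₀ v ∧ D ⊂ C} := by
    have hsub : Eᶜ ⊆ C := Set.compl_subset_comm.1 hCE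
    refine ⟨⟨h𝒟.compl E hE, fun h => hC.2.1 (hsub h), hvE⟩, hsub.ssubset_of_ne fun h => hne ?_⟩
    rw [← h, compl_compl]
  obtain ⟨D, hD, hmax⟩ := (Set.Finite.subset (h𝒟.finite v₀ v)
    (fun E hE => hE.1 : {D | D ∈ sepCuts 𝒟 v₀ v ∧ D ⊂ C} ⊆ sepCuts 𝒟 v₀ v)).exists_maximal ⟨_, hEs⟩
  refine ⟨D, hD.1, ⟨Set.compl_subset_compl.2 hD.2.subset, fun h => hD.2.2
    (Set.compl_subset_compl.1 h)⟩, fun F hF h1 h2 => ?_⟩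
  by_cases hFC : Fᶜ = C
  · exact Or.inl (by rw [← hFC, compl_compl])
  · have hsub : Fᶜ ⊆ C := Set.compl_subset_comm.1 h1
    have hDF : D ⊆ Fᶜ := Set.subset_compl_comm.1 h2
    have := (hmax ⟨⟨h𝒟.compl F hF, fun h => hC.2.1 (hsub h), hDF hD.1.2.2⟩,
      hsub.ssubset_of_ne hFC⟩ hDF).antisymm hDF
    exact Or.inr (by rw [← this, compl_compl])

namespace EquivCuts

/-- A cut whose complement is nowhere maximal and which contains a point not separated by the
remaining cuts covers a translate of its image. -/
theorem exists_coadj_image (h𝒟 : EquivCuts G τ 𝒟) (hτ : TwistedAction φ w τ v₀)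
    (hr : RigidCuts G 𝒟) (hC : C ∈ outerCuts 𝒟 v₀) (hout : ∀ v, Cᶜ ∉ outerCuts 𝒟 v) {v : V}
    (hv : v ∈ C) (hsep : sepCuts 𝒟 v₀ v ⊆ cutOrbit G τ C) :
    ∃ s : G, Coadj 𝒟 Cᶜ (s • (τ '' C)ᶜ) ∧ v ∈ s • (τ '' C)ᶜ := by
  obtain ⟨D, hD, hco⟩ := h𝒟.exists_coadj_compl hC hv (hout v)
  have hCc := h𝒟.compl C hC.1
  have hC' := (h𝒟.image_mem_outerCuts_base hτ).2 hC
  obtain ⟨g, rfl | rfl | rfl | rfl⟩ := hsep hD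
  · exact absurd ((hco.symm h𝒟.toCutSystem).mem_outerCuts h𝒟.toCutSystem hCc
      ((h𝒟.smul_mem_outerCuts_iff g v₀).2 hC)) (hout _)
  · have := hr _ hCc hout g hco
    rw [this, one_smul] at hco
    exact absurd hco (not_coadj_compl_self h𝒟.toCutSystem hC.1)
  · exact absurd ((hco.symm h𝒟.toCutSystem).mem_outerCuts h𝒟.toCutSystem hCc
      ((h𝒟.smul_mem_outerCuts_iff g v₀).2 hC')) (hout _)
  · exact ⟨g, hco, hD.2.2⟩

theorem eq_of_coadj (h𝒟 : EquivCuts G τ 𝒟) (hr : RigidCuts G 𝒟) (hQ : Q ∈ 𝒟)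
    (hout : ∀ v, Q ∉ outerCuts 𝒟 v) (hR : R ∈ 𝒟) {g h : G} (hg : Coadj 𝒟 R (g • Q))
    (hh : Coadj 𝒟 R (h • Q)) : g = h := by
  by_cases heq : g • Q = h • Q
  · exact h𝒟.eq_of_smul_eq hQ heq
  have h1 := (hg.symm h𝒟.toCutSystem).trans h𝒟.toCutSystem (h𝒟.smul_mem g Q hQ) hR
    (h𝒟.smul_mem h Q hQ) hh heq
  have h2 := h𝒟.coadj_smul g⁻¹ h1
  rw [inv_smul_smul, smul_smul] at h2
  exact inv_mul_eq_one.1 (hr Q hQ hout _ h2)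

theorem mul_mul_eq_one_of_coadj (h𝒟 : EquivCuts G τ 𝒟) (hτ : TwistedAction φ w τ v₀)
    (hr : RigidCuts G 𝒟) (hQ : Q ∈ 𝒟) (hout : ∀ v, Q ∉ outerCuts 𝒟 v) {s : G}
    (hs : Coadj 𝒟 Q (s • τ '' Q)) : s * φ s * w = 1 := by
  have h1 := h𝒟.coadj_smul s (h𝒟.coadj_image hτ hs)
  rw [image_smul_eq hτ, image_image_eq hτ, smul_smul, smul_smul] at h1
  refine (h𝒟.eq_of_coadj hr hQ hout (h𝒟.smul_mem s _ (h𝒟.image_mem Q hQ)) (h := 1) h1 ?_)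
  rw [one_smul]
  exact hs.symm h𝒟.toCutSystem

theorem sepCuts_subset_pair (h𝒟 : EquivCuts G τ 𝒟) {E : Set V} {v : V}
    (hC : C ∈ outerCuts 𝒟 v₀) (hE : E ∈ outerCuts 𝒟 v) (hco : Coadj 𝒟 Cᶜ Eᶜ) :
    sepCuts 𝒟 v₀ v ⊆ {C, Eᶜ} := by
  rintro D ⟨hD, h1, h2⟩
  have hsub := hco.1.subset
  rw [compl_compl] at hsub
  obtain ⟨x, hx⟩ := h𝒟.nonempty _ (h𝒟.compl _ hE.1)
  obtain ⟨y, hy⟩ := h𝒟.nonempty _ (h𝒟.compl _ hC.1)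
  have hxC : x ∈ C := by by_contra h; exact hx (hsub h)
  rcases h𝒟.cases_of_notMem hC.1 hD hC.2.1 h1 with h | h | h
  · exact Or.inl (hC.2.2 D hD h1 h)
  · rcases h𝒟.cases_of_notMem hE.1 (h𝒟.compl D hD) hE.2.1 (fun h => h h2) with h' | h' | h'
    · exact Or.inr (by
        rw [Set.mem_singleton_iff, ← hE.2.2 _ (h𝒟.compl D hD) (fun h => h h2) h', compl_compl])
    · rcases hco.2 Dᶜ (h𝒟.compl D hD) (Set.compl_subset_compl.2 h) (by rwa [compl_compl])
        with h3 | h3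
      · exact Or.inl (compl_injective h3)
      · exact Or.inr (compl_injective h3)
    · rw [compl_compl] at h'
      exact absurd (h (h' (hsub hy))) hy
  · rcases h𝒟.cases_of_notMem hE.1 (h𝒟.compl D hD) hE.2.1 (fun h => h h2) with h' | h' | h'
    · exact Or.inr (by
        rw [Set.mem_singleton_iff, ← hE.2.2 _ (h𝒟.compl D hD) (fun h => h h2) h', compl_compl])
    · exact absurd (h' (h hxC)) hx
    · rw [compl_compl] at h'
      refine absurd hco.1 fun hss => hss.2 ?_
      rw [compl_compl]
      exact fun z hz hzC => h hzC (h' hz)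

/-- The growth of the stabilizer when the complement of the removed cut is nowhere maximal. -/
theorem step_of_compl_notMem_outerCuts (h𝒟 : EquivCuts G τ 𝒟) (hτ : TwistedAction φ w τ v₀)
    (hr : RigidCuts G 𝒟) (hC : C ∈ outerCuts 𝒟 v₀) (hout : ∀ v, Cᶜ ∉ outerCuts 𝒟 v) :
    cutStab G 𝒟 v₀ = cutStab G (𝒟 \ cutOrbit G τ C) v₀ ∨
      Step φ w (cutStab G 𝒟 v₀) (cutStab G (𝒟 \ cutOrbit G τ C) v₀) := by
  have hC' := (h𝒟.image_mem_outerCuts_base hτ).2 hC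
  have hCc := h𝒟.compl C hC.1
  have hout' : ∀ v, (τ '' C)ᶜ ∉ outerCuts 𝒟 v := by
    intro v hv
    obtain ⟨v, rfl⟩ := τ.surjective v
    rw [← image_compl_perm, h𝒟.image_mem_outerCuts hτ] at hv
    exact hout v hv
  have hww : (τ '' (τ '' C))ᶜ = w • Cᶜ := by rw [image_image_eq hτ, Set.smul_set_compl]
  have horb : cutOrbit G τ C ⊆ cutOrbit G τ (τ '' C) := by
    rintro D ⟨g, h | h | h | h⟩
    · exact ⟨g * w⁻¹, Or.inr (Or.inr (Or.inl (by
        rw [h, image_image_eq hτ, smul_smul, inv_mul_cancel_right])))⟩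
    · exact ⟨g * w⁻¹, Or.inr (Or.inr (Or.inr (by
        rw [h, hww, smul_smul, inv_mul_cancel_right])))⟩
    · exact ⟨g, Or.inl h⟩
    · exact ⟨g, Or.inr (Or.inl h)⟩
  have key : ∀ g ∈ cutStab G (𝒟 \ cutOrbit G τ C) v₀, g ∉ cutStab G 𝒟 v₀ →
      ∃ s h : G, h ∈ cutStab G 𝒟 v₀ ∧ Coadj 𝒟 Cᶜ (s • (τ '' C)ᶜ) ∧
        ((h⁻¹ * g) • v₀ ∈ s • (τ '' C)ᶜ ∧ (h⁻¹ * g) • v₀ ∈ C ∨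
          (h⁻¹ * g) • v₀ ∈ s⁻¹ • Cᶜ ∧ (h⁻¹ * g) • v₀ ∈ τ '' C) := by
    intro g hg hgK
    rw [h𝒟.mem_cutStab_iff_sepCuts, ← Ne, ← Set.nonempty_iff_ne_empty] at hgK
    obtain ⟨D, hD⟩ := hgK
    obtain ⟨A, hA, -, hA'⟩ := h𝒟.exists_maximal_sepCuts hD
    obtain ⟨h, rfl | rfl | rfl | rfl⟩ := (h𝒟.mem_cutStab_diff_iff hτ).1 hg hA'
    · have hh := h𝒟.mem_cutStab_of_smul hC hA
      have hv : (h⁻¹ * g) • v₀ ∈ C := by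
        rw [mul_smul, ← Set.mem_smul_set_iff_inv_smul_mem]; exact hA'.2.2
      obtain ⟨s, hs, hsv⟩ := h𝒟.exists_coadj_image hτ hr hC hout hv
        ((h𝒟.mem_cutStab_diff_iff hτ).1 (mul_mem (inv_mem (h𝒟.cutStab_le_diff hτ hh)) hg))
      exact ⟨s, h, hh, hs, Or.inl ⟨hsv, hv⟩⟩
    · rw [h𝒟.smul_mem_outerCuts_iff'] at hA
      exact absurd hA (hout _)
    · have hh := h𝒟.mem_cutStab_of_smul hC' hA
      have hv : (h⁻¹ * g) • v₀ ∈ τ '' C := by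
        rw [mul_smul, ← Set.mem_smul_set_iff_inv_smul_mem]; exact hA'.2.2
      obtain ⟨s, hs, hsv⟩ := h𝒟.exists_coadj_image hτ hr hC' hout' hv
        (((h𝒟.mem_cutStab_diff_iff hτ).1
          (mul_mem (inv_mem (h𝒟.cutStab_le_diff hτ hh)) hg)).trans horb)
      rw [hww, smul_smul] at hs hsv
      refine ⟨(s * w)⁻¹, h, hh, ?_, Or.inr ⟨by rwa [inv_inv], hv⟩⟩
      have := h𝒟.coadj_smul (s * w)⁻¹ (hs.symm h𝒟.toCutSystem)
      rwa [inv_smul_smul] at this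
    · rw [h𝒟.smul_mem_outerCuts_iff'] at hA
      exact absurd hA (hout' _)
  by_cases hex : ∃ s : G, Coadj 𝒟 Cᶜ (s • (τ '' C)ᶜ)
  swap
  · refine Or.inl (le_antisymm (h𝒟.cutStab_le_diff hτ) fun g hg => ?_)
    by_contra hgK
    obtain ⟨s, -, -, hs, -⟩ := key g hg hgK
    exact hex ⟨s, hs⟩
  obtain ⟨s, hs⟩ := hex
  have huniq : ∀ s' : G, Coadj 𝒟 Cᶜ (s' • (τ '' C)ᶜ) → s' = s := fun s' hs' =>
    h𝒟.eq_of_coadj hr (h𝒟.compl _ hC'.1) hout' hCc hs' hs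
  have hsw : s * φ s * w = 1 := h𝒟.mul_mul_eq_one_of_coadj hτ hr hCc hout
    (by rwa [image_compl_perm])
  have hs1 : sepCuts 𝒟 v₀ (s • v₀) ⊆ {C, s • (τ '' C)ᶜ} := by
    have := h𝒟.sepCuts_subset_pair hC ((h𝒟.smul_mem_outerCuts_iff s v₀).2 hC')
      (by rwa [← Set.smul_set_compl])
    rwa [← Set.smul_set_compl] at this
  have hsub : s • (τ '' C)ᶜ ⊆ C := Set.compl_subset_compl.1 (by simpa using hs.1.subset)
  have hsC : s • v₀ ∈ C := hsub (Set.smul_mem_smul_set hC'.2.1)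
  have hsK : s ∉ cutStab G 𝒟 v₀ := fun h => hC.2.1 ((h𝒟.mem_cutStab_iff.1 h C hC.1).1 hsC)
  have hsK' : s ∈ cutStab G (𝒟 \ cutOrbit G τ C) v₀ := by
    rw [h𝒟.mem_cutStab_diff_iff hτ]
    refine hs1.trans ?_
    rintro D (rfl | rfl)
    · exact ⟨1, Or.inl (one_smul _ _).symm⟩
    · exact ⟨s, Or.inr (Or.inr (Or.inr rfl))⟩
  have hle : cutStab G 𝒟 v₀ ⊔ Subgroup.closure {s} ≤ cutStab G (𝒟 \ cutOrbit G τ C) v₀ :=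
    sup_le (h𝒟.cutStab_le_diff hτ) ((Subgroup.closure_le _).2 (Set.singleton_subset_iff.2 hsK'))
  have hsmem : s ∈ cutStab G 𝒟 v₀ ⊔ Subgroup.closure {s} :=
    Subgroup.mem_sup_right (Subgroup.subset_closure rfl)
  have hnon : ∀ l : G, l ∉ cutStab G 𝒟 v₀ → (sepCuts 𝒟 v₀ (l • v₀)).Nonempty := by
    intro l hl
    rwa [h𝒟.mem_cutStab_iff_sepCuts, ← Ne, ← Set.nonempty_iff_ne_empty] at hl
  have hge : cutStab G (𝒟 \ cutOrbit G τ C) v₀ ≤ cutStab G 𝒟 v₀ ⊔ Subgroup.closure {s} := by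
    refine h𝒟.cutStab_le_of_sepCuts le_sup_left hle fun g hg hgK => ?_
    obtain ⟨s', h, hh, hs', hcase⟩ := key g hg hgK
    rw [huniq s' hs'] at hcase
    have hmove : ∀ E : Set V, (h⁻¹ * g) • v₀ ∈ E → g • v₀ ∈ h • E := fun E hE => by
      rwa [Set.mem_smul_set_iff_inv_smul_mem, ← mul_smul]
    rcases hcase with ⟨h1, h2⟩ | ⟨h1, h2⟩
    · refine ⟨h * s, mul_mem (Subgroup.mem_sup_left hh) hsmem, hnon _ fun h' => hsK ?_,
        fun E hE => ⟨hE.1, hE.2.1, ?_⟩⟩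
      · simpa using mul_mem (inv_mem hh) h'
      · obtain ⟨E', rfl | rfl, rfl⟩ := h𝒟.smul_sepCuts_subset hh hs1 hE
        · exact hmove _ h2
        · exact hmove _ h1
    · refine ⟨h * s⁻¹, mul_mem (Subgroup.mem_sup_left hh) (inv_mem hsmem), hnon _ fun h' => hsK ?_,
        fun E hE => ⟨hE.1, hE.2.1, ?_⟩⟩
      · simpa using inv_mem (mul_mem (inv_mem hh) h')
      · obtain ⟨E₁, hE₁, rfl⟩ := h𝒟.smul_sepCuts_subset hh subset_rfl hE
        obtain ⟨E₂, rfl | rfl, rfl⟩ := h𝒟.sepCuts_inv_subset hs1 hE₁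
        · exact hmove _ h1
        · rw [Set.smul_set_compl, inv_smul_smul, compl_compl]
          exact hmove _ h2
  right
  refine Or.inr (Or.inl ⟨s, hsw, ?_⟩)
  rw [le_antisymm hge hle]
  refine h𝒟.isExt_of_outerCuts ⟨s, rfl⟩ (fun _ => C) (fun _ => τ '' C) (fun _ => C)
    (fun _ => s⁻¹ • Cᶜ) (fun _ _ => hC) (fun _ _ => hC') (fun _ _ => subset_rfl)
    (fun _ _ => ?_) ?_ ?_ ?_ ?_
  · rintro _ ⟨x, hx, rfl⟩
    by_contra hcon
    refine hx (hsub ?_)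
    rw [Set.mem_smul_set_iff_inv_smul_mem]
    exact hcon
  · rintro z rfl z' rfl h
    exact absurd rfl h
  · rintro z rfl z' rfl h
    exact absurd rfl h
  · intro z _ z' _ k h
    rw [← h, ← Set.smul_set_compl, smul_smul] at hs
    have := hr _ hCc hout _ hs
    rw [this, one_smul] at hs
    exact not_coadj_compl_self h𝒟.toCutSystem hC.1 hs
  · rintro z rfl v hv
    rw [Set.mem_inv_smul_set_iff] at hv
    simpa using hv

/-- Removing the orbit of a maximal cut enlarges the stabilizer by at most one step. -/
theorem step_diff_cutOrbit (h𝒟 : EquivCuts G τ 𝒟) (hτ : TwistedAction φ w τ v₀)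
    (htf : ∀ g : G, g * g = 1 → g = 1) (hr : RigidCuts G 𝒟) (hC : C ∈ outerCuts 𝒟 v₀) :
    cutStab G 𝒟 v₀ = cutStab G (𝒟 \ cutOrbit G τ C) v₀ ∨
      Step φ w (cutStab G 𝒟 v₀) (cutStab G (𝒟 \ cutOrbit G τ C) v₀) := by
  by_cases hout : ∃ v, Cᶜ ∈ outerCuts 𝒟 v
  · obtain ⟨v, hv⟩ := hout
    obtain ⟨b, rfl⟩ := hτ.trans v
    exact Or.inr (h𝒟.step_of_compl_mem_outerCuts hτ htf hC hv)
  · exact h𝒟.step_of_compl_notMem_outerCuts hτ hr hC (not_exists.1 hout)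

/-- If there are finitely many orbits of cuts, the stabilizer of the system is joined to the whole
group by finitely many steps. -/
theorem reflTransGen_step_cutStab (hτ : TwistedAction φ w τ v₀)
    (htf : ∀ g : G, g * g = 1 → g = 1) (T : Finset (Set V)) (h𝒟 : EquivCuts G τ 𝒟)
    (hr : RigidCuts G 𝒟) (hT : ∀ D ∈ 𝒟, ∃ E ∈ T, ∃ g : G, D = g • E) :
    Relation.ReflTransGen (Step φ w) (cutStab G 𝒟 v₀) ⊤ := by
  classical
  induction hn : T.card using Nat.strong_induction_on generalizing T 𝒟 with
  | _ n ih =>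
    rcases 𝒟.eq_empty_or_nonempty with rfl | ⟨D, hD⟩
    · have : cutStab G (∅ : Set (Set V)) v₀ = ⊤ := by
        rw [eq_top_iff]; intro g _ h D hD; exact absurd hD (Set.notMem_empty D)
      rw [this]
    obtain ⟨D, hD, hvD⟩ : ∃ D ∈ 𝒟, v₀ ∉ D := by
      by_cases h : v₀ ∈ D
      · exact ⟨Dᶜ, h𝒟.compl D hD, fun h' => h' h⟩
      · exact ⟨D, hD, h⟩
    obtain ⟨C, hC, -⟩ := h𝒟.exists_outerCuts hD hvD
    obtain ⟨C', hC'T, g, hg⟩ := hT C hC.1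
    have hlt : (T.erase C').card < n := hn ▸ Finset.card_erase_lt_of_mem hC'T
    have htail := ih _ hlt (T.erase C') (h𝒟.diff_cutOrbit hτ (C := C))
      (h𝒟.rigidCuts_diff hτ hr hC) (fun D hD => by
        obtain ⟨E, hE, h, rfl⟩ := hT D hD.1
        refine ⟨E, Finset.mem_erase.2 ⟨?_, hE⟩, h, rfl⟩
        rintro rfl
        exact hD.2 ⟨h * g⁻¹, Or.inl (by rw [hg, smul_smul, inv_mul_cancel_right])⟩) rfl
    rcases h𝒟.step_diff_cutOrbit hτ htf hr hC with h | h
    · rwa [h]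
    · exact Relation.ReflTransGen.head h htail

end EquivCuts

end Growth

/-! ### The derivation attached to a free extension -/

section Derivation

variable {G : Type u} [Group G] {R : Type} [CommRing R]

/-- Translation by `g` on finitely supported functions on `G × G`, acting on the first factor. -/
noncomputable def ftrans (R : Type) [CommRing R] (g : G) : (G × G →₀ R) ≃+ (G × G →₀ R) :=
  Finsupp.domCongr ((Equiv.mulLeft g).prodCongr (Equiv.refl G))

theorem ftrans_apply (g : G) (m : G × G →₀ R) (p : G × G) :
    ftrans R g m p = m (g⁻¹ * p.1, p.2) := rfl

theorem ftrans_single (g x z : G) (r : R) :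
    ftrans R g (Finsupp.single (x, z) r) = Finsupp.single (g * x, z) r := by
  simp [ftrans, Finsupp.domCongr_apply]

theorem ftrans_mul (g h : G) (m : G × G →₀ R) : ftrans R (g * h) m = ftrans R g (ftrans R h m) := by
  ext p
  simp [ftrans_apply, mul_assoc]

theorem ftrans_one (m : G × G →₀ R) : ftrans R 1 m = m := by
  ext p
  simp [ftrans_apply]

/-- The boundary of a chain of edges `(x, z)` joining `x • v₀` and `x • z • v₀`. -/
noncomputable def bdry {V : Type*} [MulAction G V] (v₀ : V) : (G × G →₀ R) →+ (V →₀ R) :=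
  Finsupp.mapDomain.addMonoidHom (fun p : G × G => (p.1 * p.2) • v₀) -
    Finsupp.mapDomain.addMonoidHom (fun p : G × G => p.1 • v₀)

variable {V : Type*} [MulAction G V] {v₀ : V}

theorem bdry_single (x z : G) (r : R) :
    bdry v₀ (Finsupp.single (x, z) r) =
      Finsupp.single ((x * z) • v₀) r - Finsupp.single (x • v₀) r := by
  simp [bdry, Finsupp.mapDomain_single]

theorem bdry_ftrans (g : G) (m : G × G →₀ R) :
    bdry v₀ (ftrans R g m) = Finsupp.mapDomain (g • ·) (bdry v₀ m) := by
  induction m using Finsupp.induction_linear with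
  | zero => simp
  | add a b ha hb => simp only [map_add, ha, hb, Finsupp.mapDomain_add]
  | single p r =>
    obtain ⟨x, z⟩ := p
    rw [ftrans_single, bdry_single, bdry_single, sub_eq_add_neg, sub_eq_add_neg,
      Finsupp.mapDomain_add, Finsupp.mapDomain_single, ← Finsupp.single_neg, ← Finsupp.single_neg,
      Finsupp.mapDomain_single, smul_smul, smul_smul, mul_assoc]

/-- The sum of the coefficients of a boundary vanishes. -/
theorem degree_bdry (m : G × G →₀ R) :
    (bdry v₀ m).sum (fun _ r => r) = 0 := by
  induction m using Finsupp.induction_linear with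
  | zero => simp
  | add a b ha hb =>
    rw [map_add, Finsupp.sum_add_index' (fun _ => rfl) (fun _ _ _ => rfl), ha, hb, add_zero]
  | single p r =>
    obtain ⟨x, z⟩ := p
    rw [bdry_single, Finsupp.sum_sub_index (fun _ _ _ => rfl), Finsupp.sum_single_index rfl,
      Finsupp.sum_single_index rfl, sub_self]

/-- A crossed homomorphism into chains of edges which is trivial on `H` and sends each `z ∈ Z`
to the edge `(1, z)`. -/
structure IsDerivation (H : Subgroup G) (Z : Set G) (d : G → (G × G →₀ R)) : Prop where
  base : ∀ x ∈ H, d x = 0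
  gen : ∀ z ∈ Z, d z = Finsupp.single (1, z) 1
  mul : ∀ g h, d (g * h) = d g + ftrans R g (d h)

theorem IsExt.exists_derivation {H : Subgroup G} {Z : Set G} (h : IsExt H Z ⊤) (R : Type)
    [CommRing R] : ∃ d : G → (G × G →₀ R), IsDerivation H Z d := by
  let ρ : G →* Equiv.Perm (G × G →₀ R) :=
    { toFun := fun g => (ftrans R g).toEquiv
      map_one' := by ext1 m; exact ftrans_one m
      map_mul' := fun a b => by ext1 m; exact ftrans_mul a b m }
  obtain ⟨f, hfH, hfZ⟩ := h.exists_hom_top (P := Equiv.Perm (G × G →₀ R)) (ρ.comp H.subtype)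
    (fun z => Equiv.addLeft (Finsupp.single (1, z) 1) * ρ z)
  have key : ∀ g m m', f g (m + m') = f g m + ftrans R g m' := by
    let L : Subgroup G :=
      { carrier := {g | ∀ m m', f g (m + m') = f g m + ftrans R g m'}
        one_mem' := fun m m' => by simp [ftrans_one]
        mul_mem' := fun {a b} ha hb m m' => by
          rw [map_mul, Equiv.Perm.mul_apply, hb, ha, ftrans_mul, Equiv.Perm.mul_apply]
        inv_mem' := fun {a} ha m m' => by
          apply (f a).injective
          have h1 : ∀ n, f a (f a⁻¹ n) = n := fun n => by
            rw [← Equiv.Perm.mul_apply, ← map_mul, mul_inv_cancel, map_one, Equiv.Perm.one_apply]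
          rw [ha, h1, h1, ← ftrans_mul, mul_inv_cancel, ftrans_one] }
    have : ⊤ ≤ L := h.le_of (fun x hx m m' => ?_) fun z hz m m' => ?_
    · exact fun g => this (Subgroup.mem_top g)
    · rw [hfH x hx]
      exact map_add (ftrans R x) m m'
    · rw [hfZ z hz]
      change Finsupp.single (1, z) 1 + ftrans R z (m + m') =
        Finsupp.single (1, z) 1 + ftrans R z m + ftrans R z m'
      rw [map_add, add_assoc]
  refine ⟨fun g => f g 0, fun x hx => ?_, fun z hz => ?_, fun g g' => ?_⟩
  · simp only [hfH x hx]
    exact map_zero (ftrans R x)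
  · simp only [hfZ z hz]
    change Finsupp.single (1, z) 1 + ftrans R z 0 = _
    rw [map_zero, add_zero]
  · simp only [map_mul, Equiv.Perm.mul_apply]
    rw [← key, zero_add]

namespace IsDerivation

variable {H : Subgroup G} {Z : Set G} {d : G → (G × G →₀ R)}

theorem one (hd : IsDerivation H Z d) : d 1 = 0 := hd.base 1 H.one_mem

theorem inv (hd : IsDerivation H Z d) (g : G) : d g⁻¹ = - ftrans R g⁻¹ (d g) := by
  have := hd.mul g⁻¹ g
  rw [inv_mul_cancel, hd.one] at this
  exact eq_neg_of_add_eq_zero_left this.symm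

theorem mul_apply (hd : IsDerivation H Z d) (g h : G) (p : G × G) :
    d (g * h) p = d g p + d h (g⁻¹ * p.1, p.2) := by
  rw [hd.mul]; rfl

theorem mul_base (hd : IsDerivation H Z d) (g : G) {h : G} (hh : h ∈ H) : d (g * h) = d g := by
  rw [hd.mul, hd.base h hh, map_zero, add_zero]

/-- The boundary of `d g` is the difference of the endpoints `g • v₀` and `v₀`. -/
theorem bdry_eq (hd : IsDerivation H Z d) (h : IsExt H Z ⊤) (hv : ∀ x ∈ H, x • v₀ = v₀) (g : G) :
    bdry v₀ (d g) = Finsupp.single (g • v₀) 1 - Finsupp.single v₀ 1 := by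
  have hsub : ∀ (g : G) (a b : V →₀ R), Finsupp.mapDomain (g • ·) (a - b) =
      Finsupp.mapDomain (g • ·) a - Finsupp.mapDomain (g • ·) b := fun g a b =>
    map_sub (Finsupp.mapDomain.addMonoidHom (g • · : V → V)) a b
  let L : Subgroup G :=
    { carrier := {g | bdry v₀ (d g) = Finsupp.single (g • v₀) 1 - Finsupp.single v₀ 1}
      one_mem' := by simp [hd.one]
      mul_mem' := fun {a b} ha hb => by
        have ha' : bdry v₀ (d a) = Finsupp.single (a • v₀) 1 - Finsupp.single v₀ 1 := ha
        have hb' : bdry v₀ (d b) = Finsupp.single (b • v₀) 1 - Finsupp.single v₀ 1 := hb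
        change bdry v₀ (d (a * b)) = _
        rw [hd.mul, map_add, bdry_ftrans, ha', hb', hsub, Finsupp.mapDomain_single,
          Finsupp.mapDomain_single, smul_smul]
        abel
      inv_mem' := fun {a} ha => by
        have ha' : bdry v₀ (d a) = Finsupp.single (a • v₀) 1 - Finsupp.single v₀ 1 := ha
        change bdry v₀ (d a⁻¹) = _
        rw [hd.inv, map_neg, bdry_ftrans, ha', hsub, Finsupp.mapDomain_single,
          Finsupp.mapDomain_single, inv_smul_smul]
        abel }
  have : ⊤ ≤ L := h.le_of (fun x hx => ?_) fun z hz => ?_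
  · exact this (Subgroup.mem_top g)
  · change bdry v₀ (d x) = _
    rw [hd.base x hx, hv x hx, map_zero, sub_self]
  · change bdry v₀ (d z) = _
    rw [hd.gen z hz, bdry_single, one_mul, one_smul]

end IsDerivation

end Derivation

open Pointwise Filter

/-! ### Rigidity of the cuts attached to a derivation -/

section Rigid

variable {G : Type u} [Group G] {V : Type*} [MulAction G V] {τ : Equiv.Perm V} {v₀ : V}
  {𝒟 : Set (Set V)} {Q : Set V} {g : G}

theorem injective_zpow (htf : ∀ (g : G) (n : ℕ), n ≠ 0 → g ^ n = 1 → g = 1) (hg : g ≠ 1) :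
    Function.Injective (fun i : ℤ => g ^ i) := by
  refine injective_zpow_iff_not_isOfFinOrder.2 fun h => ?_
  obtain ⟨n, hn, hgn⟩ := isOfFinOrder_iff_pow_eq_one.1 h
  exact hg (htf g n hn.ne' hgn)

namespace EquivCuts

theorem coadj_zpow (h𝒟 : EquivCuts G τ 𝒟) (hQ : Q ∈ 𝒟) (hinj : Function.Injective (g ^ · : ℤ → G))
    (h : Coadj 𝒟 Q (g • Q)) {i j : ℤ} (hij : i ≠ j) : Coadj 𝒟 (g ^ i • Q) (g ^ j • Q) := by
  have key : ∀ n : ℕ, Coadj 𝒟 Q (g ^ ((n : ℤ) + 1) • Q) := by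
    intro n
    induction n with
    | zero => simpa using h
    | succ n ih =>
      have h1 := h𝒟.coadj_smul (g ^ ((n : ℤ) + 1)) h
      rw [smul_smul, ← zpow_add_one] at h1
      refine Coadj.trans h𝒟.toCutSystem hQ (h𝒟.smul_mem _ _ hQ) (h𝒟.smul_mem _ _ hQ) ih ?_ ?_
      · exact_mod_cast h1
      · intro h2
        have := h𝒟.free _ Q hQ h2.symm
        have := hinj (this.trans (zpow_zero g).symm)
        push_cast at this
        lia
  have lt : ∀ {i j : ℤ}, i < j → Coadj 𝒟 (g ^ i • Q) (g ^ j • Q) := by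
    intro i j hlt
    have := h𝒟.coadj_smul (g ^ i) (key (j - i - 1).toNat)
    rw [smul_smul, ← zpow_add] at this
    rwa [show i + (((j - i - 1).toNat : ℤ) + 1) = j by lia] at this
  rcases lt_or_gt_of_ne hij with h1 | h1
  · exact lt h1
  · exact (lt h1).symm h𝒟.toCutSystem

theorem eventually_mem_iff (h𝒟 : EquivCuts G τ 𝒟) (hQ : Q ∈ 𝒟)
    (hinj : Function.Injective (g ^ · : ℤ → G)) (h : Coadj 𝒟 Q (g • Q)) {v : V} (hv : v ∈ Q)
    {D : Set V} (hD : BoolGen 𝒟 D) :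
    ∃ P : Prop, ∀ᶠ i : ℤ in cofinite, (g ^ i • v ∈ D ↔ P) := by
  have hco := fun {i j : ℤ} => h𝒟.coadj_zpow hQ hinj h (i := i) (j := j)
  have hvi : ∀ i : ℤ, g ^ i • v ∈ g ^ i • Q := fun i => Set.smul_mem_smul_set hv
  have huniq : ∀ {i j : ℤ}, g ^ i • v ∈ g ^ j • Q → i = j := by
    intro i j hi
    by_contra hne
    exact (hco hne).1.subset (hvi i) hi
  induction hD with
  | @basic D hD =>
    by_cases h1 : ∃ i : ℤ, D ⊆ g ^ i • Q
    · obtain ⟨i, hi⟩ := h1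
      refine ⟨False, ?_⟩
      filter_upwards [(Set.finite_singleton i).compl_mem_cofinite] with j hj
      simpa using fun hj' => hj (huniq (hi hj'))
    by_cases h2 : ∃ i : ℤ, Dᶜ ⊆ g ^ i • Q
    · obtain ⟨i, hi⟩ := h2
      refine ⟨True, ?_⟩
      filter_upwards [(Set.finite_singleton i).compl_mem_cofinite] with j hj
      rw [iff_true]
      by_contra hj'
      exact hj (huniq (hi hj'))
    push Not at h1 h2
    have hcases : ∀ i : ℤ, g ^ i • Q ⊆ D ∨ g ^ i • Q ⊆ Dᶜ := by
      intro i
      rcases h𝒟.nested _ (h𝒟.smul_mem (g ^ i) Q hQ) D hD with h | h | h | h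
      · exact Or.inl h
      · exact absurd h (h1 i)
      · exact Or.inr h
      · exact absurd h (h2 i)
    have hcontra : ∀ {i j : ℤ}, g ^ i • Q ⊆ D → g ^ j • Q ⊆ Dᶜ → False := by
      intro i j hi hj
      have hne : i ≠ j := fun h => hj (h ▸ hvi i) (hi (hvi i))
      rcases (hco hne).2 D hD hi (Set.subset_compl_comm.1 hj) with h | h
      · exact h1 i h.le
      · exact h2 j (by rw [h, compl_compl])
    rcases hcases 0 with h0 | h0
    · refine ⟨True, Eventually.of_forall fun i => ?_⟩
      rw [iff_true]
      rcases hcases i with hi | hi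
      · exact hi (hvi i)
      · exact (hcontra h0 hi).elim
    · refine ⟨False, Eventually.of_forall fun i => ?_⟩
      rw [iff_false]
      rcases hcases i with hi | hi
      · exact (hcontra hi h0).elim
      · exact hi (hvi i)
  | empty => exact ⟨False, by simp⟩
  | compl _ ih =>
    obtain ⟨P, hP⟩ := ih
    exact ⟨¬ P, hP.mono fun i hi => not_congr hi⟩
  | inter _ _ ih ih' =>
    obtain ⟨P, hP⟩ := ih
    obtain ⟨P', hP'⟩ := ih'
    refine ⟨P ∧ P', ?_⟩
    filter_upwards [hP, hP'] with i h1 h2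
    exact and_congr h1 h2

theorem pow_smul_ne_of_coadj (h𝒟 : EquivCuts G τ 𝒟) (hQ : Q ∈ 𝒟)
    (hinj : Function.Injective (g ^ · : ℤ → G)) (h : Coadj 𝒟 Q (g • Q))
    (hout : ∀ v, Q ∉ outerCuts 𝒟 v) (v : V) {k : ℕ} (hk : k ≠ 0) : g ^ k • v ≠ v := by
  intro hkv
  have hco := fun {i j : ℤ} => h𝒟.coadj_zpow hQ hinj h (i := i) (j := j)
  have hzero : (g ^ (0 : ℤ)) • Q = Q := by simp
  have hvQ : ∀ i : ℤ, v ∉ g ^ i • Q := by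
    intro i hi
    have h1 : v ∈ g ^ (i + k) • Q := by
      rw [add_comm, zpow_add, mul_smul, zpow_natCast]
      nth_rewrite 1 [← hkv]
      exact Set.smul_mem_smul_set hi
    exact (hco (show i ≠ i + k by lia)).1.subset hi h1
  obtain ⟨E, hE, hvE, hQE, hne⟩ : ∃ E ∈ 𝒟, v ∉ E ∧ Q ⊆ E ∧ E ≠ Q := by
    by_contra hcon
    push Not at hcon
    exact hout v ⟨hQ, by simpa using hvQ 0, hcon⟩
  obtain ⟨x, hx⟩ := h𝒟.nonempty Q hQ
  have hall : ∀ j : ℤ, g ^ j • Q ⊆ E := by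
    intro j
    by_cases hj : 0 = j
    · rwa [← hj, hzero]
    have hc := hco hj
    rw [hzero] at hc
    rcases h𝒟.cases_of_notMem (h𝒟.smul_mem (g ^ j) Q hQ) hE (hvQ j) hvE with h1 | h1 | h1
    · exact h1
    · exact absurd (h1 (hQE hx)) (hc.1.subset hx)
    · rcases hc.2 E hE hQE (Set.subset_compl_comm.1 h1) with h2 | h2
      · exact absurd h2 hne
      · exact absurd (h2 ▸ hvQ j : v ∈ E) hvE
  have hmem : ∀ n : ℕ, (g ^ k) ^ n • E ∈ {D | D ∈ 𝒟 ∧ v ∉ D ∧ x ∈ D} := by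
    intro n
    refine ⟨h𝒟.smul_mem _ _ hE, ?_, ?_⟩
    · have hfix : ∀ n : ℕ, (g ^ k) ^ n • v = v := by
        intro n
        induction n with
        | zero => simp
        | succ n ih => rw [pow_succ, mul_smul, hkv, ih]
      nth_rewrite 1 [← hfix n]
      rwa [Set.smul_mem_smul_set_iff]
    · rw [Set.mem_smul_set_iff_inv_smul_mem]
      apply hall (-((k : ℤ) * n))
      rw [zpow_neg, zpow_mul, zpow_natCast, zpow_natCast]
      exact Set.smul_mem_smul_set hx
  refine Set.infinite_of_injective_forall_mem (fun a b hab => ?_) hmem (h𝒟.finite v x)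
  have h1 : ((g ^ k) ^ b)⁻¹ * (g ^ k) ^ a = 1 := by
    refine h𝒟.free _ E hE ?_
    rw [mul_smul, show (g ^ k) ^ a • E = (g ^ k) ^ b • E from hab, inv_smul_smul]
  rw [inv_mul_eq_one, ← pow_mul, ← pow_mul] at h1
  have h2 := hinj (a₁ := ((k * b : ℕ) : ℤ)) (a₂ := ((k * a : ℕ) : ℤ))
      (by simpa only [zpow_natCast] using h1)
  exact (Nat.eq_of_mul_eq_mul_left (Nat.pos_of_ne_zero hk) (by exact_mod_cast h2)).symm

end EquivCuts

/-- If the values of a derivation along the orbit of `g` stabilise, then a power of `g` fixes a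
point. -/
theorem IsDerivation.exists_pow_smul_eq {H : Subgroup G} {Z : Set G} (h : IsExt H Z ⊤)
    {d : G → (G × G →₀ ℤ)} (hd : IsDerivation H Z d) (hH : ∀ x ∈ H, x • v₀ = v₀)
    (hinj : Function.Injective (g ^ · : ℤ → G)) (u : G)
    (hfin : ∀ p j, ∃ P : Prop, ∀ᶠ i : ℤ in cofinite, (d (g ^ i * u) p = j ↔ P)) :
    ∃ v : V, ∃ k : ℕ, k ≠ 0 ∧ g ^ k • v = v := by
  have hinj' : ∀ p : G × G, Function.Injective fun i : ℤ => ((g ^ i)⁻¹ * p.1, p.2) := by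
    intro p i j hij
    exact hinj (inv_injective (mul_right_cancel (Prod.ext_iff.1 hij).1))
  have hzero : ∀ (m : G × G →₀ ℤ) (p : G × G), ∀ᶠ i : ℤ in cofinite,
      m ((g ^ i)⁻¹ * p.1, p.2) = 0 := by
    intro m p
    have := (hinj' p).tendsto_cofinite.eventually (m.support.finite_toSet.compl_mem_cofinite)
    filter_upwards [this] with i hi
    simpa using hi
  have hlim : ∀ p, ∃ j, ∀ᶠ i : ℤ in cofinite, d (g ^ i * u) p = j := by
    intro p
    have hstep : ∀ᶠ i : ℤ in cofinite, d (g ^ (i + 1) * u) p = d (g ^ i * u) p := by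
      filter_upwards [hzero (d (g * u) - d u) p] with i hi
      rw [Finsupp.sub_apply, sub_eq_zero] at hi
      rw [zpow_add_one, mul_assoc, hd.mul_apply (g ^ i) (g * u), hd.mul_apply (g ^ i) u, hi]
    have hfinite : {i : ℤ | ¬ d (g ^ (i + 1) * u) p = d (g ^ i * u) p}.Finite := hstep
    obtain ⟨N, hN⟩ := hfinite.bddAbove
    have hconst : ∀ n : ℕ, d (g ^ (N + 1 + n) * u) p = d (g ^ (N + 1) * u) p := by
      intro n
      induction n with
      | zero => simp
      | succ n ih =>
        rw [← ih]
        by_contra hne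
        have := hN (a := N + 1 + n) (by simpa [add_assoc] using hne)
        lia
    obtain ⟨P, hP⟩ := hfin p (d (g ^ (N + 1) * u) p)
    have hPtrue : P := by
      by_contra hPn
      have hsub : Set.range (fun n : ℕ => N + 1 + (n : ℤ)) ⊆
          {i : ℤ | ¬ (d (g ^ i * u) p = d (g ^ (N + 1) * u) p ↔ P)} := by
        rintro _ ⟨n, rfl⟩
        simp [hconst n, hPn]
      exact Set.infinite_range_of_injective (fun a b hab => by simpa using hab)
        (Set.Finite.subset hP hsub)
    exact ⟨_, hP.mono fun i hi => hi.2 hPtrue⟩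
  choose ω hω using hlim
  have hshift : ∀ (n : ℤ) (p : G × G), ω p = d (g ^ n) p + ω ((g ^ n)⁻¹ * p.1, p.2) := by
    intro n p
    have h1 := (add_right_injective n).tendsto_cofinite.eventually (hω p)
    obtain ⟨i, hi, hi'⟩ := (h1.and (hω ((g ^ n)⁻¹ * p.1, p.2))).exists
    rw [← hi, ← hi', zpow_add, mul_assoc, hd.mul_apply]
  have hvan : ∀ p : G × G, ∀ᶠ n : ℤ in cofinite, ω ((g ^ n)⁻¹ * p.1, p.2) = 0 := by
    intro p
    filter_upwards [hω p, hzero (d u) p] with n h1 h2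
    have h3 := hshift n p
    rw [← h1, hd.mul_apply, h2, add_zero] at h3
    lia
  have hsupp : (Function.support ω).Finite := by
    let T := (d g).support
    have hT : ∀ p : G × G, ω p ≠ ω (g⁻¹ * p.1, p.2) → p ∈ T := by
      intro p hp
      have := hshift 1 p
      rw [zpow_one] at this
      rw [Finsupp.mem_support_iff]
      lia
    have hbd : ∀ t : G × G, ∃ N : ℤ, ∀ n : ℤ, ((g ^ n) * t.1, t.2) ∈ T → n ≤ N := by
      intro t
      have hf : {n : ℤ | (g ^ n * t.1, t.2) ∈ T}.Finite := by
        refine Set.Finite.preimage (Function.Injective.injOn fun i j hij => ?_) T.finite_toSet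
        exact hinj (mul_right_cancel (Prod.ext_iff.1 hij).1)
      obtain ⟨N, hN⟩ := hf.bddAbove
      exact ⟨N, fun n hn => hN hn⟩
    choose N hN using hbd
    refine Set.Finite.subset (T.finite_toSet.biUnion fun t _ =>
      (Set.finite_Icc 0 (N t)).image fun i : ℤ => (g ^ i * t.1, t.2)) fun p hp => ?_
    obtain ⟨a, ha⟩ : ∃ a : ℕ, ω ((g ^ (a : ℤ))⁻¹ * p.1, p.2) = 0 :=
      (Nat.cast_injective.tendsto_cofinite.eventually (hvan p)).exists
    obtain ⟨b, hb⟩ : ∃ b : ℕ, ω ((g ^ (-(b : ℤ)))⁻¹ * p.1, p.2) = 0 :=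
      ((neg_injective.comp Nat.cast_injective).tendsto_cofinite.eventually (hvan p)).exists
    have hback : ∃ i : ℕ, ((g ^ (i : ℤ))⁻¹ * p.1, p.2) ∈ T := by
      by_contra hcon
      push Not at hcon
      refine hp ?_
      have : ∀ n : ℕ, ω ((g ^ (n : ℤ))⁻¹ * p.1, p.2) = ω p := by
        intro n
        induction n with
        | zero => simp
        | succ n ih =>
          rw [← ih]
          by_contra hne
          refine hcon n (hT _ fun h => hne ?_)
          rw [h, ← mul_assoc, ← mul_inv_rev, Nat.cast_succ, zpow_add_one]
      rw [← this a, ha]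
    have hforw : ∃ j : ℕ, ((g ^ (j : ℤ)) * p.1, p.2) ∈ T := by
      by_contra hcon
      push Not at hcon
      refine hp ?_
      have : ∀ n : ℕ, ω (g ^ (n : ℤ) * p.1, p.2) = ω p := by
        intro n
        induction n with
        | zero => simp
        | succ n ih =>
          rw [← ih]
          by_contra hne
          refine hcon (n + 1) (hT _ fun h => hne ?_)
          rw [h, ← mul_assoc, Nat.cast_succ, add_comm, zpow_one_add, inv_mul_cancel_left]
      rw [← this b, ← hb, zpow_neg, inv_inv]
    obtain ⟨i, hi⟩ := hback
    obtain ⟨j, hj⟩ := hforw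
    refine Set.mem_biUnion hi ⟨i, ⟨by lia, ?_⟩, by simp⟩
    have := hN ((g ^ (i : ℤ))⁻¹ * p.1, p.2) (i + j)
      (by rw [add_comm, zpow_add, mul_assoc, mul_inv_cancel_left]; exact hj)
    lia
  let m : G × G →₀ ℤ := Finsupp.ofSupportFinite ω hsupp
  have hm : m = d g + ftrans ℤ g m := by
    ext p
    have := hshift 1 p
    rw [zpow_one] at this
    exact this
  let μ : V →₀ ℤ := Finsupp.single v₀ 1 + bdry v₀ m
  have hμ : Finsupp.mapDomain (g • ·) μ = μ := by
    change Finsupp.mapDomain (g • ·) (Finsupp.single v₀ 1 + bdry v₀ m) =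
      Finsupp.single v₀ 1 + bdry v₀ m
    have h1 := congrArg (bdry v₀) hm
    rw [map_add, hd.bdry_eq h hH, bdry_ftrans] at h1
    rw [Finsupp.mapDomain_add, Finsupp.mapDomain_single]
    nth_rewrite 2 [h1]
    abel
  have hμ0 : μ ≠ 0 := by
    intro h0
    have h1 : μ.sum (fun _ r => r) = 1 := by
      rw [Finsupp.sum_add_index' (fun _ => rfl) (fun _ _ _ => rfl), degree_bdry,
        Finsupp.sum_single_index rfl, add_zero]
    rw [h0, Finsupp.sum_zero_index] at h1
    exact zero_ne_one h1
  obtain ⟨v, hv⟩ := Finsupp.support_nonempty_iff.2 hμ0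
  have hinv : ∀ n : ℕ, g ^ n • v ∈ μ.support := by
    intro n
    induction n with
    | zero => simpa using hv
    | succ n ih =>
      rw [pow_succ', mul_smul, Finsupp.mem_support_iff, ← hμ,
        Finsupp.mapDomain_apply (MulAction.injective g)]
      exact Finsupp.mem_support_iff.1 ih
  have hninj : ¬ Function.Injective fun n : ℕ => g ^ n • v := fun hi =>
    Set.infinite_of_injective_forall_mem hi hinv μ.support.finite_toSet
  rw [Function.Injective] at hninj
  push Not at hninj
  obtain ⟨a, b, hab, hne⟩ := hninj
  have key : ∀ {a b : ℕ}, a < b → g ^ a • v = g ^ b • v → ∃ k : ℕ, k ≠ 0 ∧ g ^ k • v = v := by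
    intro a b hlt hab
    refine ⟨b - a, by lia, MulAction.injective (g ^ a) ?_⟩
    change g ^ a • g ^ (b - a) • v = g ^ a • v
    rw [smul_smul, ← pow_add, Nat.add_sub_cancel' hlt.le, hab]
  rcases lt_or_gt_of_ne hne with hlt | hlt
  · exact ⟨v, key hlt hab⟩
  · exact ⟨v, key hlt hab.symm⟩

theorem EquivCuts.rigidCuts (h𝒟 : EquivCuts G τ 𝒟)
    (htf : ∀ (g : G) (n : ℕ), n ≠ 0 → g ^ n = 1 → g = 1) {H : Subgroup G} {Z : Set G}
    (h : IsExt H Z ⊤) {d : G → (G × G →₀ ℤ)} (hd : IsDerivation H Z d)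
    (hH : ∀ x, x • v₀ = v₀ ↔ x ∈ H) (htrans : ∀ v, ∃ g : G, g • v₀ = v)
    (hfib : ∀ p j, BoolGen 𝒟 {v | ∃ g : G, v = g • v₀ ∧ d g p = j}) : RigidCuts G 𝒟 := by
  intro Q hQ hout g hg
  by_contra hne
  have hinj := injective_zpow htf hne
  obtain ⟨x, hx⟩ := h𝒟.nonempty Q hQ
  obtain ⟨u, rfl⟩ := htrans x
  obtain ⟨v, k, hk, hkv⟩ := hd.exists_pow_smul_eq (V := V) (v₀ := v₀) h (fun x hx => (hH x).2 hx)
    hinj u fun p j => by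
      obtain ⟨P, hP⟩ := h𝒟.eventually_mem_iff hQ hinj hg hx (hfib p j)
      refine ⟨P, hP.mono fun i hi => Iff.trans ⟨fun h1 => ?_, fun h1 => ?_⟩ hi⟩
      · exact ⟨g ^ i * u, smul_smul _ _ _, h1⟩
      · obtain ⟨a, ha, ha'⟩ := h1
        rw [smul_smul] at ha
        have h2 : a⁻¹ * (g ^ i * u) ∈ H := (hH _).1 (by rw [mul_smul, ha, inv_smul_smul])
        rw [← ha', ← hd.mul_base a h2, mul_inv_cancel_left]
  exact h𝒟.pow_smul_ne_of_coadj hQ hinj hg hout v hk hkv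

end Rigid

/-! ### Cuts of the coset graph of a free extension -/

/-- Adjacency in the coset graph: the edges join `g • v₀` and `(g * z) • v₀` for `z ∈ W`. -/
def genRel {G : Type*} [Group G] {V : Type*} [MulAction G V] (v₀ : V) (W : Set G)
    (a b : V) : Prop :=
  ∃ g : G, ∃ z ∈ W, (a = g • v₀ ∧ b = (g * z) • v₀) ∨ (b = g • v₀ ∧ a = (g * z) • v₀)

section CosetGraph

variable {G : Type u} [Group G] {V : Type*} [MulAction G V] {v₀ : V} {W : Set G} {φ : MulAut G}
  {w : G} {τ : Equiv.Perm V} {H : Subgroup G} {Z : Set G} {d : G → (G × G →₀ ℤ)}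

theorem genRel_symm ⦃a b : V⦄ (h : genRel v₀ W a b) : genRel v₀ W b a := by
  obtain ⟨g, z, hz, h⟩ := h
  exact ⟨g, z, hz, h.symm⟩

theorem genRel_smul (g : G) {a b : V} (h : genRel v₀ W a b) : genRel v₀ W (g • a) (g • b) := by
  obtain ⟨x, z, hz, ⟨rfl, rfl⟩ | ⟨rfl, rfl⟩⟩ := h
  · exact ⟨g * x, z, hz, Or.inl ⟨smul_smul _ _ _, by rw [smul_smul, mul_assoc]⟩⟩
  · exact ⟨g * x, z, hz, Or.inr ⟨smul_smul _ _ _, by rw [smul_smul, mul_assoc]⟩⟩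

theorem genRel_smul_iff (g : G) (a b : V) : genRel v₀ W (g • a) (g • b) ↔ genRel v₀ W a b :=
  ⟨fun h => by simpa using genRel_smul g⁻¹ h, genRel_smul g⟩

theorem genRel_twist (hτ : TwistedAction φ w τ v₀) {a b : V}
    (h : genRel v₀ (Z ∪ φ '' Z) a b) : genRel v₀ (Z ∪ φ '' Z) (τ a) (τ b) := by
  obtain ⟨x, z, hz, h⟩ := h
  have hw := hτ.smul_base
  rcases hz with hz | ⟨z, hz, rfl⟩
  · refine ⟨φ x, φ z, Or.inr ⟨z, hz, rfl⟩, h.imp ?_ ?_⟩ <;>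
    · rintro ⟨rfl, rfl⟩
      simp only [hτ.map_smul_base, map_mul, and_self]
  · have hw' : w⁻¹ • v₀ = v₀ := inv_smul_eq_iff.2 hw.symm
    refine ⟨φ x * w, z, Or.inl hz, h.imp ?_ ?_⟩ <;>
    · rintro ⟨rfl, rfl⟩
      simp only [hτ.map_smul_base, map_mul, hτ.aut_sq]
      constructor
      · rw [mul_smul, hw]
      · simp only [mul_smul, hw']

theorem genRel_twist_iff (hτ : TwistedAction φ w τ v₀) (a b : V) :
    genRel v₀ (Z ∪ φ '' Z) (τ a) (τ b) ↔ genRel v₀ (Z ∪ φ '' Z) a b := by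
  refine ⟨fun h => ?_, genRel_twist hτ⟩
  have := genRel_twist hτ h
  rwa [hτ.sq, hτ.sq, genRel_smul_iff] at this

theorem genRel_connected (hext : IsExt H Z ⊤) (hZW : Z ⊆ W) (hH : ∀ x, x • v₀ = v₀ ↔ x ∈ H)
    (htrans : ∀ v : V, ∃ g : G, g • v₀ = v) (x y : V) :
    Relation.ReflTransGen (genRel v₀ W) x y := by
  have hsm : ∀ (g : G) {a b : V}, Relation.ReflTransGen (genRel v₀ W) a b →
      Relation.ReflTransGen (genRel v₀ W) (g • a) (g • b) := fun g a b h =>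
    h.lift (g • ·) fun _ _ => genRel_smul g
  have hsym : ∀ {a b : V}, Relation.ReflTransGen (genRel v₀ W) a b →
      Relation.ReflTransGen (genRel v₀ W) b a := fun h =>
    Relation.ReflTransGen.mono (fun _ _ h => genRel_symm h) _ _ (Relation.reflTransGen_swap.1 h)
  let L : Subgroup G :=
    { carrier := {g | Relation.ReflTransGen (genRel v₀ W) v₀ (g • v₀)}
      one_mem' := by simp only [Set.mem_ofPred_eq, one_smul]; exact .refl
      mul_mem' := fun {a b} ha hb => by
        have := hsm a hb
        rw [smul_smul] at this
        exact ha.trans this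
      inv_mem' := fun {a} ha => by
        have := hsm a⁻¹ ha
        rw [inv_smul_smul] at this
        exact hsym this }
  have htop : ⊤ ≤ L := hext.le_of (fun x hx => by
      change Relation.ReflTransGen (genRel v₀ W) v₀ (x • v₀)
      rw [(hH x).2 hx]) fun z hz =>
    .single ⟨1, z, hZW hz, Or.inl ⟨(one_smul _ _).symm, by rw [one_mul]⟩⟩
  have hall : ∀ v : V, Relation.ReflTransGen (genRel v₀ W) v₀ v := by
    intro v
    obtain ⟨g, rfl⟩ := htrans v
    exact htop (Subgroup.mem_top g)
  exact (hsym (hall x)).trans (hall y)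

theorem IsDerivation.eq_one_of_smul_eq (hd : IsDerivation H Z d) {h z : G} (hz : z ∈ Z)
    (hh : h ∈ H) (hhz : z⁻¹ * h * z ∈ H) : h = 1 := by
  have h1 : d (h * z) = Finsupp.single (h, z) 1 := by
    rw [hd.mul, hd.base h hh, hd.gen z hz, ftrans_single, zero_add, mul_one]
  have h2 := hd.mul_base z hhz
  rw [show z * (z⁻¹ * h * z) = h * z by group, h1, hd.gen z hz] at h2
  exact (Prod.ext_iff.1 (Finsupp.single_left_injective one_ne_zero h2)).1

/-- Edges of the coset graph have trivial stabiliser. -/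
theorem eq_one_of_smul_edge (hd : IsDerivation H Z d) (hH : ∀ x, x • v₀ = v₀ ↔ x ∈ H)
    (hφH : ∀ x, φ x ∈ H ↔ x ∈ H) {a b : V} (hab : genRel v₀ (Z ∪ φ '' Z) a b) {g : G}
    (ha : g • a = a) (hb : g • b = b) : g = 1 := by
  have key : ∀ z ∈ Z ∪ φ '' Z, ∀ h ∈ H, z⁻¹ * h * z ∈ H → h = 1 := by
    rintro z (hz | ⟨z, hz, rfl⟩) h hh hhz
    · exact hd.eq_one_of_smul_eq hz hh hhz
    · obtain ⟨h, rfl⟩ := φ.surjective h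
      rw [← map_inv, ← map_mul, ← map_mul, hφH] at hhz
      rw [hd.eq_one_of_smul_eq hz ((hφH h).1 hh) hhz, map_one]
  have main : ∀ x : G, ∀ z ∈ Z ∪ φ '' Z, g • x • v₀ = x • v₀ → g • (x * z) • v₀ = (x * z) • v₀ →
      g = 1 := by
    intro x z hz h1 h2
    have h3 : x⁻¹ * g * x ∈ H := by
      rw [← hH, mul_smul, mul_smul, h1, inv_smul_smul]
    have h4 : z⁻¹ * (x⁻¹ * g * x) * z ∈ H := by
      rw [show z⁻¹ * (x⁻¹ * g * x) * z = (x * z)⁻¹ * g * (x * z) by group, ← hH, mul_smul, mul_smul,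
        h2, inv_smul_smul]
    have h5 := key z hz _ h3 h4
    rw [show g = x * (x⁻¹ * g * x) * x⁻¹ by group, h5, mul_one, mul_inv_cancel]
  obtain ⟨x, z, hz, ⟨rfl, rfl⟩ | ⟨rfl, rfl⟩⟩ := hab
  · exact main x z hz ha hb
  · exact main x z hz hb ha

/-- The fibres of the coordinates of a derivation have uniformly bounded edge boundary. -/
theorem IsDerivation.exists_bound (hd : IsDerivation H Z d) (hH : ∀ x, x • v₀ = v₀ ↔ x ∈ H)
    (hW : W.Finite) : ∃ N : ℕ, ∀ p j, (edgeBoundary (genRel v₀ W)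
      {v | ∃ g : G, v = g • v₀ ∧ d g p = j}).encard ≤ N := by
  classical
  let S : Finset ((G × (G × G)) × Bool) :=
    (hW.toFinset.biUnion fun z => (d z).support.image fun q => (z, q)) ×ˢ Finset.univ
  refine ⟨S.card, fun p j => ?_⟩
  let f : (G × (G × G)) × Bool → V × V := fun s =>
    if s.2 then ((p.1 * s.1.2.1⁻¹) • v₀, (p.1 * s.1.2.1⁻¹ * s.1.1) • v₀)
    else ((p.1 * s.1.2.1⁻¹ * s.1.1) • v₀, (p.1 * s.1.2.1⁻¹) • v₀)
  have hmemS : ∀ z ∈ W, ∀ g, d (g * z) p ≠ d g p → ∀ b, ((z, (g⁻¹ * p.1, p.2)), b) ∈ S := by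
    intro z hz g hne b
    rw [hd.mul_apply] at hne
    simp only [S, Finset.mem_product, Finset.mem_univ, and_true, Finset.mem_biUnion,
      Finset.mem_image, Set.Finite.mem_toFinset]
    refine ⟨z, hz, _, ?_, rfl⟩
    rw [Finsupp.mem_support_iff]
    intro h0
    exact hne (by rw [h0, add_zero])
  have hval : ∀ {a b : G}, a • v₀ = b • v₀ → d a = d b := by
    intro a b hab
    have h2 : b⁻¹ * a ∈ H := (hH _).1 (by rw [mul_smul, hab, inv_smul_smul])
    rw [← hd.mul_base b h2, mul_inv_cancel_left]
  have hsub : edgeBoundary (genRel v₀ W) {v | ∃ g : G, v = g • v₀ ∧ d g p = j} ⊆ f '' S := by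
    rintro ⟨a, b⟩ ⟨⟨g, z, hz, ⟨ha, hb⟩ | ⟨hb, ha⟩⟩, ⟨x, hx, hxj⟩, hnb⟩
    · obtain rfl : a = g • v₀ := ha
      obtain rfl : b = (g * z) • v₀ := hb
      refine ⟨((z, (g⁻¹ * p.1, p.2)), true), hmemS z hz g (fun h => ?_) _, by simp [f]⟩
      exact hnb ⟨g * z, rfl, by rw [h, hval hx, hxj]⟩
    · obtain rfl : b = g • v₀ := hb
      obtain rfl : a = (g * z) • v₀ := ha
      refine ⟨((z, (g⁻¹ * p.1, p.2)), false), hmemS z hz g (fun h => ?_) _, by simp [f]⟩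
      exact hnb ⟨g, rfl, by rw [← h, hval hx, hxj]⟩
  calc _ ≤ (f '' S).encard := Set.encard_le_encard hsub
    _ ≤ (S : Set ((G × (G × G)) × Bool)).encard := Set.encard_image_le _ _
    _ = S.card := Set.encard_coe_eq_coe_finsetCard S

theorem equivCuts_optimalCuts (htf : ∀ (g : G) (n : ℕ), n ≠ 0 → g ^ n = 1 → g = 1)
    (hτ : TwistedAction φ w τ v₀) (hext : IsExt H Z ⊤) (hd : IsDerivation H Z d)
    (hH : ∀ x, x • v₀ = v₀ ↔ x ∈ H) (hφH : ∀ x, φ x ∈ H ↔ x ∈ H) (N : ℕ) :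
    EquivCuts G τ (optimalCuts (genRel v₀ (Z ∪ φ '' Z)) N) := by
  have hr : ∀ ⦃a b⦄, genRel v₀ (Z ∪ φ '' Z) a b → genRel v₀ (Z ∪ φ '' Z) b a := genRel_symm
  have hconn := genRel_connected hext (Set.subset_union_left : Z ⊆ Z ∪ φ '' Z) hH hτ.trans
  refine ⟨⟨fun D hD => optimalCuts_nonempty hD, fun D hD => optimalCuts_compl hr hD,
    fun C hC D hD => not_crosses_cases (not_crosses_optimalCuts hr hconn hC hD), fun x y => ?_⟩,
    fun g D hD => ?_, fun D hD => ?_, fun g D hD hgD => ?_⟩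
  · refine (finite_tight_separating hr hconn N y x).subset fun D hD => ?_
    exact ⟨tight_of_mem_optimalCuts hr hconn hD.1, hD.1.1, hD.2.2, hD.2.1⟩
  · have := preimage_mem_optimalCuts (MulAction.toPerm g⁻¹) (genRel_smul_iff g⁻¹) hD
    rwa [show (MulAction.toPerm g⁻¹ : V → V) ⁻¹' D = g • D from Set.preimage_smul_inv g D] at this
  · have hσ : ∀ a b, genRel v₀ (Z ∪ φ '' Z) (τ.symm a) (τ.symm b) ↔
        genRel v₀ (Z ∪ φ '' Z) a b := fun a b => by rw [← genRel_twist_iff hτ]; simp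
    have := preimage_mem_optimalCuts τ.symm hσ hD
    rwa [← τ.image_eq_preimage_symm] at this
  · obtain ⟨⟨a, b⟩, hab⟩ := edgeBoundary_nonempty hconn (optimalCuts_nonempty hD)
      (optimalCuts_nonempty (optimalCuts_compl hr hD))
    have hmem : ∀ n : ℕ, (g ^ n • a, g ^ n • b) ∈ edgeBoundary (genRel v₀ (Z ∪ φ '' Z)) D := by
      intro n
      induction n with
      | zero => simpa using hab
      | succ n ih =>
        rw [pow_succ', mul_smul, mul_smul]
        refine ⟨genRel_smul g ih.1, ?_, fun h => ih.2.2 ?_⟩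
        · rw [← hgD]
          exact Set.smul_mem_smul_set ih.2.1
        · rw [← hgD] at h
          exact Set.smul_mem_smul_set_iff.1 h
    have hninj : ¬ Function.Injective fun n : ℕ => (g ^ n • a, g ^ n • b) := fun hi =>
      Set.infinite_of_injective_forall_mem hi hmem (finite_of_mem_optimalCuts hD)
    rw [Function.Injective] at hninj
    push Not at hninj
    obtain ⟨m, n, hmn, hne⟩ := hninj
    have key : ∀ {m n : ℕ}, m < n → (g ^ m • a, g ^ m • b) = (g ^ n • a, g ^ n • b) → g = 1 := by
      intro m n hlt hmn
      have hcancel : ∀ x : V, g ^ m • x = g ^ n • x → g ^ (n - m) • x = x := fun x hx => by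
        refine MulAction.injective (g ^ m) ?_
        change g ^ m • g ^ (n - m) • x = g ^ m • x
        rw [smul_smul, ← pow_add, Nat.add_sub_cancel' hlt.le, hx]
      exact htf g (n - m) (by lia) (eq_one_of_smul_edge hd hH hφH hab.1
        (hcancel a (Prod.ext_iff.1 hmn).1) (hcancel b (Prod.ext_iff.1 hmn).2))
    rcases lt_or_gt_of_ne hne with hlt | hlt
    · exact key hlt hmn
    · exact key hlt hmn.symm

theorem reflTransGen_step_of_twistedAction
    (htf : ∀ (g : G) (n : ℕ), n ≠ 0 → g ^ n = 1 → g = 1)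
    (hτ : TwistedAction φ w τ v₀) (hext : IsExt H Z ⊤) (hZ : Z.Finite)
    (hH : ∀ x, x • v₀ = v₀ ↔ x ∈ H) (hφH : ∀ x, φ x ∈ H ↔ x ∈ H) :
    Relation.ReflTransGen (Step φ w) H ⊤ := by
  obtain ⟨d, hd⟩ := hext.exists_derivation ℤ
  have hW : (Z ∪ φ '' Z).Finite := hZ.union (hZ.image _)
  obtain ⟨N, hN⟩ := hd.exists_bound hH hW
  have hE := equivCuts_optimalCuts htf hτ hext hd hH hφH N
  have hr : ∀ ⦃a b⦄, genRel v₀ (Z ∪ φ '' Z) a b → genRel v₀ (Z ∪ φ '' Z) b a := genRel_symm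
  have hconn := genRel_connected hext (Set.subset_union_left : Z ⊆ Z ∪ φ '' Z) hH hτ.trans
  have hfib := fun p j => boolGen_optimalCuts _ (hN p j)
  have hrigid := hE.rigidCuts htf hext hd hH hτ.trans hfib
  have hstab : cutStab G (optimalCuts (genRel v₀ (Z ∪ φ '' Z)) N) v₀ = H := by
    ext g
    rw [hE.mem_cutStab_iff]
    refine ⟨fun h => ?_, fun h D _ => by rw [(hH g).2 h]⟩
    have hB : ∀ D, BoolGen (optimalCuts (genRel v₀ (Z ∪ φ '' Z)) N) D → (g • v₀ ∈ D ↔ v₀ ∈ D) := by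
      intro D hD
      induction hD with
      | basic hD => exact h _ hD
      | empty => simp
      | compl _ ih => exact not_congr ih
      | inter _ _ ih ih' => exact and_congr ih ih'
    have hdg : d g = 0 := by
      ext p
      obtain ⟨x, hx, hx'⟩ := (hB _ (hfib p 0)).2 ⟨1, (one_smul _ _).symm, by rw [hd.one]; rfl⟩
      have h2 : x⁻¹ * g ∈ H := (hH _).1 (by rw [mul_smul, hx, inv_smul_smul])
      have h3 := hd.mul_base x h2
      rw [mul_inv_cancel_left] at h3
      rw [h3, hx']
      rfl
    have := hd.bdry_eq hext (fun x hx => (hH x).2 hx) g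
    rw [hdg, map_zero, eq_comm, sub_eq_zero] at this
    exact (hH g).1 (Finsupp.single_left_injective one_ne_zero this)
  have hTfin : (⋃ z ∈ Z ∪ φ '' Z, ({D : Set V | Tight (genRel v₀ (Z ∪ φ '' Z)) D ∧
      (v₀, z • v₀) ∈ edgeBoundary (genRel v₀ (Z ∪ φ '' Z)) D ∧
        (edgeBoundary (genRel v₀ (Z ∪ φ '' Z)) D).encard ≤ N} ∪
      {D : Set V | Tight (genRel v₀ (Z ∪ φ '' Z)) D ∧
      (z • v₀, v₀) ∈ edgeBoundary (genRel v₀ (Z ∪ φ '' Z)) D ∧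
        (edgeBoundary (genRel v₀ (Z ∪ φ '' Z)) D).encard ≤ N})).Finite :=
    hW.biUnion fun z _ => (finite_tight_through N _ hr _).union (finite_tight_through N _ hr _)
  have := hE.reflTransGen_step_cutStab hτ (fun g hg => htf g 2 two_ne_zero (by rw [pow_two, hg]))
    hTfin.toFinset hrigid fun D hD => by
      obtain ⟨⟨a, b⟩, ⟨x, z, hz, h⟩, haD, hbD⟩ := edgeBoundary_nonempty hconn
        (optimalCuts_nonempty hD) (optimalCuts_nonempty (optimalCuts_compl hr hD))
      have hD' := hE.smul_mem x⁻¹ D hD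
      refine ⟨x⁻¹ • D, ?_, x, by rw [smul_inv_smul]⟩
      rw [Set.Finite.mem_toFinset]
      refine Set.mem_biUnion hz (h.imp ?_ ?_)
      · rintro ⟨ha, hb⟩
        obtain rfl : a = x • v₀ := ha
        obtain rfl : b = (x * z) • v₀ := hb
        refine ⟨tight_of_mem_optimalCuts hr hconn hD', ⟨⟨1, z, hz, Or.inl ⟨?_, ?_⟩⟩, ?_, ?_⟩, hD'.1⟩
        · simp
        · simp
        · simpa [Set.mem_inv_smul_set_iff] using haD
        · simpa [Set.mem_inv_smul_set_iff, smul_smul] using hbD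
      · rintro ⟨hb, ha⟩
        obtain rfl : b = x • v₀ := hb
        obtain rfl : a = (x * z) • v₀ := ha
        refine ⟨tight_of_mem_optimalCuts hr hconn hD', ⟨⟨1, z, hz, Or.inr ⟨?_, ?_⟩⟩, ?_, ?_⟩, hD'.1⟩
        · simp
        · simp
        · simpa [Set.mem_inv_smul_set_iff, smul_smul] using haD
        · simpa [Set.mem_inv_smul_set_iff] using hbD
  rwa [hstab] at this

end CosetGraph

/-- An automorphism preserving `H` acts on the cosets of `H`. -/
theorem exists_twistedAction_quotient {G : Type u} [Group G] {φ : MulAut G} {w : G}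
    (hφ : ∀ x, φ (φ x) = w * x * w⁻¹) (hφw : φ w = w) {H : Subgroup G} (hw : w ∈ H)
    (hH : ∀ x ∈ H, φ x ∈ H) :
    ∃ τ : Equiv.Perm (G ⧸ H), TwistedAction φ w τ ((1 : G) : G ⧸ H) := by
  have hφH := apply_mem_iff_of_invariant hφ hw hH
  have hrel : ∀ a b : G, a⁻¹ * b ∈ H ↔ (φ a)⁻¹ * φ b ∈ H := fun a b => by
    rw [← map_inv, ← map_mul, hφH]
  let f : G ⧸ H → G ⧸ H := Quotient.map' φ fun a b hab => by
    rw [QuotientGroup.leftRel_apply] at hab ⊢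
    exact (hrel a b).1 hab
  have hf : ∀ a : G, f (a : G ⧸ H) = (φ a : G ⧸ H) := fun _ => rfl
  have hbij : Function.Bijective f := by
    constructor
    · intro a b
      obtain ⟨a, rfl⟩ := QuotientGroup.mk_surjective a
      obtain ⟨b, rfl⟩ := QuotientGroup.mk_surjective b
      intro hab
      rw [hf, hf, QuotientGroup.eq] at hab
      exact QuotientGroup.eq.2 ((hrel a b).2 hab)
    · intro a
      obtain ⟨a, rfl⟩ := QuotientGroup.mk_surjective a
      obtain ⟨a, rfl⟩ := φ.surjective a
      exact ⟨a, rfl⟩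
  refine ⟨Equiv.ofBijective f hbij, fun g v => ?_, fun v => ?_, ?_, fun v => ?_, hφ, hφw⟩
  · obtain ⟨a, rfl⟩ := QuotientGroup.mk_surjective v
    change ((φ (g * a) : G) : G ⧸ H) = ((φ g * φ a : G) : G ⧸ H)
    rw [map_mul]
  · obtain ⟨a, rfl⟩ := QuotientGroup.mk_surjective v
    change ((φ (φ a) : G) : G ⧸ H) = ((w * a : G) : G ⧸ H)
    rw [hφ, QuotientGroup.eq]
    rwa [show (w * a * w⁻¹)⁻¹ * (w * a) = w by group]
  · change ((φ 1 : G) : G ⧸ H) = ((1 : G) : G ⧸ H)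
    rw [map_one]
  · obtain ⟨a, rfl⟩ := QuotientGroup.mk_surjective v
    exact ⟨a, by change ((a * 1 : G) : G ⧸ H) = _; rw [mul_one]⟩

theorem smul_mk_one_eq_iff {G : Type u} [Group G] (H : Subgroup G) (x : G) :
    x • ((1 : G) : G ⧸ H) = ((1 : G) : G ⧸ H) ↔ x ∈ H := by
  change ((x * 1 : G) : G ⧸ H) = ((1 : G) : G ⧸ H) ↔ x ∈ H
  rw [mul_one, eq_comm, QuotientGroup.eq, inv_one, one_mul]

/-- A finitely generated free extension of an invariant subgroup decomposes into elementary
extensions. -/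
theorem reflTransGen_step_top {G : Type u} [Group G]
    (htf : ∀ (g : G) (n : ℕ), n ≠ 0 → g ^ n = 1 → g = 1) {φ : MulAut G} {w : G}
    (hφ : ∀ x, φ (φ x) = w * x * w⁻¹) (hφw : φ w = w) {H : Subgroup G} (hw : w ∈ H)
    (hH : ∀ x ∈ H, φ x ∈ H) {Z : Set G} (hZ : Z.Finite) (hext : IsExt H Z ⊤) :
    Relation.ReflTransGen (Step φ w) H ⊤ := by
  obtain ⟨τ, hτ⟩ := exists_twistedAction_quotient hφ hφw hw hH
  exact reflTransGen_step_of_twistedAction htf hτ hext hZ (smul_mk_one_eq_iff H)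
    (apply_mem_iff_of_invariant hφ hw hH)

/-! ### Twisted torsion in free extensions -/

section Torsion

/-- A chain modulo two invariant under an involution that moves every point of the support
is the sum of some chain and of its image. -/
theorem exists_eq_add_mapDomain {α : Type*} (σ : Equiv.Perm α) (hσ : ∀ p, σ (σ p) = p)
    (P : α →₀ ZMod 2) (hP : Finsupp.mapDomain σ P = P) (hfix : ∀ p ∈ P.support, σ p ≠ p) :
    ∃ q : α →₀ ZMod 2, q.support ⊆ P.support ∧ P = q + Finsupp.mapDomain σ q := by
  classical
  let _ : LinearOrder α := linearOrderOfSTO WellOrderingRel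
  have hsymm : ∀ p, σ.symm p = σ p := fun p => by rw [Equiv.symm_apply_eq, hσ]
  have hP' : ∀ p, P (σ p) = P p := fun p => by
    conv_rhs => rw [← hP, Finsupp.mapDomain_equiv_apply, hsymm]
  refine ⟨P.filter (fun p => p < σ p), by
    rw [Finsupp.support_filter]; exact Finset.filter_subset _ _, ?_⟩
  ext p
  rw [Finsupp.add_apply, Finsupp.mapDomain_equiv_apply, hsymm, Finsupp.filter_apply,
    Finsupp.filter_apply, hσ, hP']
  by_cases hp : P p = 0
  · simp [hp]
  · rcases lt_or_gt_of_ne (hfix p (Finsupp.mem_support_iff.2 hp)) with h | h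
    · rw [if_neg h.le.not_gt, if_pos h, zero_add]
    · rw [if_pos h, if_neg h.le.not_gt, add_zero]

/-- A chain modulo two of odd degree invariant under an involution has a fixed point. -/
theorem exists_fixed_of_degree_ne_zero {V : Type*} (ρ : Equiv.Perm V) (hρ : ∀ v, ρ (ρ v) = v)
    (m : V →₀ ZMod 2) (hm : Finsupp.mapDomain ρ m = m) (hdeg : m.sum (fun _ r => r) ≠ 0) :
    ∃ v, ρ v = v := by
  by_contra! hno
  have hsymm : ∀ p, ρ.symm p = ρ p := fun p => by rw [Equiv.symm_apply_eq, hρ]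
  have hm' : ∀ p, m (ρ p) = m p := fun p => by
    conv_rhs => rw [← hm, Finsupp.mapDomain_equiv_apply, hsymm]
  refine hdeg (Finset.sum_involution (fun v _ => ρ v) (fun v _ => ?_) (fun v _ _ => hno v)
    (fun v hv => ?_) (fun v _ => hρ v))
  · rw [hm']; exact CharTwo.add_self_eq_zero _
  · rw [Finsupp.mem_support_iff] at hv ⊢
    rwa [hm']

variable {G : Type u} [Group G] {φ : MulAut G} {w : G} {K : Subgroup G} {Z : Set G}

/-- Elements `a` with `a * φ a * w = 1` come, up to twisted conjugation, from the base of a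
free extension or from a generator whose edge is inverted. -/
theorem IsDerivation.exists_twisted_conj {d : G → (G × G →₀ ZMod 2)} (hd : IsDerivation K Z d)
    (hφ : ∀ x, φ (φ x) = w * x * w⁻¹) (hφw : φ w = w) (hw : w ∈ K) (hK : ∀ x ∈ K, φ x ∈ K)
    (hext : IsExt K Z ⊤) {c z' : G → G} (hz' : ∀ z ∈ Z, z' z ∈ Z)
    (hc : ∀ z ∈ Z, d (φ z) = Finsupp.single (c z, z' z) 1) {a : G} (ha : a * φ a * w = 1) :
    (∃ u, u⁻¹ * a * φ u ∈ K) ∨ ∃ x, ∃ z ∈ Z, z' z = z ∧ a = x * (c z)⁻¹ * (φ x)⁻¹ := by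
  classical
  suffices ∀ t : G × G → G × G, t = (fun p : G × G => (φ p.1 * c p.2, z' p.2)) →
    (∃ u, u⁻¹ * a * φ u ∈ K) ∨ ∃ x, ∃ z ∈ Z, z' z = z ∧ a = x * (c z)⁻¹ * (φ x)⁻¹ from this _ rfl
  intro t ht
  have hT : ∀ g (m : G × G →₀ ZMod 2), Finsupp.mapDomain t (ftrans (ZMod 2) g m) =
      ftrans (ZMod 2) (φ g) (Finsupp.mapDomain t m) := fun g m => by
    induction m using Finsupp.induction_linear with
    | zero => simp
    | add a b ha hb => simp only [map_add, ha, hb, Finsupp.mapDomain_add]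
    | single p r =>
      obtain ⟨x, z⟩ := p
      rw [ftrans_single, Finsupp.mapDomain_single, Finsupp.mapDomain_single, ht]
      simp only [ftrans_single, map_mul, mul_assoc]
  have hneg : ∀ m : G × G →₀ ZMod 2, -m = m := fun m => by
    ext p; exact CharTwo.neg_eq _
  have hdinv : ∀ g, d g⁻¹ = ftrans (ZMod 2) g⁻¹ (d g) := fun g => by rw [hd.inv, hneg]
  have hdT : ∀ g, d (φ g) = Finsupp.mapDomain t (d g) := by
    let L : Subgroup G :=
      { carrier := {g | d (φ g) = Finsupp.mapDomain t (d g)}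
        one_mem' := by
          change d (φ 1) = Finsupp.mapDomain t (d 1)
          rw [map_one, hd.one, Finsupp.mapDomain_zero]
        mul_mem' := fun {g h} hg hh => by
          change d (φ (g * h)) = Finsupp.mapDomain t (d (g * h))
          rw [map_mul, hd.mul, hd.mul, Finsupp.mapDomain_add, hT, ← show _ = _ from hg,
            ← show _ = _ from hh]
        inv_mem' := fun {g} hg => by
          change d (φ g⁻¹) = Finsupp.mapDomain t (d g⁻¹)
          rw [map_inv, hdinv, hdinv, hT, ← show _ = _ from hg, map_inv] }
    have : ⊤ ≤ L := hext.le_of (fun x hx => ?_) fun z hz => ?_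
    · exact fun g => this (Subgroup.mem_top g)
    · change d (φ x) = Finsupp.mapDomain t (d x)
      rw [hd.base x hx, hd.base _ (hK x hx), Finsupp.mapDomain_zero]
    · change d (φ z) = Finsupp.mapDomain t (d z)
      rw [hd.gen z hz, hc z hz, Finsupp.mapDomain_single, ht]
      simp
  have hsupp : ∀ g, ∀ p ∈ (d g).support, p.2 ∈ Z := by
    have htr : ∀ g (m : G × G →₀ ZMod 2), (∀ p ∈ m.support, p.2 ∈ Z) →
        ∀ p ∈ (ftrans (ZMod 2) g m).support, p.2 ∈ Z := fun g m hm p hp => by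
      rw [Finsupp.mem_support_iff, ftrans_apply] at hp
      exact hm (g⁻¹ * p.1, p.2) (Finsupp.mem_support_iff.2 hp)
    let L : Subgroup G :=
      { carrier := {g | ∀ p ∈ (d g).support, p.2 ∈ Z}
        one_mem' := by
          change ∀ p ∈ (d 1).support, p.2 ∈ Z
          rw [hd.one]; simp
        mul_mem' := fun {g h} hg hh => by
          change ∀ p ∈ (d (g * h)).support, p.2 ∈ Z
          rw [hd.mul]
          intro p hp
          rcases Finset.mem_union.1 (Finsupp.support_add hp) with h1 | h1
          · exact hg p h1
          · exact htr _ _ hh p h1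
        inv_mem' := fun {g} hg => by
          change ∀ p ∈ (d g⁻¹).support, p.2 ∈ Z
          rw [hdinv]
          exact htr _ _ hg }
    have : ⊤ ≤ L := hext.le_of (fun x hx => ?_) fun z hz => ?_
    · exact fun g => this (Subgroup.mem_top g)
    · change ∀ p ∈ (d x).support, p.2 ∈ Z
      rw [hd.base x hx]; simp
    · change ∀ p ∈ (d z).support, p.2 ∈ Z
      rw [hd.gen z hz]
      intro p hp
      rw [Finset.mem_singleton.1 (Finsupp.support_single_subset hp)]
      exact hz
  have hsq : ∀ z ∈ Z, φ (c z) * c (z' z) = w ∧ z' (z' z) = z := fun z hz => by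
    have h1 : d (φ (φ z)) = Finsupp.single (w, z) 1 := by
      rw [hφ, hd.mul_base _ (K.inv_mem hw), hd.mul, hd.base w hw, zero_add, hd.gen z hz,
        ftrans_single, mul_one]
    rw [hdT, hc z hz, Finsupp.mapDomain_single, ht] at h1
    exact Prod.ext_iff.1 (Finsupp.single_left_injective one_ne_zero h1)
  let σ₀ : G × G → G × G := fun p => if p.2 ∈ Z then (a * φ p.1 * c p.2, z' p.2) else p
  have hσ₀ : Function.Involutive σ₀ := fun p => by
    obtain ⟨x, z⟩ := p
    by_cases hz : z ∈ Z
    · simp only [σ₀, if_pos hz, if_pos (hz' z hz), (hsq z hz).2, Prod.mk.injEq, and_true]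
      rw [map_mul, map_mul, hφ]
      calc a * (φ a * (w * x * w⁻¹) * φ (c z)) * c (z' z)
          = a * φ a * w * x * w⁻¹ * (φ (c z) * c (z' z)) := by group
        _ = x := by rw [(hsq z hz).1, ha]; group
    · simp only [σ₀, if_neg hz]
  let σ : Equiv.Perm (G × G) := hσ₀.toPerm
  have hσT : ∀ m : G × G →₀ ZMod 2, (∀ p ∈ m.support, p.2 ∈ Z) →
      Finsupp.mapDomain σ m = ftrans (ZMod 2) a (Finsupp.mapDomain t m) := fun m hm => by
    have h1 : Finsupp.mapDomain σ m =
        Finsupp.mapDomain (fun p : G × G => (a * (t p).1, (t p).2)) m :=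
      Finsupp.mapDomain_congr fun p hp => by
        change σ₀ p = _
        simp only [σ₀, if_pos (hm p hp), ht, mul_assoc]
    have h2 : Finsupp.mapDomain (fun p : G × G => (a * p.1, p.2)) (Finsupp.mapDomain t m) =
        ftrans (ZMod 2) a (Finsupp.mapDomain t m) := by
      rw [ftrans, Finsupp.domCongr_apply, Finsupp.equivMapDomain_eq_mapDomain]
      rfl
    rw [h1, ← h2, ← Finsupp.mapDomain_comp]
    rfl
  have hP : Finsupp.mapDomain σ (d a) = d a := by
    rw [hσT _ (hsupp a), ← hdT]
    have h1 : d (a * φ a * w) = 0 := by rw [ha, hd.one]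
    rw [hd.mul_base _ hw, hd.mul] at h1
    rw [eq_neg_of_add_eq_zero_left h1, hneg]
  by_cases hfix : ∃ p ∈ (d a).support, σ p = p
  · obtain ⟨⟨x, z⟩, hp, hfix⟩ := hfix
    have hz : z ∈ Z := hsupp a _ hp
    have h1 : σ₀ (x, z) = (x, z) := hfix
    simp only [σ₀, if_pos hz, Prod.mk.injEq] at h1
    refine Or.inr ⟨x, z, hz, h1.2, ?_⟩
    rw [eq_mul_inv_iff_mul_eq, eq_mul_inv_iff_mul_eq, h1.1]
  push Not at hfix
  obtain ⟨q, hq, hPq⟩ := exists_eq_add_mapDomain σ hσ₀ (d a) hP hfix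
  obtain ⟨τ, hτ⟩ := exists_twistedAction_quotient hφ hφw hw hK
  have hv : ∀ x ∈ K, x • ((1 : G) : G ⧸ K) = ((1 : G) : G ⧸ K) := fun x =>
    (smul_mk_one_eq_iff K x).2
  have hv' : ∀ x, x • ((1 : G) : G ⧸ K) = ((1 : G) : G ⧸ K) → x ∈ K := fun x =>
    (smul_mk_one_eq_iff K x).1
  generalize ((1 : G) : G ⧸ K) = v₀ at hτ hv hv'
  have hneg' : ∀ m : G ⧸ K →₀ ZMod 2, -m = m := fun m => by
    ext p; exact CharTwo.neg_eq _
  have hbt : ∀ m : G × G →₀ ZMod 2, (∀ p ∈ m.support, p.2 ∈ Z) →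
      bdry v₀ (Finsupp.mapDomain t m) = Finsupp.mapDomain τ (bdry v₀ m) := fun m => by
    induction m using Finsupp.induction with
    | zero => simp
    | single_add p r m hp hr ih =>
      intro hm
      have hsup : (Finsupp.single p r + m).support = {p} ∪ m.support := by
        rw [Finsupp.support_add_eq, Finsupp.support_single _ hr]
        rw [Finsupp.support_single _ hr]
        exact Finset.disjoint_singleton_left.2 hp
      rw [hsup] at hm
      rw [Finsupp.mapDomain_add, map_add, map_add, Finsupp.mapDomain_add,
        ih fun p' hp' => hm p' (Finset.mem_union_right _ hp')]
      congr 1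
      have hz : p.2 ∈ Z := hm p (by simp)
      obtain ⟨x, z⟩ := p
      obtain rfl : r = 1 := (by decide : ∀ r : ZMod 2, r ≠ 0 → r = 1) r hr
      have h1 : bdry v₀ (d (φ z)) = Finsupp.single (φ z • v₀) 1 - Finsupp.single v₀ 1 :=
        hd.bdry_eq hext hv _
      have hsub : ∀ (F : G ⧸ K → G ⧸ K) (a b : G ⧸ K →₀ ZMod 2), Finsupp.mapDomain F (a - b) =
          Finsupp.mapDomain F a - Finsupp.mapDomain F b := fun F a b =>
        map_sub (Finsupp.mapDomain.addMonoidHom F) a b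
      have h2 : Finsupp.mapDomain t (Finsupp.single (x, z) (1 : ZMod 2)) =
          ftrans (ZMod 2) (φ x) (d (φ z)) := by
        rw [hc z hz, Finsupp.mapDomain_single, ftrans_single, ht]
      rw [h2, bdry_ftrans, h1, bdry_single, hsub, hsub]
      simp only [Finsupp.mapDomain_single, hτ.map_smul, hτ.base, map_mul, smul_smul]
  let ρ : Equiv.Perm (G ⧸ K) := τ.trans (MulAction.toPerm a)
  have hρ : ∀ v, ρ v = a • τ v := fun _ => rfl
  have hρρ : ∀ v, ρ (ρ v) = v := fun v => by
    rw [hρ, hρ, hτ.map_smul, hτ.sq, smul_smul, smul_smul, ha, one_smul]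
  have hρm : ∀ m : G ⧸ K →₀ ZMod 2, Finsupp.mapDomain ρ m =
      Finsupp.mapDomain (a • ·) (Finsupp.mapDomain τ m) := fun m => by
    rw [← Finsupp.mapDomain_comp]; rfl
  obtain ⟨v, hvρ⟩ := exists_fixed_of_degree_ne_zero ρ hρρ (Finsupp.single v₀ 1 + bdry v₀ q)
    (by
      have hqZ : ∀ p ∈ q.support, p.2 ∈ Z := fun p hp => hsupp a p (hq hp)
      have h1 : bdry v₀ (d a) = Finsupp.single (a • v₀) 1 - Finsupp.single v₀ 1 :=
        hd.bdry_eq hext hv _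
      have h2 : Finsupp.mapDomain ρ (bdry v₀ q) = bdry v₀ (d a) - bdry v₀ q := by
        rw [hρm, ← hbt q hqZ, ← bdry_ftrans, ← hσT q hqZ]
        conv_rhs => rw [hPq, map_add, add_sub_cancel_left]
      rw [Finsupp.mapDomain_add, h2, h1, Finsupp.mapDomain_single, hρ, hτ.base,
        sub_sub, ← add_sub_assoc, ← two_nsmul, sub_eq_add_neg, hneg']
      have : (2 : ℕ) • Finsupp.single (a • v₀) (1 : ZMod 2) = 0 := by
        rw [two_nsmul]; nth_rewrite 1 [← hneg' (Finsupp.single (a • v₀) 1)]; simp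
      rw [this, zero_add])
    (by
      rw [Finsupp.sum_add_index' (fun _ => rfl) (fun _ _ _ => rfl), degree_bdry,
        Finsupp.sum_single_index rfl]
      decide)
  obtain ⟨g, rfl⟩ := hτ.trans v
  refine Or.inl ⟨g, hv' _ ?_⟩
  rw [hρ, hτ.map_smul, hτ.base] at hvρ
  rw [mul_smul, mul_smul, hvρ, inv_smul_smul]

end Torsion

section Torsion

variable {G : Type u} [Group G] {φ : MulAut G} {w : G} {K K' : Subgroup G} {Z : Set G}

theorem IsExt.exists_twisted_conj_top (hφ : ∀ x, φ (φ x) = w * x * w⁻¹) (hφw : φ w = w)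
    (hw : w ∈ K) (hK : ∀ x ∈ K, φ x ∈ K) (hext : IsExt K Z ⊤)
    (hZ : ∀ z ∈ Z, ∃ z' ∈ Z, (∃ k ∈ K, ∃ l ∈ K, φ z = k * z' * l) ∨ ∃ l ∈ K, φ z = z'⁻¹ * l)
    {a : G} (ha : a * φ a * w = 1) :
    (∃ u, u⁻¹ * a * φ u ∈ K) ∨ ∃ x, ∃ z ∈ Z, (∃ l ∈ K, φ z = z⁻¹ * l) ∧ a = x * z * (φ x)⁻¹ := by
  obtain ⟨d, hd⟩ := hext.exists_derivation (ZMod 2)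
  have hneg : ∀ m : G × G →₀ ZMod 2, -m = m := fun m => by
    ext p; exact CharTwo.neg_eq _
  have hZ' : ∀ z, ∃ z' c, z ∈ Z → z' ∈ Z ∧ d (φ z) = Finsupp.single (c, z') 1 ∧
      (c ∈ K ∨ c = z'⁻¹ ∧ ∃ l ∈ K, φ z = z'⁻¹ * l) := fun z => by
    by_cases hz : z ∈ Z
    · obtain ⟨z', hz', ⟨k, hk, l, hl, h⟩ | ⟨l, hl, h⟩⟩ := hZ z hz
      · refine ⟨z', k, fun _ => ⟨hz', ?_, Or.inl hk⟩⟩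
        rw [h, hd.mul_base _ hl, hd.mul, hd.base k hk, hd.gen z' hz', ftrans_single, zero_add,
          mul_one]
      · refine ⟨z', z'⁻¹, fun _ => ⟨hz', ?_, Or.inr ⟨rfl, l, hl, h⟩⟩⟩
        rw [h, hd.mul_base _ hl, hd.inv, hneg, hd.gen z' hz', ftrans_single, mul_one]
    · exact ⟨1, 1, fun h => absurd h hz⟩
  choose z' c hc using hZ'
  obtain h | ⟨x, z, hz, hzz, h⟩ := hd.exists_twisted_conj hφ hφw hw hK hext
    (fun z hz => (hc z hz).1) (fun z hz => (hc z hz).2.1) ha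
  · exact Or.inl h
  · obtain h1 | ⟨h1, h2⟩ := (hc z hz).2.2
    · refine Or.inl ⟨x, ?_⟩
      rw [h, show x⁻¹ * (x * (c z)⁻¹ * (φ x)⁻¹) * φ x = (c z)⁻¹ by group]
      exact K.inv_mem h1
    · rw [hzz] at h1 h2
      rw [h1, inv_inv] at h
      exact Or.inr ⟨x, z, hz, h2, h⟩

/-- Elements `a` with `a * φ a * w = 1` come, up to twisted conjugation, from the base of a
free extension or from an inverted generator. -/
theorem IsExt.exists_twisted_conj (hφ : ∀ x, φ (φ x) = w * x * w⁻¹) (hφw : φ w = w)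
    (hw : w ∈ K) (hK : ∀ x ∈ K, φ x ∈ K) (hext : IsExt K Z K') (hK' : ∀ x ∈ K', φ x ∈ K')
    (hZ : ∀ z ∈ Z, ∃ z' ∈ Z, (∃ k ∈ K, ∃ l ∈ K, φ z = k * z' * l) ∨ ∃ l ∈ K, φ z = z'⁻¹ * l)
    {a : G} (haK' : a ∈ K') (ha : a * φ a * w = 1) :
    (∃ u ∈ K', u⁻¹ * a * φ u ∈ K) ∨
      ∃ x ∈ K', ∃ z ∈ Z, a = x * z * (φ x)⁻¹ := by
  have hL := apply_mem_iff_of_invariant hφ (hext.le hw) hK'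
  have h := IsExt.exists_twisted_conj_top (φ := restrictAut φ K' hL) (w := ⟨w, hext.le hw⟩)
    (K := K.subgroupOf K') (fun x => Subtype.ext (hφ x)) (Subtype.ext hφw) hw
    (fun x hx => hK x hx) hext.subgroupOf (fun z hz => ?_) (a := ⟨a, haK'⟩) (Subtype.ext ha)
  · obtain ⟨u, hu⟩ | ⟨x, z, hz, -, h⟩ := h
    · exact Or.inl ⟨u, u.2, hu⟩
    · exact Or.inr ⟨x, x.2, z, hz, congrArg Subtype.val h⟩
  · obtain ⟨z', hz', ⟨k, hk, l, hl, h⟩ | ⟨l, hl, h⟩⟩ := hZ z hz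
    · exact ⟨⟨z', hext.subset hz'⟩, hz', Or.inl ⟨⟨k, hext.le hk⟩, hk, ⟨l, hext.le hl⟩, hl,
        Subtype.ext h⟩⟩
    · exact ⟨⟨z', hext.subset hz'⟩, hz', Or.inr ⟨⟨l, hext.le hl⟩, hl, Subtype.ext h⟩⟩

/-- A free generator may be multiplied on both sides by elements of the base. -/
theorem IsExt.mul_mul {y k l : G} (h : IsExt K {y} K') (hk : k ∈ K) (hl : l ∈ K) :
    IsExt K {k * y * l} K' := by
  refine ⟨?_, fun P _ α β => ?_⟩
  · refine le_antisymm (h.le_of le_sup_left (Set.singleton_subset_iff.2 ?_))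
      (sup_le h.le ((Subgroup.closure_le _).2 (Set.singleton_subset_iff.2 ?_)))
    · have h1 : k * y * l ∈ K ⊔ Subgroup.closure {k * y * l} :=
        Subgroup.mem_sup_right (Subgroup.subset_closure rfl)
      have h2 := Subgroup.mul_mem _ (Subgroup.mul_mem _
        (Subgroup.inv_mem _ (Subgroup.mem_sup_left hk)) h1)
        (Subgroup.inv_mem _ (Subgroup.mem_sup_left hl))
      rwa [show k⁻¹ * (k * y * l) * l⁻¹ = y by group] at h2
    · exact K'.mul_mem (K'.mul_mem (h.le hk) (h.subset rfl)) (h.le hl)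
  · obtain ⟨f, h1, h2⟩ := h.2 P α (fun _ => (α ⟨k, hk⟩)⁻¹ * β (k * y * l) * (α ⟨l, hl⟩)⁻¹)
    refine ⟨f, h1, ?_⟩
    rintro x rfl hx
    have hy : y ∈ K' := h.subset rfl
    have : (⟨k * y * l, hx⟩ : K') = ⟨k, h.le hk⟩ * ⟨y, hy⟩ * ⟨l, h.le hl⟩ := rfl
    rw [this, map_mul, map_mul, h1 k hk, h1 l hl, h2 y rfl]
    group

end Torsion

/-! ### Adapted free generators -/

section Adapted

variable {G : Type u} [Group G] {φ : MulAut G} {w : G} {H K K' : Subgroup G} {B B' Z : Set G}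

/-- Labels: twisted torsion elements which are trivial or belong to `B`. -/
def IsLabel (φ : MulAut G) (w : G) (B : Set G) (e : G) : Prop :=
  e * φ e * w = 1 ∧ (e = 1 ∨ e ∈ B)

/-- The three admissible behaviours of a generator `b ∈ B` under `φ`. -/
def IsTyped (φ : MulAut G) (w : G) (B : Set G) (b : G) : Prop :=
  b * φ b * w = 1 ∨ (∃ z ∈ B, φ z ∈ B ∧ z ≠ φ z ∧ (b = z ∨ b = φ z)) ∨
    ∃ e e', IsLabel φ w B e ∧ IsLabel φ w B e' ∧ φ b = e⁻¹ * b * e'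

/-- A set of free generators over `H` adapted to `φ`. -/
structure IsAdapted (φ : MulAut G) (w : G) (H : Subgroup G) (B : Set G) : Prop where
  ext : IsExt H B (H ⊔ Subgroup.closure B)
  inv : ∀ x ∈ H ⊔ Subgroup.closure B, φ x ∈ H ⊔ Subgroup.closure B
  typed : ∀ b ∈ B, IsTyped φ w B b
  torsion : ∀ a ∈ H ⊔ Subgroup.closure B, a * φ a * w = 1 →
    ∃ k ∈ H ⊔ Subgroup.closure B, ∃ e, IsLabel φ w B e ∧ a = k * e * (φ k)⁻¹

theorem IsLabel.mono {e : G} (h : IsLabel φ w B e) (hB : B ⊆ B') : IsLabel φ w B' e :=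
  ⟨h.1, h.2.imp id fun h => hB h⟩

theorem IsLabel.mem {e : G} (h : IsLabel φ w B e) : e ∈ H ⊔ Subgroup.closure B := by
  obtain rfl | h := h.2
  · exact Subgroup.one_mem _
  · exact Subgroup.mem_sup_right (Subgroup.subset_closure h)

theorem IsTyped.mono {b : G} (h : IsTyped φ w B b) (hB : B ⊆ B') : IsTyped φ w B' b := by
  obtain h | ⟨z, hz, hz', h⟩ | ⟨e, e', he, he', h⟩ := h
  · exact Or.inl h
  · exact Or.inr (Or.inl ⟨z, hB hz, hB hz', h⟩)
  · exact Or.inr (Or.inr ⟨e, e', he.mono hB, he'.mono hB, h⟩)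

theorem twisted_conj_torsion (hφ : ∀ x, φ (φ x) = w * x * w⁻¹) {a : G} (ha : a * φ a * w = 1)
    (u : G) : u⁻¹ * a * φ u * φ (u⁻¹ * a * φ u) * w = 1 := by
  rw [map_mul, map_mul, map_inv, hφ]
  calc u⁻¹ * a * φ u * ((φ u)⁻¹ * φ a * (w * u * w⁻¹)) * w
      = u⁻¹ * (a * φ a * w) * u := by group
    _ = 1 := by rw [ha]; group

theorem IsAdapted.union (hφ : ∀ x, φ (φ x) = w * x * w⁻¹) (hφw : φ w = w)
    (h : IsAdapted φ w H B) (hw : w ∈ H) (hext : IsExt (H ⊔ Subgroup.closure B) Z K')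
    (hZ : ∀ z ∈ Z, ∃ z' ∈ Z, (∃ k ∈ H ⊔ Subgroup.closure B, ∃ l ∈ H ⊔ Subgroup.closure B,
      φ z = k * z' * l) ∨ ∃ l ∈ H ⊔ Subgroup.closure B, φ z = z'⁻¹ * l)
    (htyped : ∀ z ∈ Z, IsTyped φ w (B ∪ Z) z) :
    IsAdapted φ w H (B ∪ Z) ∧ H ⊔ Subgroup.closure (B ∪ Z) = K' := by
  have htrans := h.ext.trans hext
  have hK' := htrans.1
  have hinv : ∀ x ∈ K', φ x ∈ K' := hext.le_of (L := K'.comap φ.toMonoidHom)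
    (fun x hx => hext.le (h.inv x hx)) fun z hz => by
      obtain ⟨z', hz', ⟨k, hk, l, hl, h⟩ | ⟨l, hl, h⟩⟩ := hZ z hz
      · change φ z ∈ K'
        rw [h]
        exact K'.mul_mem (K'.mul_mem (hext.le hk) (hext.subset hz')) (hext.le hl)
      · change φ z ∈ K'
        rw [h]
        exact K'.mul_mem (K'.inv_mem (hext.subset hz')) (hext.le hl)
  refine ⟨?_, hK'.symm⟩
  refine ⟨hK' ▸ htrans, hK' ▸ hinv, ?_, ?_⟩
  · rintro b (hb | hb)
    · exact (h.typed b hb).mono Set.subset_union_left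
    · exact htyped b hb
  · rw [← hK']
    intro a haK' ha
    obtain ⟨u, hu, hua⟩ | ⟨x, hx, z, hz, rfl⟩ := hext.exists_twisted_conj hφ hφw
      (Subgroup.mem_sup_left hw) h.inv hinv hZ haK' ha
    · obtain ⟨k, hk, e, he, hke⟩ := h.torsion _ hua (twisted_conj_torsion hφ ha u)
      refine ⟨u * k, K'.mul_mem hu (hext.le hk), e, he.mono Set.subset_union_left, ?_⟩
      rw [map_mul, mul_inv_rev]
      calc a = u * (u⁻¹ * a * φ u) * (φ u)⁻¹ := by group
        _ = _ := by rw [hke]; group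
    · refine ⟨x, hx, z, ⟨?_, Or.inr (Or.inr hz)⟩, rfl⟩
      have := twisted_conj_torsion hφ ha x
      rwa [show x⁻¹ * (x * z * (φ x)⁻¹) * φ x = z by group] at this

theorem IsAdapted.exists_of_step (hφ : ∀ x, φ (φ x) = w * x * w⁻¹) (hφw : φ w = w)
    (h : IsAdapted φ w H B) (hw : w ∈ H) (hstep : Step φ w (H ⊔ Subgroup.closure B) K') :
    ∃ B', B ⊆ B' ∧ IsAdapted φ w H B' ∧ H ⊔ Subgroup.closure B' = K' := by
  have hwK : w ∈ H ⊔ Subgroup.closure B := Subgroup.mem_sup_left hw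
  obtain ⟨z, hz, hext⟩ | ⟨s, hs, hext⟩ | ⟨y, a, ha, c, hc, ha', hc', hy, hext⟩ := hstep
  · refine ⟨_, Set.subset_union_left, h.union hφ hφw hw hext ?_ ?_⟩
    · rintro x (rfl | rfl)
      · exact ⟨φ x, by simp, Or.inl ⟨1, Subgroup.one_mem _, 1, Subgroup.one_mem _, by simp⟩⟩
      · exact ⟨z, by simp, Or.inl ⟨w, hwK, w⁻¹, Subgroup.inv_mem _ hwK, hφ z⟩⟩
    · rintro x hx
      exact Or.inr (Or.inl ⟨z, by simp, by simp, hz, hx⟩)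
  · refine ⟨_, Set.subset_union_left, h.union hφ hφw hw hext ?_ ?_⟩
    · rintro x rfl
      refine ⟨x, rfl, Or.inr ⟨w⁻¹, Subgroup.inv_mem _ hwK, ?_⟩⟩
      rw [mul_eq_one_iff_eq_inv] at hs
      rw [← hs, inv_mul_cancel_left]
    · rintro x rfl
      exact Or.inl hs
  · obtain ⟨k, hk, e, he, rfl⟩ := h.torsion a ha ha'
    obtain ⟨l, hl, e', he', rfl⟩ := h.torsion c hc hc'
    have hy' : φ (k⁻¹ * y * l) = e⁻¹ * (k⁻¹ * y * l) * e' := by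
      rw [map_mul, map_mul, hy, map_inv]
      group
    refine ⟨_, Set.subset_union_left, h.union hφ hφw hw
      (hext.mul_mul (Subgroup.inv_mem _ hk) hl) ?_ ?_⟩
    · rintro x rfl
      exact ⟨_, rfl, Or.inl ⟨e⁻¹, Subgroup.inv_mem _ he.mem, e', he'.mem, hy'⟩⟩
    · rintro x rfl
      exact Or.inr (Or.inr ⟨e, e', he.mono Set.subset_union_left, he'.mono Set.subset_union_left,
        hy'⟩)

theorem IsAdapted.exists_of_reflTransGen (hφ : ∀ x, φ (φ x) = w * x * w⁻¹) (hφw : φ w = w)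
    (h : IsAdapted φ w H B) (hw : w ∈ H)
    (hstep : Relation.ReflTransGen (Step φ w) (H ⊔ Subgroup.closure B) K') :
    ∃ B', B ⊆ B' ∧ IsAdapted φ w H B' ∧ H ⊔ Subgroup.closure B' = K' := by
  induction hstep with
  | refl => exact ⟨B, subset_rfl, h, rfl⟩
  | tail _ hs ih =>
    obtain ⟨B₁, hB₁, h₁, rfl⟩ := ih
    obtain ⟨B₂, hB₂, h₂, rfl⟩ := h₁.exists_of_step hφ hφw hw hs
    exact ⟨B₂, hB₁.trans hB₂, h₂, rfl⟩

end Adapted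

/-! ### Unions of chains -/

section Chains

variable {G : Type u} [Group G] {φ : MulAut G} {w : G} {H : Subgroup G} {c : Set (Set G)}

theorem mem_sup_closure_sUnion (hc : DirectedOn (· ⊆ ·) c) (hne : c.Nonempty) {x : G} :
    x ∈ H ⊔ Subgroup.closure (⋃₀ c) ↔ ∃ B ∈ c, x ∈ H ⊔ Subgroup.closure B := by
  have hmono : ∀ {B B' : Set G}, B ⊆ B' → H ⊔ Subgroup.closure B ≤ H ⊔ Subgroup.closure B' :=
    fun h => sup_le_sup_left (Subgroup.closure_mono h) _
  constructor
  · let L : Subgroup G :=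
      { carrier := {x | ∃ B ∈ c, x ∈ H ⊔ Subgroup.closure B}
        one_mem' := ⟨hne.some, hne.some_mem, Subgroup.one_mem _⟩
        mul_mem' := by
          rintro a b ⟨B, hB, ha⟩ ⟨B', hB', hb⟩
          obtain ⟨C, hC, h1, h2⟩ := hc B hB B' hB'
          exact ⟨C, hC, Subgroup.mul_mem _ (hmono h1 ha) (hmono h2 hb)⟩
        inv_mem' := by
          rintro a ⟨B, hB, ha⟩
          exact ⟨B, hB, Subgroup.inv_mem _ ha⟩ }
    have : H ⊔ Subgroup.closure (⋃₀ c) ≤ L := by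
      refine sup_le (fun x hx => ⟨hne.some, hne.some_mem, Subgroup.mem_sup_left hx⟩)
        ((Subgroup.closure_le _).2 ?_)
      rintro x ⟨B, hB, hx⟩
      exact ⟨B, hB, Subgroup.mem_sup_right (Subgroup.subset_closure hx)⟩
    exact fun h => this h
  · rintro ⟨B, hB, hx⟩
    exact hmono (Set.subset_sUnion_of_mem hB) hx

/-- Compatible homomorphisms on the members of a directed family of subgroups glue. -/
theorem exists_hom_glue {ι : Type*} {P : Type*} [Group P] (K : ι → Subgroup G) (L : Subgroup G)
    (hL : ∀ x ∈ L, ∃ i, x ∈ K i) (hdir : ∀ i j, ∃ k, K i ≤ K k ∧ K j ≤ K k)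
    (f : ∀ i, K i →* P) (hf : ∀ i j x (hx : x ∈ K i) (hx' : x ∈ K j), f i ⟨x, hx⟩ = f j ⟨x, hx'⟩) :
    ∃ g : L →* P, ∀ i x (hx : x ∈ K i) (hx' : x ∈ L), g ⟨x, hx'⟩ = f i ⟨x, hx⟩ := by
  choose g hg using fun x : L => hL x x.2
  refine ⟨MonoidHom.mk' (fun x => f (g x) ⟨x, hg x⟩) fun x y => ?_, fun i x hx hx' => hf _ _ _ _ _⟩
  obtain ⟨k, h1, h2⟩ := hdir (g x) (g y)
  rw [hf (g x) k x (hg x) (h1 (hg x)), hf (g y) k y (hg y) (h2 (hg y)), ← map_mul]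
  exact hf _ _ _ _ _

theorem IsExt.sUnion (hc : DirectedOn (· ⊆ ·) c) (hne : c.Nonempty)
    (h : ∀ B ∈ c, IsExt H B (H ⊔ Subgroup.closure B)) :
    IsExt H (⋃₀ c) (H ⊔ Subgroup.closure (⋃₀ c)) := by
  refine ⟨rfl, fun P _ α β => ?_⟩
  choose f hf1 hf2 using fun (B : c) => (h B B.2).2 P α β
  have hmono : ∀ {B B' : Set G}, B ⊆ B' → H ⊔ Subgroup.closure B ≤ H ⊔ Subgroup.closure B' :=
    fun h => sup_le_sup_left (Subgroup.closure_mono h) _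
  have hcompat : ∀ (B C : c), (B : Set G) ⊆ C → ∀ x (hx : x ∈ H ⊔ Subgroup.closure (B : Set G))
      (hx' : x ∈ H ⊔ Subgroup.closure (C : Set G)), f B ⟨x, hx⟩ = f C ⟨x, hx'⟩ := by
    intro B C hBC x hx hx'
    have : f B = (f C).comp (Subgroup.inclusion (hmono hBC)) := (h B B.2).hom_ext
      (fun y hy hy' => (hf1 B y hy _).trans (hf1 C y hy _).symm)
      (fun y hy hy' => (hf2 B y hy _).trans (hf2 C y (hBC hy) _).symm)
    rw [this]; rfl
  have hcompat' : ∀ (B C : c) x (hx : x ∈ H ⊔ Subgroup.closure (B : Set G))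
      (hx' : x ∈ H ⊔ Subgroup.closure (C : Set G)), f B ⟨x, hx⟩ = f C ⟨x, hx'⟩ := by
    intro B C x hx hx'
    obtain ⟨D, hD, h1, h2⟩ := hc B B.2 C C.2
    rw [hcompat B ⟨D, hD⟩ h1 x hx (hmono h1 hx), hcompat C ⟨D, hD⟩ h2 x hx' (hmono h1 hx)]
  obtain ⟨g, hg⟩ := exists_hom_glue (fun B : c => H ⊔ Subgroup.closure (B : Set G))
    (H ⊔ Subgroup.closure (⋃₀ c))
    (fun x hx => by
      obtain ⟨B, hB, hx⟩ := (mem_sup_closure_sUnion hc hne).1 hx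
      exact ⟨⟨B, hB⟩, hx⟩)
    (fun B C => by
      obtain ⟨D, hD, h1, h2⟩ := hc B B.2 C C.2
      exact ⟨⟨D, hD⟩, hmono h1, hmono h2⟩) f hcompat'
  refine ⟨g, fun x hx hx' => ?_, fun x hx hx' => ?_⟩
  · obtain ⟨B, hB⟩ := hne
    exact (hg ⟨B, hB⟩ x (Subgroup.mem_sup_left hx) hx').trans (hf1 _ x hx _)
  · obtain ⟨B, hB, hxB⟩ := hx
    exact (hg ⟨B, hB⟩ x (Subgroup.mem_sup_right (Subgroup.subset_closure hxB)) hx').trans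
      (hf2 ⟨B, hB⟩ x hxB _)

theorem IsAdapted.sUnion (hc : DirectedOn (· ⊆ ·) c) (hne : c.Nonempty)
    (h : ∀ B ∈ c, IsAdapted φ w H B) : IsAdapted φ w H (⋃₀ c) := by
  refine ⟨IsExt.sUnion hc hne fun B hB => (h B hB).ext, fun x hx => ?_, ?_, fun a ha ha' => ?_⟩
  · obtain ⟨B, hB, hx⟩ := (mem_sup_closure_sUnion hc hne).1 hx
    exact (mem_sup_closure_sUnion hc hne).2 ⟨B, hB, (h B hB).inv x hx⟩
  · rintro b ⟨B, hB, hb⟩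
    exact ((h B hB).typed b hb).mono (Set.subset_sUnion_of_mem hB)
  · obtain ⟨B, hB, ha⟩ := (mem_sup_closure_sUnion hc hne).1 ha
    obtain ⟨k, hk, e, he, h⟩ := (h B hB).torsion a ha ha'
    exact ⟨k, (mem_sup_closure_sUnion hc hne).2 ⟨B, hB, hk⟩, e,
      he.mono (Set.subset_sUnion_of_mem hB), h⟩

end Chains

/-! ### Intersections with free factors -/

section Schreier

/-- Recursion along a parent function that decreases a height. -/
theorem exists_rec_of_height {Q F : Type*} [Mul F] (d : Q → ℕ) (s l : Q → F) (par : Q → Q)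
    (hpar : ∀ q, d q ≠ 0 → d (par q) < d q) :
    ∃ σ : Q → F, (∀ q, d q = 0 → σ q = s q) ∧ ∀ q, d q ≠ 0 → σ q = l q * σ (par q) := by
  classical
  let hwf : WellFounded (fun a b : Q => d a < d b) := (measure d).wf
  refine ⟨hwf.fix fun q ih => if h : d q = 0 then s q else l q * ih (par q) (hpar q h),
    fun q hq => ?_, fun q hq => ?_⟩
  · rw [hwf.fix_eq, dif_pos hq]
  · rw [hwf.fix_eq, dif_neg hq]

variable {X : Type u}

/-- A cocycle on a set acted on by a free group is freely determined by its values on the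
generators. -/
theorem exists_cocycle {Q P : Type*} [MulAction (FreeGroup X) Q] [Group P] (c : Q → X → P) :
    ∃ θ : FreeGroup X → Q → P, (∀ x q, θ (FreeGroup.of x) q = c q x) ∧
      ∀ g h q, θ (g * h) q = θ g (h • q) * θ h q := by
  let Θ : FreeGroup X →* Equiv.Perm (Q × P) := FreeGroup.lift fun x =>
    { toFun := fun p : Q × P => (FreeGroup.of x • p.1, c p.1 x * p.2)
      invFun := fun p : Q × P => ((FreeGroup.of x)⁻¹ • p.1,
        (c ((FreeGroup.of x)⁻¹ • p.1) x)⁻¹ * p.2)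
      left_inv := fun p => by simp
      right_inv := fun p => by simp }
  have hof : ∀ x (p : Q × P), Θ (FreeGroup.of x) p = (FreeGroup.of x • p.1, c p.1 x * p.2) :=
    fun x p => by simp [Θ]
  have hinv : ∀ x (p : Q × P), Θ (FreeGroup.of x)⁻¹ p =
      ((FreeGroup.of x)⁻¹ • p.1, (c ((FreeGroup.of x)⁻¹ • p.1) x)⁻¹ * p.2) := fun x p => by
    rw [map_inv, Equiv.Perm.inv_eq_iff_eq, hof]; simp
  have key : ∀ g q p, Θ g (q, p) = (g • q, (Θ g (q, 1)).2 * p) := fun g => by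
    induction g using FreeGroup.induction_on with
    | C1 => simp
    | of x => intro q p; rw [hof, hof]; simp
    | inv_of x _ => intro q p; rw [hinv, hinv]; simp
    | mul g h hg hh =>
      intro q p
      simp only [map_mul, Equiv.Perm.mul_apply]
      rw [hh q p, hg, hh q 1, hg (h • q) (_ * 1), mul_one, mul_smul, mul_assoc]
  refine ⟨fun g q => (Θ g (q, 1)).2, fun x q => by simp [hof], fun g h q => ?_⟩
  simp only [map_mul, Equiv.Perm.mul_apply]
  rw [key h q 1, mul_one, key g]

/-- A Schreier transversal of a subgroup adapted to the orbit of the free factor generated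
by `S`. -/
theorem exists_schreier_section {Q : Type*} [MulAction (FreeGroup X) Q] (q₀ : Q)
    (hq₀ : ∀ q, ∃ g : FreeGroup X, g • q₀ = q) (B : Subgroup (FreeGroup X)) :
    ∃ σ : Q → FreeGroup X, σ q₀ = 1 ∧ (∀ q, σ q • q₀ = q) ∧
      (∀ q, (∃ b ∈ B, b • q₀ = q) → σ q ∈ B) ∧
      ∀ p : Q → Prop, (∀ q, (∃ b ∈ B, b • q₀ = q) → p q) →
        (∀ q, (¬ ∃ b ∈ B, b • q₀ = q) → ∀ x : X,
          (σ q = FreeGroup.of x * σ ((FreeGroup.of x)⁻¹ • q) →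
          p ((FreeGroup.of x)⁻¹ • q) → p q) ∧ (σ q = (FreeGroup.of x)⁻¹ * σ (FreeGroup.of x • q) →
          p (FreeGroup.of x • q) → p q)) → ∀ q, p q := by
  classical
  let D : ℕ → Set Q := fun n => Nat.rec (motive := fun _ => Set Q) {q | ∃ b ∈ B, b • q₀ = q}
    (fun _ D => {q | ∃ x : X, (FreeGroup.of x)⁻¹ • q ∈ D ∨ FreeGroup.of x • q ∈ D}) n
  have hD0 : ∀ q, q ∈ D 0 ↔ ∃ b ∈ B, b • q₀ = q := fun _ => Iff.rfl
  have hD : ∀ n q, q ∈ D (n + 1) ↔ ∃ x : X, (FreeGroup.of x)⁻¹ • q ∈ D n ∨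
      FreeGroup.of x • q ∈ D n :=
    fun _ _ => Iff.rfl
  have hex : ∀ q, ∃ n, q ∈ D n := by
    have : ∀ (g : FreeGroup X) (q : Q), (∃ n, q ∈ D n) → ∃ n, g • q ∈ D n := fun g => by
      induction g using FreeGroup.induction_on with
      | C1 => simp
      | of x =>
        rintro q ⟨n, hn⟩
        exact ⟨n + 1, (hD _ _).2 ⟨x, Or.inl (by rwa [inv_smul_smul])⟩⟩
      | inv_of x _ =>
        rintro q ⟨n, hn⟩
        exact ⟨n + 1, (hD _ _).2 ⟨x, Or.inr (by rwa [smul_inv_smul])⟩⟩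
      | mul g h hg hh => intro q hq; rw [mul_smul]; exact hg _ (hh _ hq)
    intro q
    obtain ⟨g, rfl⟩ := hq₀ q
    exact this g q₀ ⟨0, 1, B.one_mem, one_smul _ _⟩
  let d : Q → ℕ := fun q => Nat.find (p := fun n => q ∈ D n) (hex q)
  have hd0 : ∀ q, d q = 0 ↔ ∃ b ∈ B, b • q₀ = q := fun q =>
    (Nat.find_eq_zero (hex q)).trans (hD0 q)
  have hl : ∀ q, ∃ l, d q ≠ 0 → d (l⁻¹ • q) < d q ∧
      ∃ x : X, l = FreeGroup.of x ∨ l = (FreeGroup.of x)⁻¹ := fun q => by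
    by_cases hq : d q = 0
    · exact ⟨1, fun h => absurd hq h⟩
    · obtain ⟨n, hn⟩ := Nat.exists_eq_succ_of_ne_zero hq
      have h1 : q ∈ D (n + 1) := by
        have := Nat.find_spec (hex q)
        rwa [show Nat.find (hex q) = n + 1 from hn] at this
      obtain ⟨x, h | h⟩ := (hD _ _).1 h1
      · refine ⟨FreeGroup.of x, fun _ => ⟨?_, x, Or.inl rfl⟩⟩
        exact lt_of_le_of_lt (Nat.find_min' _ h) (by rw [hn]; exact Nat.lt_succ_self n)
      · refine ⟨(FreeGroup.of x)⁻¹, fun _ => ⟨?_, x, Or.inr rfl⟩⟩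
        rw [inv_inv]
        exact lt_of_le_of_lt (Nat.find_min' _ h) (by rw [hn]; exact Nat.lt_succ_self n)
  choose l hl using hl
  have hs : ∀ q, ∃ s, (q = q₀ → s = 1) ∧ ((∃ b ∈ B, b • q₀ = q) → s ∈ B ∧ s • q₀ = q) := fun q => by
    by_cases hq : q = q₀
    · exact ⟨1, fun _ => rfl, fun _ => ⟨B.one_mem, by rw [hq, one_smul]⟩⟩
    · by_cases h : ∃ b ∈ B, b • q₀ = q
      · obtain ⟨b, hb⟩ := h
        exact ⟨b, fun h => absurd h hq, fun _ => hb⟩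
      · exact ⟨1, fun _ => rfl, fun h' => absurd h' h⟩
  choose s hs1 hs2 using hs
  obtain ⟨σ, hσ0, hσ⟩ := exists_rec_of_height d s l (fun q => (l q)⁻¹ • q) fun q hq => (hl q hq).1
  have hind : ∀ p : Q → Prop, (∀ q, (∃ b ∈ B, b • q₀ = q) → p q) →
      (∀ q, d q ≠ 0 → p ((l q)⁻¹ • q) → p q) → ∀ q, p q := fun p h0 h1 q => by
    induction hn : d q using Nat.strong_induction_on generalizing q with
    | _ n ih =>
      by_cases hq : d q = 0
      · exact h0 q ((hd0 q).1 hq)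
      · exact h1 q hq (ih _ (hn ▸ (hl q hq).1) _ rfl)
  refine ⟨σ, ?_, ?_, ?_, fun p h0 h1 => hind p h0 fun q hq hpq => ?_⟩
  · rw [hσ0 q₀ ((hd0 _).2 ⟨1, B.one_mem, one_smul _ _⟩), hs1 _ rfl]
  · refine hind _ (fun q hq => ?_) fun q hq ih => ?_
    · rw [hσ0 q ((hd0 _).2 hq)]; exact (hs2 q hq).2
    · rw [hσ q hq, mul_smul, ih, smul_inv_smul]
  · intro q hq
    rw [hσ0 q ((hd0 _).2 hq)]
    exact (hs2 q hq).1
  · have hσq := hσ q hq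
    obtain ⟨x, hx | hx⟩ := (hl q hq).2
    · rw [hx] at hσq hpq
      exact (h1 q (fun h => hq ((hd0 q).2 h)) x).1 hσq hpq
    · rw [hx, inv_inv] at hσq hpq
      exact (h1 q (fun h => hq ((hd0 q).2 h)) x).2 hσq hpq

end Schreier

section Schreier

variable {X : Type u}

/-- The intersection of a subgroup with a standard free factor is a free factor of the
subgroup. -/
theorem exists_isExt_inf (S : Set X) (A : Subgroup (FreeGroup X)) :
    ∃ Z, IsExt (A ⊓ Subgroup.closure (FreeGroup.of '' S)) Z A := by
  classical
  suffices ∀ B, B = Subgroup.closure (FreeGroup.of '' S) → ∃ Z, IsExt (A ⊓ B) Z A from this _ rfl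
  intro B hB
  have hSB : ∀ x ∈ S, FreeGroup.of x ∈ B := fun x hx =>
    hB ▸ Subgroup.subset_closure ⟨x, hx, rfl⟩
  have hstab : ∀ x : FreeGroup X, x • ((1 : FreeGroup X) : FreeGroup X ⧸ A) =
    ((1 : FreeGroup X) : FreeGroup X ⧸ A) ↔ x ∈ A := smul_mk_one_eq_iff A
  have htrans : ∀ q : FreeGroup X ⧸ A, ∃ g : FreeGroup X,
      g • ((1 : FreeGroup X) : FreeGroup X ⧸ A) = q := fun q => by
    obtain ⟨g, rfl⟩ := QuotientGroup.mk_surjective q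
    exact ⟨g, by change ((g * 1 : FreeGroup X) : FreeGroup X ⧸ A) = _; rw [mul_one]⟩
  generalize ((1 : FreeGroup X) : FreeGroup X ⧸ A) = q₀ at hstab htrans
  obtain ⟨σ, hσ0, hσ, hσB, hind⟩ := exists_schreier_section q₀ htrans B
  have hO : ∀ b ∈ B, ∀ q, (∃ b ∈ B, b • q₀ = q) → ∃ b' ∈ B, b' • q₀ = b • q := by
    rintro b hb _ ⟨b', hb', rfl⟩
    exact ⟨b * b', B.mul_mem hb hb', mul_smul _ _ _⟩
  have hγA : ∀ g q, (σ (g • q))⁻¹ * g * σ q ∈ A := fun g q => by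
    rw [← hstab, mul_smul, mul_smul, hσ, inv_smul_eq_iff, hσ]
  have hγB : ∀ b ∈ B, ∀ q, (∃ b ∈ B, b • q₀ = q) → (σ (b • q))⁻¹ * b * σ q ∈ A ⊓ B :=
    fun b hb q hq => ⟨hγA b q, B.mul_mem (B.mul_mem (B.inv_mem (hσB _ (hO b hb q hq))) hb)
      (hσB q hq)⟩
  let E : (FreeGroup X ⧸ A) → X → Prop := fun q x => (∃ b ∈ B, b • q₀ = q) ∧ x ∈ S
  let γ : (FreeGroup X ⧸ A) → X → FreeGroup X := fun q x =>
    (σ (FreeGroup.of x • q))⁻¹ * FreeGroup.of x * σ q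
  let Z : Set (FreeGroup X) := {z | ∃ q x, ¬ E q x ∧ z = γ q x ∧ z ≠ 1}
  refine ⟨Z, le_antisymm (fun a ha => ?_) (sup_le inf_le_left ((Subgroup.closure_le _).2 ?_)),
    fun P _ α β => ?_⟩
  · have key : ∀ (g : FreeGroup X) q,
        (σ (g • q))⁻¹ * g * σ q ∈ (A ⊓ B) ⊔ Subgroup.closure Z := fun g => by
      have hof : ∀ x q, γ q x ∈ (A ⊓ B) ⊔ Subgroup.closure Z := fun x q => by
        by_cases hE : E q x
        · exact Subgroup.mem_sup_left (hγB _ (hSB x hE.2) q hE.1)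
        · by_cases h1 : γ q x = 1
          · rw [h1]; exact Subgroup.one_mem _
          · exact Subgroup.mem_sup_right (Subgroup.subset_closure ⟨q, x, hE, rfl, h1⟩)
      induction g using FreeGroup.induction_on with
      | C1 => simp
      | of x => exact hof x
      | inv_of x _ =>
        intro q
        have := Subgroup.inv_mem _ (hof x ((FreeGroup.of x)⁻¹ • q))
        simpa [γ, mul_assoc] using this
      | mul g h hg hh =>
        intro q
        have := Subgroup.mul_mem _ (hg (h • q)) (hh q)
        rw [mul_smul]
        convert this using 1
        group
    have := key a q₀
    rwa [(hstab a).2 ha, hσ0, inv_one, one_mul, mul_one] at this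
  · rintro _ ⟨q, x, -, rfl, -⟩
    exact hγA _ q
  let c : (FreeGroup X ⧸ A) → X → P := fun q x =>
    if h : E q x then α ⟨γ q x, hγB _ (hSB x h.2) q h.1⟩ else if γ q x = 1 then 1 else β (γ q x)
  obtain ⟨θ, hθ, hθmul⟩ := exists_cocycle c
  have hθ1 : ∀ q, θ 1 q = 1 := fun q => by
    have := hθmul 1 1 q
    rwa [one_smul, mul_one, left_eq_mul] at this
  have hθinv : ∀ g q, θ g⁻¹ q = (θ g (g⁻¹ • q))⁻¹ := fun g q => by
    have := hθmul g g⁻¹ q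
    rw [mul_inv_cancel, hθ1] at this
    exact eq_inv_of_mul_eq_one_right this.symm
  have hθB : ∀ b (hb : b ∈ B) q (hq : ∃ b ∈ B, b • q₀ = q), θ b q = α ⟨_, hγB b hb q hq⟩ := by
    have : ∀ b ∈ Subgroup.closure (FreeGroup.of '' S), ∀ q, (∃ b ∈ B, b • q₀ = q) →
        ∀ h : (σ (b • q))⁻¹ * b * σ q ∈ A ⊓ B, θ b q = α ⟨_, h⟩ := by
      intro b hb
      induction hb using Subgroup.closure_induction with
      | mem b hb =>
        obtain ⟨x, hx, rfl⟩ := hb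
        intro q hq h
        have hE : E q x := ⟨hq, hx⟩
        rw [hθ]
        exact dif_pos hE
      | one =>
        intro q hq h
        rw [hθ1, ← map_one α]
        congr 1
        apply Subtype.ext
        change 1 = (σ ((1 : FreeGroup X) • q))⁻¹ * 1 * σ q
        simp
      | mul g g' hg hg' ih ih' =>
        intro q hq h
        rw [← hB] at hg hg'
        rw [hθmul, ih _ (hO g' hg' q hq) (hγB g hg _ (hO g' hg' q hq)),
          ih' q hq (hγB g' hg' q hq), ← map_mul]
        congr 1
        apply Subtype.ext
        change (σ (g • g' • q))⁻¹ * g * σ (g' • q) * ((σ (g' • q))⁻¹ * g' * σ q) =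
          (σ ((g * g') • q))⁻¹ * (g * g') * σ q
        rw [mul_smul]
        group
      | inv g hg ih =>
        intro q hq h
        rw [← hB] at hg
        have hq' := hO _ (B.inv_mem hg) q hq
        rw [hθinv, ih _ hq' (hγB g hg _ hq'), ← map_inv]
        congr 1
        apply Subtype.ext
        change ((σ (g • g⁻¹ • q))⁻¹ * g * σ (g⁻¹ • q))⁻¹ = (σ (g⁻¹ • q))⁻¹ * g⁻¹ * σ q
        rw [smul_inv_smul]
        group
    exact fun b hb q hq => this b (hB ▸ hb) q hq _
  have hq₀ : ∃ b ∈ B, b • q₀ = q₀ := ⟨1, B.one_mem, one_smul _ _⟩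
  have hc1 : ∀ q x, ¬ E q x → γ q x = 1 → c q x = 1 := fun q x hE h1 => by
    simp only [c, dif_neg hE, if_pos h1]
  have hσ1 : ∀ q, θ (σ q) q₀ = 1 := by
    refine hind _ (fun q hq => ?_) fun q hq x => ⟨fun h ih => ?_, fun h ih => ?_⟩
    · rw [hθB _ (hσB q hq) _ hq₀, ← map_one α]
      congr 1
      apply Subtype.ext
      change (σ (σ q • q₀))⁻¹ * σ q * σ q₀ = 1
      rw [hσ, hσ0]
      group
    · rw [h, hθmul, ih, hσ, mul_one, hθ]
      refine hc1 _ _ (fun hE => hq ?_) ?_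
      · have := hO _ (hSB x hE.2) _ hE.1
        rwa [smul_inv_smul] at this
      · change (σ (FreeGroup.of x • (FreeGroup.of x)⁻¹ • q))⁻¹ * FreeGroup.of x *
          σ ((FreeGroup.of x)⁻¹ • q) = 1
        rw [smul_inv_smul, h]
        group
    · rw [h, hθmul, ih, hσ, mul_one, hθinv, inv_smul_smul, hθ, hc1 _ _ (fun hE => hq hE.1), inv_one]
      change (σ (FreeGroup.of x • q))⁻¹ * FreeGroup.of x * σ q = 1
      rw [h]
      group
  refine ⟨MonoidHom.mk' (fun a => θ a q₀) fun a b => ?_, fun a ha ha' => ?_, ?_⟩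
  · rw [Subgroup.coe_mul, hθmul, (hstab _).2 b.2]
  · change θ a q₀ = _
    rw [hθB a ha.2 q₀ hq₀]
    congr 1
    apply Subtype.ext
    change (σ (a • q₀))⁻¹ * a * σ q₀ = a
    rw [(hstab a).2 ha', hσ0]
    group
  · rintro _ ⟨q, x, hE, rfl, h1⟩ h'
    change θ ((σ (FreeGroup.of x • q))⁻¹ * FreeGroup.of x * σ q) q₀ = _
    rw [hθmul, hσ1, hσ, mul_one, hθmul, hθinv, hθ]
    have h2 : (σ (FreeGroup.of x • q))⁻¹ • FreeGroup.of x • q = q₀ := by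
      rw [inv_smul_eq_iff, hσ]
    rw [h2, hσ1, inv_one, one_mul]
    simp only [c, dif_neg hE, if_neg h1]

end Schreier

/-! ### Exhausting the free group -/

section FiniteExt

variable {G : Type u} [Group G] {φ : MulAut G} {w : G} {K K' : Subgroup G} {Z : Set G}

theorem exists_finite_subset_mem {Y : Set G} {x : G} (hx : x ∈ K ⊔ Subgroup.closure Y) :
    ∃ Y₀ ⊆ Y, Y₀.Finite ∧ x ∈ K ⊔ Subgroup.closure Y₀ := by
  have hY : ⋃₀ {Y₀ | Y₀ ⊆ Y ∧ Y₀.Finite} = Y := by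
    refine Set.Subset.antisymm (Set.sUnion_subset fun Y₀ h => h.1) fun y hy => ?_
    exact ⟨{y}, ⟨Set.singleton_subset_iff.2 hy, Set.finite_singleton y⟩, rfl⟩
  rw [← hY, mem_sup_closure_sUnion (c := {Y₀ | Y₀ ⊆ Y ∧ Y₀.Finite})
    (fun A hA B hB => ⟨A ∪ B, ⟨Set.union_subset hA.1 hB.1, hA.2.union hB.2⟩,
      Set.subset_union_left, Set.subset_union_right⟩)
      ⟨∅, Set.empty_subset _, Set.finite_empty⟩] at hx
  obtain ⟨Y₀, ⟨h1, h2⟩, h3⟩ := hx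
  exact ⟨Y₀, h1, h2, h3⟩

/-- A free extension generated over its base by finitely many elements is free of finite
rank. -/
theorem IsExt.finite_of_le (h : IsExt K Z K') {T : Set G} (hT : T.Finite)
    (hle : K' ≤ K ⊔ Subgroup.closure T) (hTK : T ⊆ K') : Z.Finite := by
  choose! Y h1 h2 h3 using fun t (ht : t ∈ T) =>
    exists_finite_subset_mem (show t ∈ K ⊔ Subgroup.closure Z from h.1 ▸ hTK ht)
  refine (hT.biUnion h2).subset fun z hz => ?_
  by_contra hz'
  have hsub : ∀ t ∈ T, Y t ⊆ Z \ {z} := fun t ht y hy => by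
    refine ⟨h1 t ht hy, ?_⟩
    rintro rfl
    exact hz' (Set.mem_biUnion ht hy)
  have hK' : K' ≤ K ⊔ Subgroup.closure (Z \ {z}) :=
    hle.trans (sup_le le_sup_left ((Subgroup.closure_le _).2 fun t ht =>
      sup_le_sup_left (Subgroup.closure_mono (hsub t ht)) K (h3 t ht)))
  exact h.notMem hz (hK' (h.subset hz))

theorem IsExt.reflTransGen_step (htf : ∀ (g : G) (n : ℕ), n ≠ 0 → g ^ n = 1 → g = 1)
    (hφ : ∀ x, φ (φ x) = w * x * w⁻¹) (hφw : φ w = w) (hw : w ∈ K) (hK : ∀ x ∈ K, φ x ∈ K)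
    (hK' : ∀ x ∈ K', φ x ∈ K') (hZ : Z.Finite) (h : IsExt K Z K') :
    Relation.ReflTransGen (Step φ w) K K' := by
  have hL := apply_mem_iff_of_invariant hφ (h.le hw) hK'
  have key := reflTransGen_step_top (φ := restrictAut φ K' hL) (w := ⟨w, h.le hw⟩)
    (H := K.subgroupOf K') (Z := ((↑) : K' → G) ⁻¹' Z)
    (fun g n hn hg => Subtype.ext (htf g n hn (by simpa using congrArg Subtype.val hg)))
    (fun x => Subtype.ext (hφ x)) (Subtype.ext hφw) hw (fun x hx => hK x hx)
    (hZ.preimage Subtype.val_injective.injOn) h.subgroupOf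
  have : Relation.ReflTransGen (Step φ w) ((K.subgroupOf K').map K'.subtype)
      ((⊤ : Subgroup K').map K'.subtype) := key.lift (p := Step φ w)
      (fun A => A.map K'.subtype) fun A A' hA =>
    hA.map_subtype K' hL
  rwa [Subgroup.subgroupOf_map_subtype, inf_eq_left.2 h.le, ← MonoidHom.range_eq_map,
    Subgroup.range_subtype] at this

end FiniteExt

section Exhaust

variable {X : Type u} {φ : MulAut (FreeGroup X)} {w : FreeGroup X}

theorem FreeGroup.exists_finite_letters (T : Set (FreeGroup X)) (hT : T.Finite) :
    ∃ S : Set X, S.Finite ∧ T ⊆ Subgroup.closure (FreeGroup.of '' S) := by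
  have h1 : ∀ g : FreeGroup X, ∃ S : Set X, S.Finite ∧ g ∈
      Subgroup.closure (FreeGroup.of '' S) := by
    intro g
    have hmono : ∀ {S S' : Set X}, S ⊆ S' → Subgroup.closure (FreeGroup.of '' S) ≤
      Subgroup.closure (FreeGroup.of '' S') := fun h => Subgroup.closure_mono (Set.image_mono h)
    induction g using FreeGroup.induction_on with
    | C1 => exact ⟨∅, Set.finite_empty, Subgroup.one_mem _⟩
    | of x => exact ⟨{x}, Set.finite_singleton x, Subgroup.subset_closure ⟨x, rfl, rfl⟩⟩
    | inv_of x _ => exact ⟨{x}, Set.finite_singleton x,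
        Subgroup.inv_mem _ (Subgroup.subset_closure ⟨x, rfl, rfl⟩)⟩
    | mul g h hg hh =>
      obtain ⟨S, hS, hg⟩ := hg
      obtain ⟨S', hS', hh⟩ := hh
      exact ⟨S ∪ S', hS.union hS', Subgroup.mul_mem _ (hmono Set.subset_union_left hg)
        (hmono Set.subset_union_right hh)⟩
  choose S hS hg using h1
  exact ⟨⋃ t ∈ T, S t, hT.biUnion fun t _ => hS t, fun t ht =>
    Subgroup.closure_mono (Set.image_mono (Set.subset_biUnion_of_mem ht)) (hg t)⟩

/-- The intersection of a standard free factor with its image under `φ`. -/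
def coreOf (φ : MulAut (FreeGroup X)) (S : Set X) : Subgroup (FreeGroup X) :=
  Subgroup.closure (FreeGroup.of '' S) ⊓
    (Subgroup.closure (FreeGroup.of '' S)).map φ.toMonoidHom

theorem coreOf_invariant (hφ : ∀ x, φ (φ x) = w * x * w⁻¹) {S : Set X}
    (hw : w ∈ Subgroup.closure (FreeGroup.of '' S)) : ∀ x ∈ coreOf φ S, φ x ∈ coreOf φ S := by
  rintro x ⟨h1, a, ha, rfl⟩
  refine ⟨?_, _, h1, rfl⟩
  change φ (φ a) ∈ _
  rw [hφ]
  exact Subgroup.mul_mem _ (Subgroup.mul_mem _ hw ha) (Subgroup.inv_mem _ hw)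

theorem mem_coreOf (hφw : φ w = w) {S : Set X}
    (hw : w ∈ Subgroup.closure (FreeGroup.of '' S)) : w ∈ coreOf φ S := ⟨hw, w, hw, hφw⟩

theorem exists_isExt_inf_map (φ : MulAut (FreeGroup X)) (S : Set X) (M : Subgroup (FreeGroup X)) :
    ∃ Z, IsExt (M ⊓ (Subgroup.closure (FreeGroup.of '' S)).map φ.toMonoidHom) Z M := by
  obtain ⟨Z, h⟩ := exists_isExt_inf S (M.comap φ.toMonoidHom)
  have h' := h.map φ.toMonoidHom φ.injective
  rw [Subgroup.map_inf _ _ _ φ.injective,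
    Subgroup.map_comap_eq_self_of_surjective φ.surjective] at h'
  exact ⟨_, h'⟩

theorem FreeGroup.eq_one_of_pow_eq_one (g : FreeGroup X) (n : ℕ) (hn : n ≠ 0) (h : g ^ n = 1) :
    g = 1 :=
  pow_left_injective hn (by simpa using h)

/-- Enlarging a standard free factor so as to contain a letter and so that its core contains the
previous factor. -/
theorem exists_coreOf_extension (hφ : ∀ x, φ (φ x) = w * x * w⁻¹) (hφw : φ w = w) {S : Set X}
    (hw : w ∈ Subgroup.closure (FreeGroup.of '' S)) {C : Set (FreeGroup X)} (hC : C.Finite)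
    (hSC : Subgroup.closure (FreeGroup.of '' S) ≤ coreOf φ S ⊔ Subgroup.closure C) (x : X) :
    ∃ S₁ : Set X, S ⊆ S₁ ∧ x ∈ S₁ ∧ Subgroup.closure (FreeGroup.of '' S) ≤ coreOf φ S₁ ∧
      (∃ C₁ : Set (FreeGroup X), C₁.Finite ∧
        Subgroup.closure (FreeGroup.of '' S₁) ≤ coreOf φ S₁ ⊔ Subgroup.closure C₁) ∧
      Relation.ReflTransGen (Step φ w) (coreOf φ S) (coreOf φ S₁) := by
  obtain ⟨T, hT, hCT⟩ := FreeGroup.exists_finite_letters (C ∪ φ.symm '' C) (hC.union (hC.image _))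
  have hmono : ∀ {S S' : Set X}, S ⊆ S' → Subgroup.closure (FreeGroup.of '' S) ≤
    Subgroup.closure (FreeGroup.of '' S') := fun h => Subgroup.closure_mono (Set.image_mono h)
  obtain ⟨S₁, hS₁⟩ : ∃ S₁ : Set X, S₁ = S ∪ ({x} ∪ T) := ⟨_, rfl⟩
  have hSS₁ : S ⊆ S₁ := hS₁ ▸ Set.subset_union_left
  have hTS₁ : T ⊆ S₁ := hS₁ ▸ Set.subset_union_right.trans Set.subset_union_right
  have hle : Subgroup.closure (FreeGroup.of '' S) ≤ coreOf φ S₁ := by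
    refine le_inf (hmono hSS₁) (hSC.trans (sup_le (inf_le_right.trans
      (Subgroup.map_mono (hmono hSS₁))) ((Subgroup.closure_le _).2 fun y hy => ?_)))
    exact ⟨φ.symm y, hmono hTS₁ (hCT (Or.inr ⟨y, hy, rfl⟩)), φ.apply_symm_apply y⟩
  have hgen : Subgroup.closure (FreeGroup.of '' S₁) ≤
      coreOf φ S ⊔ Subgroup.closure (C ∪ FreeGroup.of '' ({x} ∪ T)) := by
    rw [hS₁, Set.image_union, Subgroup.closure_union]
    refine sup_le (hSC.trans (sup_le_sup_left (Subgroup.closure_mono Set.subset_union_left) _))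
      ((Subgroup.closure_mono Set.subset_union_right).trans le_sup_right)
  have hfin : (C ∪ FreeGroup.of '' ({x} ∪ T)).Finite :=
    hC.union (((Set.finite_singleton x).union hT).image _)
  have hKK : coreOf φ S ≤ coreOf φ S₁ := inf_le_left.trans hle
  refine ⟨S₁, hSS₁, hS₁ ▸ Or.inr (Or.inl rfl), hle, ⟨_, hfin, hgen.trans (sup_le_sup_right hKK _)⟩,
    ?_⟩
  obtain ⟨Y₁, hY₁⟩ := exists_isExt_inf S (coreOf φ S₁)
  obtain ⟨Y₂, hY₂⟩ := exists_isExt_inf_map φ S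
    (coreOf φ S₁ ⊓ Subgroup.closure (FreeGroup.of '' S))
  obtain ⟨Y₃, hY₃⟩ := exists_isExt_inf_map φ S₁ (Subgroup.closure (FreeGroup.of '' S₁))
  rw [inf_assoc, show Subgroup.closure (FreeGroup.of '' S) ⊓ _ = coreOf φ S from rfl,
    inf_eq_right.2 hKK] at hY₂
  have hext := hY₂.trans hY₁
  have hext' := hext.trans hY₃
  refine hext.reflTransGen_step FreeGroup.eq_one_of_pow_eq_one hφ hφw (mem_coreOf hφw hw)
    (coreOf_invariant hφ hw) (coreOf_invariant hφ (hmono hSS₁ hw)) ?_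
  refine (hext'.finite_of_le hfin hgen ?_).subset Set.subset_union_left
  refine Set.union_subset (fun y hy => hmono hTS₁ (hCT (Or.inl hy))) ?_
  exact (Set.image_mono (hS₁ ▸ Set.subset_union_right)).trans Subgroup.subset_closure

end Exhaust

section Exhaust

variable {X : Type u} {φ : MulAut (FreeGroup X)} {w : FreeGroup X} {H : Subgroup (FreeGroup X)}

/-- An adapted set of generators whose span is the core of a standard free factor which is
finitely generated over that core. -/
structure IsCoreStage (φ : MulAut (FreeGroup X)) (w : FreeGroup X) (H : Subgroup (FreeGroup X))
    (B : Set (FreeGroup X)) (S : Set X) : Prop where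
  adapted : IsAdapted φ w H B
  span : H ⊔ Subgroup.closure B = coreOf φ S
  mem : w ∈ Subgroup.closure (FreeGroup.of '' S)
  fg : ∃ C : Set (FreeGroup X), C.Finite ∧
    Subgroup.closure (FreeGroup.of '' S) ≤ coreOf φ S ⊔ Subgroup.closure C

theorem IsCoreStage.exists_next (hφ : ∀ x, φ (φ x) = w * x * w⁻¹) (hφw : φ w = w) (hw : w ∈ H)
    {B : Set (FreeGroup X)} {S : Set X} (h : IsCoreStage φ w H B S) (x : X) :
    ∃ B' S', IsCoreStage φ w H B' S' ∧ B ⊆ B' ∧ S ⊆ S' ∧ x ∈ S' ∧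
      Subgroup.closure (FreeGroup.of '' S) ≤ coreOf φ S' := by
  obtain ⟨C, hC, hSC⟩ := h.fg
  obtain ⟨S', hS', hx, hle, hfg, hstep⟩ := exists_coreOf_extension hφ hφw h.mem hC hSC x
  obtain ⟨B', hB', hA, hspan⟩ := h.adapted.exists_of_reflTransGen hφ hφw hw (h.span ▸ hstep)
  exact ⟨B', S', ⟨hA, hspan, Subgroup.closure_mono (Set.image_mono hS') h.mem, hfg⟩, hB', hS', hx,
    hle⟩

/-- Any stage extends to an adapted set spanning a standard free factor containing a given
letter. -/
theorem IsCoreStage.exists_span (hφ : ∀ x, φ (φ x) = w * x * w⁻¹) (hφw : φ w = w) (hw : w ∈ H)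
    {B : Set (FreeGroup X)} {S : Set X} (h : IsCoreStage φ w H B S) (x : X) :
    ∃ B' S', IsAdapted φ w H B' ∧ H ⊔ Subgroup.closure B' = Subgroup.closure (FreeGroup.of '' S') ∧
      B ⊆ B' ∧ x ∈ S' := by
  choose nB nS hn hB hS hx hle using fun p : {p : Set (FreeGroup X) × Set X //
    IsCoreStage φ w H p.1 p.2} => p.2.exists_next hφ hφw hw x
  let seq : ℕ → {p : Set (FreeGroup X) × Set X // IsCoreStage φ w H p.1 p.2} := fun n =>
    Nat.rec ⟨(B, S), h⟩ (fun _ p => ⟨(nB p, nS p), hn p⟩) n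
  have hmono : Monotone fun n => (seq n).1.1 := monotone_nat_of_le_succ fun n => hB (seq n)
  have hdir : DirectedOn (· ⊆ ·) (Set.range fun n => (seq n).1.1) := by
    rintro _ ⟨m, rfl⟩ _ ⟨n, rfl⟩
    exact ⟨_, ⟨max m n, rfl⟩, hmono (le_max_left m n), hmono (le_max_right m n)⟩
  have hne : (Set.range fun n => (seq n).1.1).Nonempty := ⟨_, 0, rfl⟩
  refine ⟨⋃₀ Set.range fun n => (seq n).1.1, ⋃ n, (seq n).1.2,
    IsAdapted.sUnion hdir hne ?_, le_antisymm (fun g hg => ?_) ?_, fun b hb => ⟨_, ⟨0, rfl⟩, hb⟩,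
    Set.mem_iUnion.2 ⟨1, hx (seq 0)⟩⟩
  · rintro _ ⟨n, rfl⟩
    exact (seq n).2.adapted
  · obtain ⟨_, ⟨n, rfl⟩, hg⟩ := (mem_sup_closure_sUnion hdir hne).1 hg
    rw [(seq n).2.span] at hg
    exact Subgroup.closure_mono (Set.image_mono (Set.subset_iUnion (fun n => (seq n).1.2) n)) hg.1
  · refine (Subgroup.closure_le _).2 ?_
    rintro _ ⟨s, hs, rfl⟩
    obtain ⟨n, hs⟩ := Set.mem_iUnion.1 hs
    refine (mem_sup_closure_sUnion hdir hne).2 ⟨_, ⟨n + 1, rfl⟩, ?_⟩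
    have h1 := hle (seq n) (Subgroup.subset_closure ⟨s, hs, rfl⟩)
    have h2 : H ⊔ Subgroup.closure (seq (n + 1)).1.1 = coreOf φ (seq (n + 1)).1.2 :=
      (seq (n + 1)).2.span
    change FreeGroup.of s ∈ H ⊔ Subgroup.closure (seq (n + 1)).1.1
    rw [h2]
    exact h1

/-- Over the core of a finitely generated standard free factor, the free group has an adapted set
of free generators. -/
theorem exists_isAdapted_top [Nonempty X] (hφ : ∀ x, φ (φ x) = w * x * w⁻¹) (hφw : φ w = w)
    {S : Set X} (hS : S.Finite) (hw : w ∈ Subgroup.closure (FreeGroup.of '' S))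
    (h : IsAdapted φ w (coreOf φ S) ∅) :
    ∃ B, IsAdapted φ w (coreOf φ S) B ∧ coreOf φ S ⊔ Subgroup.closure B = ⊤ := by
  have hwH := mem_coreOf hφw hw
  have hstart : IsCoreStage φ w (coreOf φ S) ∅ S :=
    ⟨h, by simp, hw, _, hS.image _, le_sup_right⟩
  generalize coreOf φ S = H at h hwH hstart
  obtain ⟨x⟩ := ‹Nonempty X›
  obtain ⟨B₀, S₀, hB₀, hspan₀, -⟩ := hstart.exists_span hφ hφw hwH x
  obtain ⟨B, -, hB⟩ := zorn_subset_nonempty {B | IsAdapted φ w H B ∧ ∃ S' : Set X,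
    H ⊔ Subgroup.closure B = Subgroup.closure (FreeGroup.of '' S')} (fun c hc hchain hne => by
      choose! s hs using fun B (hB : B ∈ c) => (hc hB).2
      have hdir : DirectedOn (· ⊆ ·) c := hchain.directedOn
      refine ⟨⋃₀ c, ⟨IsAdapted.sUnion hdir hne fun B hB => (hc hB).1, ⋃ B ∈ c, s B,
        le_antisymm (fun g hg => ?_) ?_⟩, fun B hB => Set.subset_sUnion_of_mem hB⟩
      · obtain ⟨B, hB, hg⟩ := (mem_sup_closure_sUnion hdir hne).1 hg
        rw [hs B hB] at hg
        exact Subgroup.closure_mono (Set.image_mono (Set.subset_biUnion_of_mem hB)) hg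
      · refine (Subgroup.closure_le _).2 ?_
        rintro _ ⟨y, hy, rfl⟩
        obtain ⟨B, hB, hy⟩ := Set.mem_iUnion₂.1 hy
        refine (mem_sup_closure_sUnion hdir hne).2 ⟨B, hB, ?_⟩
        rw [hs B hB]
        exact Subgroup.subset_closure ⟨y, hy, rfl⟩) B₀ ⟨hB₀, S₀, hspan₀⟩
  obtain ⟨⟨hBA, S', hS'⟩, hmax⟩ := hB
  refine ⟨B, hBA, ?_⟩
  have hwS' : w ∈ Subgroup.closure (FreeGroup.of '' S') := hS' ▸ Subgroup.mem_sup_left hwH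
  have hcore : coreOf φ S' = Subgroup.closure (FreeGroup.of '' S') := by
    refine inf_eq_left.2 fun y hy => ⟨φ.symm y, ?_, φ.apply_symm_apply y⟩
    have := apply_mem_iff_of_invariant hφ (Subgroup.mem_sup_left hwH) hBA.inv (φ.symm y)
    rw [MulEquiv.apply_symm_apply, hS'] at this
    exact this.1 hy
  have hstage : IsCoreStage φ w H B S' :=
    ⟨hBA, hS'.trans hcore.symm, hwS', ∅, Set.finite_empty, by simp [hcore]⟩
  rw [eq_top_iff, ← FreeGroup.closure_range_of, Subgroup.closure_le]
  rintro _ ⟨x, rfl⟩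
  obtain ⟨B', S'', hB', hspan, hBB', hx⟩ := hstage.exists_span hφ hφw hwH x
  have hle : H ⊔ Subgroup.closure B' ≤ H ⊔ Subgroup.closure B :=
    sup_le_sup_left (Subgroup.closure_mono (hmax ⟨hB', S'', hspan⟩ hBB')) _
  refine hle ?_
  rw [hspan]
  exact Subgroup.subset_closure ⟨x, hx, rfl⟩

end Exhaust

/-! ### Conjugates that commute -/

section Pairs

variable {G : Type u} [Group G] {φ : MulAut G} {w : G}

/-- An extension of the trivial automorphism of the base of an extension of `G` by an assignment of
generators which is an involution on the generators. -/
theorem IsExt.exists_mulAut {M : Subgroup G} {Z : Set G} (h : IsExt M Z ⊤) (β : G → G)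
    (hβ : ∀ x ∈ Z, β x = x ∨ β x = x⁻¹) :
    ∃ g : MulAut G, (∀ x ∈ M, g x = x) ∧ (∀ x ∈ Z, g x = β x) ∧ ∀ x, g (g x) = x := by
  obtain ⟨a, ha, ha'⟩ := h.exists_hom_top M.subtype β
  have hinv : ∀ x, a (a x) = x := by
    have hle : (⊤ : Subgroup G) ≤ (a.comp a).eqLocus (MonoidHom.id G) := by
      refine h.le_of (fun x hx => ?_) (fun x hx => ?_)
      · change a (a x) = x
        have : a x = x := ha x hx
        rw [this, this]
      · change a (a x) = x
        have e := ha' x hx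
        rcases hβ x hx with h1 | h1 <;> rw [h1] at e <;> simp [e]
    exact fun x => hle (Subgroup.mem_top x)
  exact ⟨{ toFun := a, invFun := a, left_inv := hinv, right_inv := hinv, map_mul' := a.map_mul },
    fun x hx => ha x hx, ha', hinv⟩

theorem toOut_eq_iff {a b : MulAut G} : toOut a = toOut b ↔ ∃ c, MulAut.conj c = a⁻¹ * b := by
  rw [toOut, QuotientGroup.mk'_eq_mk']
  constructor
  · rintro ⟨_, ⟨c, rfl⟩, h⟩
    exact ⟨c, by rw [← h]; group⟩
  · rintro ⟨c, hc⟩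
    exact ⟨_, ⟨c, rfl⟩, by rw [hc]; group⟩

/-- If the class of `φ` is anti-commutative then `φ` does not permute two independent elements
modulo an invariant complement. -/
theorem not_isExt_pair (hφ : ∀ x, φ (φ x) = w * x * w⁻¹)
    (hanti : AntiCommSet {g : OutAut G | IsConj (toOut φ) g}) {M : Subgroup G}
    (hM : ∀ x ∈ M, φ x ∈ M) (hw : w ∈ M) {z : G} (hz : z ≠ φ z) : ¬ IsExt M {z, φ z} ⊤ := by
  classical
  intro h
  obtain ⟨g, hgM, hgZ, hgg⟩ := h.exists_mulAut (fun x => if x = z then x⁻¹ else x)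
    (fun x _ => by by_cases hx : x = z <;> simp [hx])
  have hgz : g z = z⁻¹ := by simpa using hgZ z (by simp)
  have hgz' : g (φ z) = φ z := by simpa [hz.symm] using hgZ (φ z) (by simp)
  have hφinv : ∀ x, φ⁻¹ x = w⁻¹ * φ x * w := fun x => by
    have := hφ (φ⁻¹ x)
    rw [MulAut.apply_inv_self] at this
    rw [this]; group
  obtain ⟨g', hg'⟩ : ∃ g' : MulAut G, g' = φ * g * φ⁻¹ := ⟨_, rfl⟩
  have happ : ∀ x, g' x = φ (g (φ⁻¹ x)) := fun x => by rw [hg']; rfl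
  have hMinv : ∀ x ∈ M, φ⁻¹ x ∈ M := fun x hx => by
    rw [hφinv]; exact M.mul_mem (M.mul_mem (M.inv_mem hw) (hM x hx)) hw
  have hφgM : ∀ x ∈ M, g' x = x := fun x hx => by
    rw [happ, hgM _ (hMinv x hx), MulAut.apply_inv_self]
  have hφgz : g' z = z := by
    have : g (φ⁻¹ z) = φ⁻¹ z := by
      rw [hφinv, map_mul, map_mul, hgz', hgM _ hw, hgM _ (M.inv_mem hw)]
    rw [happ, this, MulAut.apply_inv_self]
  have hφgz' : g' (φ z) = (φ z)⁻¹ := by rw [happ, MulAut.inv_apply_self, hgz, map_inv]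
  have hcomm : g * g' = g' * g := by
    have hle : (⊤ : Subgroup G) ≤ (g * g').toMonoidHom.eqLocus (g' * g).toMonoidHom := by
      refine h.le_of (fun x hx => ?_) ?_
      · change g (g' x) = g' (g x)
        rw [hφgM x hx, hgM x hx, hφgM x hx]
      · rintro x (rfl | rfl)
        · change g (g' x) = g' (g x)
          rw [hφgz, hgz, map_inv, hφgz]
        · change g (g' (φ z)) = g' (g (φ z))
          rw [hφgz', hgz', map_inv, hgz', hφgz']
    ext x
    exact hle (Subgroup.mem_top x)
  have hf2 : toOut φ * toOut φ = 1 := by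
    rw [← map_mul, ← map_one toOut, eq_comm, toOut_eq_iff]
    refine ⟨w, ?_⟩
    ext x
    simp [hφ]
  have hg2 : toOut g * toOut g = 1 := by
    rw [← map_mul, ← map_one toOut]
    congr 1
    ext x
    simp [hgg]
  have hout : toOut g' = toOut φ * toOut g * toOut φ := by
    rw [hg', map_mul, map_mul, map_inv, inv_eq_of_mul_eq_one_left hf2]
  have hcomm' : toOut g * toOut g' = toOut g' * toOut g := by rw [← map_mul, hcomm, map_mul]
  have heq : toOut φ = toOut g * toOut φ * (toOut g)⁻¹ := by
    by_contra hne
    refine hanti _ (IsConj.refl _) _ (isConj_iff.2 ⟨toOut g, rfl⟩) hne ?_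
    rw [inv_eq_of_mul_eq_one_left hg2]
    rw [hout] at hcomm'
    calc toOut φ * (toOut g * toOut φ * toOut g) = toOut φ * toOut g * toOut φ * toOut g := by
          group
      _ = toOut g * (toOut φ * toOut g * toOut φ) := hcomm'.symm
      _ = _ := by group
  have hgg' : toOut g = toOut g' := by
    rw [hout]
    have : toOut φ * toOut g = toOut g * toOut φ := by
      conv_lhs => rw [heq]
      group
    rw [this, mul_assoc, hf2, mul_one]
  obtain ⟨c, hc⟩ := toOut_eq_iff.1 hgg'
  have hcz : c * z * c⁻¹ = z⁻¹ := by
    have := DFunLike.congr_fun hc z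
    rw [MulAut.conj_apply, MulAut.mul_apply, hφgz] at this
    rw [this, MulAut.inv_apply, MulEquiv.symm_apply_eq, map_inv, hgz, inv_inv]
  obtain ⟨p, hp, hp'⟩ := h.exists_hom (P := Multiplicative ℤ) 1
    (fun x => if x = z then Multiplicative.ofAdd 1 else 1)
  have hpz : p ⟨z, trivial⟩ = Multiplicative.ofAdd 1 := by simpa using hp' z (by simp) trivial
  have h1 : p (⟨c, trivial⟩ * ⟨z, trivial⟩ * ⟨c, trivial⟩⁻¹) = p (⟨z, trivial⟩⁻¹) :=
    congrArg p (Subtype.ext hcz)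
  rw [map_mul, map_mul, map_inv, map_inv, mul_comm, inv_mul_cancel_left, hpz] at h1
  exact absurd h1 (by decide)

end Pairs

section Complements

variable {G : Type u} [Group G] {φ : MulAut G} {w : G} {H K K' : Subgroup G} {B Z : Set G}

theorem IsExt.image_mul_mul (h : IsExt K Z K') (σ : G → G)
    (hσ : ∀ z ∈ Z, ∃ l ∈ K, ∃ r ∈ K, σ z = l * z * r ∨ σ z = l * z⁻¹ * r) :
    IsExt K (σ '' Z) K' := by
  have hmem : ∀ z ∈ Z, σ z ∈ K' := fun z hz => by
    obtain ⟨l, hl, r, hr, e | e⟩ := hσ z hz <;> rw [e]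
    · exact mul_mem (mul_mem (h.le hl) (h.subset hz)) (h.le hr)
    · exact mul_mem (mul_mem (h.le hl) (inv_mem (h.subset hz))) (h.le hr)
  refine ⟨le_antisymm (h.le_of le_sup_left fun z hz => ?_)
    (sup_le h.le ((Subgroup.closure_le _).2 (Set.image_subset_iff.2 hmem))), fun P _ α β => ?_⟩
  · have h0 : σ z ∈ K ⊔ Subgroup.closure (σ '' Z) :=
      Subgroup.mem_sup_right (Subgroup.subset_closure ⟨z, hz, rfl⟩)
    obtain ⟨l, hl, r, hr, e | e⟩ := hσ z hz
    · have : z = l⁻¹ * σ z * r⁻¹ := by rw [e]; group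
      rw [SetLike.mem_coe, this]
      exact mul_mem (mul_mem (inv_mem (Subgroup.mem_sup_left hl)) h0)
        (inv_mem (Subgroup.mem_sup_left hr))
    · have : z = r * (σ z)⁻¹ * l := by rw [e]; group
      rw [SetLike.mem_coe, this]
      exact mul_mem (mul_mem (Subgroup.mem_sup_left hr) (inv_mem h0)) (Subgroup.mem_sup_left hl)
  · have hval : ∀ z, ∃ p : P, z ∈ Z → ∃ l, ∃ hl : l ∈ K, ∃ r, ∃ hr : r ∈ K,
        (σ z = l * z * r ∧ β (σ z) = α ⟨l, hl⟩ * p * α ⟨r, hr⟩) ∨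
        (σ z = l * z⁻¹ * r ∧ β (σ z) = α ⟨l, hl⟩ * p⁻¹ * α ⟨r, hr⟩) := by
      intro z
      by_cases hz : z ∈ Z
      · obtain ⟨l, hl, r, hr, e | e⟩ := hσ z hz
        · exact ⟨(α ⟨l, hl⟩)⁻¹ * β (σ z) * (α ⟨r, hr⟩)⁻¹, fun _ =>
            ⟨l, hl, r, hr, Or.inl ⟨e, by group⟩⟩⟩
        · exact ⟨α ⟨r, hr⟩ * (β (σ z))⁻¹ * α ⟨l, hl⟩, fun _ =>
            ⟨l, hl, r, hr, Or.inr ⟨e, by group⟩⟩⟩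
      · exact ⟨1, fun h => absurd h hz⟩
    choose p hp using hval
    obtain ⟨f, h1, h2⟩ := h.2 P α p
    refine ⟨f, h1, ?_⟩
    rintro _ ⟨z, hz, rfl⟩ hz'
    obtain ⟨l, hl, r, hr, ⟨e, e'⟩ | ⟨e, e'⟩⟩ := hp z hz
    · rw [e', ← h1 l hl (h.le hl), ← h1 r hr (h.le hr), ← h2 z hz (h.subset hz), ← map_mul,
        ← map_mul]
      exact congrArg f (Subtype.ext e)
    · rw [e', ← h1 l hl (h.le hl), ← h1 r hr (h.le hr), ← h2 z hz (h.subset hz), ← map_inv,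
        ← map_mul, ← map_mul]
      exact congrArg f (Subtype.ext e)

theorem Subgroup.map_mem_of_closure {M : Type*} [Group M] {ψ : MulAut M} {A : Subgroup M}
    {T : Set M} (hA : ∀ x ∈ A, ψ x ∈ A ⊔ Subgroup.closure T)
    (hT : ∀ x ∈ T, ψ x ∈ A ⊔ Subgroup.closure T) :
    ∀ x ∈ A ⊔ Subgroup.closure T, ψ x ∈ A ⊔ Subgroup.closure T := by
  have : A ⊔ Subgroup.closure T ≤ (A ⊔ Subgroup.closure T).comap ψ.toMonoidHom :=
    sup_le hA ((Subgroup.closure_le _).2 hT)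
  exact this

/-- Under the anti-commutativity hypothesis an adapted basis contains no permuted pair. -/
theorem IsAdapted.eq_of_pair (hφ : ∀ x, φ (φ x) = w * x * w⁻¹)
    (hanti : AntiCommSet {g : OutAut G | IsConj (toOut φ) g}) (hw : w ∈ H)
    (hH : ∀ x ∈ H, φ x ∈ H) (h : IsAdapted φ w H B) (htop : H ⊔ Subgroup.closure B = ⊤)
    {z : G} (hz : z ∈ B) (hz' : φ z ∈ B) : z = φ z := by
  by_contra hne
  have hext : IsExt H B ⊤ := htop ▸ h.ext
  have key : ∀ {a b}, a ∈ B → b ∈ B → a ≠ b → ∀ {c d}, c ∈ H → d ∈ H →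
      b = c * a * d ∨ b = c * a⁻¹ * d → False := by
    intro a b ha hb hab c d hc hd hcd
    have ha' : a ∈ H ⊔ Subgroup.closure (B \ {b}) :=
      Subgroup.mem_sup_right (Subgroup.subset_closure ⟨ha, hab⟩)
    refine hext.notMem hb ?_
    rcases hcd with e | e
    · have := mul_mem (mul_mem (Subgroup.mem_sup_left hc) ha') (Subgroup.mem_sup_left hd)
      rwa [← e] at this
    · have := mul_mem (mul_mem (Subgroup.mem_sup_left hc) (inv_mem ha'))
        (Subgroup.mem_sup_left hd)
      rwa [← e] at this
  have hsolve : ∀ a x : G, a * x * w = 1 → x = 1 * a⁻¹ * w⁻¹ := fun a x hx => by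
    rw [eq_mul_inv_iff_mul_eq, one_mul]
    exact eq_inv_of_mul_eq_one_right (by rw [← mul_assoc]; exact hx)
  obtain ⟨C, hC⟩ : ∃ C, C = B \ {z, φ z} := ⟨_, rfl⟩
  have hCB : ∀ x, x ∈ C ↔ x ∈ B ∧ x ≠ z ∧ x ≠ φ z := fun x => by simp [hC]
  have hBC : B = C ∪ {z, φ z} := by
    rw [hC, Set.sdiff_union_of_subset]
    rintro x (rfl | rfl) <;> assumption
  have hpair : IsExt (H ⊔ Subgroup.closure C) {z, φ z} ⊤ :=
    (hBC ▸ hext : IsExt H (C ∪ {z, φ z}) ⊤).right_of_union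
      (by rw [hC]; exact Set.disjoint_sdiff_left)
  have hwM : w ∈ H ⊔ Subgroup.closure C := Subgroup.mem_sup_left hw
  have hCM : ∀ x ∈ C, x ∈ H ⊔ Subgroup.closure C := fun x hx =>
    Subgroup.mem_sup_right (Subgroup.subset_closure hx)
  have hlabel : ∀ e, IsLabel φ w B e → e ∈ H ⊔ Subgroup.closure C := by
    rintro e ⟨he, rfl | heB⟩
    · exact one_mem _
    · refine hCM _ ((hCB e).2 ⟨heB, ?_, ?_⟩)
      · rintro rfl
        exact key hz hz' hne H.one_mem (H.inv_mem hw) (Or.inr (hsolve _ _ he))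
      · rintro rfl
        refine key hz hz' hne H.one_mem (H.inv_mem hw) (Or.inr ?_)
        rw [hφ] at he
        have : φ z * w * z = 1 := by rw [← he]; group
        rw [eq_mul_inv_of_mul_eq (eq_inv_of_mul_eq_one_left this)]
        group
  refine not_isExt_pair hφ hanti (Subgroup.map_mem_of_closure
    (fun x hx => Subgroup.mem_sup_left (hH x hx)) fun b hb => ?_) hwM hne hpair
  obtain ⟨hbB, hbz, hbz'⟩ := (hCB b).1 hb
  rcases h.typed b hbB with hb1 | ⟨a, ha, ha', hne', rfl | rfl⟩ | ⟨e, e', he, he', hb1⟩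
  · rw [hsolve _ _ hb1, one_mul]
    exact mul_mem (inv_mem (hCM _ hb)) (inv_mem hwM)
  · refine hCM _ ((hCB _).2 ⟨ha', fun e => ?_, fun e => hbz (φ.injective e)⟩)
    exact key hbB hz' hbz' hw (H.inv_mem hw) (Or.inl (by rw [← hφ, e]))
  · rw [hφ]
    refine mul_mem (mul_mem hwM (hCM _ ((hCB _).2 ⟨ha, fun e => hbz' (by rw [e]), fun e => ?_⟩)))
      (inv_mem hwM)
    exact key hz hbB (Ne.symm hbz) hw (H.inv_mem hw) (Or.inl (by rw [← hφ, e]))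
  · rw [hb1]
    exact mul_mem (mul_mem (inv_mem (hlabel e he)) (hCM _ hb)) (hlabel e' he')

end Complements

section Labels

variable {G : Type u} [Group G] {φ : MulAut G} {B : Set G}

/-- A basis for an involution in which every element is inverted, or multiplied on the two sides
by labels taken from the inverted basis elements. -/
structure IsLabelledBasis (φ : MulAut G) (B : Set G) : Prop where
  ext : IsExt ⊥ B ⊤
  labels : ∀ b ∈ B, φ b ≠ b⁻¹ → ∃ e e', (φ e = e⁻¹ ∧ (e = 1 ∨ e ∈ B)) ∧
    (φ e' = e'⁻¹ ∧ (e' = 1 ∨ e' ∈ B)) ∧ φ b = e⁻¹ * b * e'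

theorem IsLabelledBasis.label_eq (hφ : ∀ x, φ (φ x) = x)
    (hanti : AntiCommSet {g : OutAut G | IsConj (toOut φ) g}) (h : IsLabelledBasis φ B)
    {s y t e : G} (hs : s ∈ B) (hφs : φ s = s⁻¹) (hy : y ∈ B) (hφy : φ y ≠ y⁻¹)
    (hty : t = y ∨ t = y⁻¹) (he : φ e = e⁻¹) (heB : e = 1 ∨ e ∈ B)
    (ht : φ t = s⁻¹ * t * e) : e = s := by
  classical
  by_contra hes
  have hys : y ≠ s := fun e => hφy (e ▸ hφs)
  obtain ⟨C, hC⟩ : ∃ C, C = B \ {s, y} := ⟨_, rfl⟩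
  have hCB : ∀ x, x ∈ C ↔ x ∈ B ∧ x ≠ s ∧ x ≠ y := fun x => by simp [hC]
  have hBC : B = {y} ∪ (C ∪ {s}) := by
    ext x
    simp only [Set.mem_union, Set.mem_singleton_iff, hCB]
    constructor
    · intro hx; by_cases h1 : x = s <;> by_cases h2 : x = y <;> simp [h1, h2, hx]
    · rintro (rfl | ⟨hx, -⟩ | rfl) <;> assumption
  have hB : IsExt ⊥ ({y} ∪ (C ∪ {s})) ⊤ := hBC ▸ h.ext
  have hrest : IsExt (⊥ ⊔ Subgroup.closure {y}) (C ∪ {s}) ⊤ := hB.right_of_union (by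
    rw [Set.disjoint_singleton_left]
    rintro (hx | hx)
    · exact ((hCB y).1 hx).2.2 rfl
    · exact hys hx)
  have hyK : IsExt ⊥ {y} (⊥ ⊔ Subgroup.closure {y}) := hB.left_of_union
  have htK : IsExt ⊥ {t} (⊥ ⊔ Subgroup.closure {y}) := by
    have := hyK.image_mul_mul (fun _ => t) (fun z hz => ⟨1, one_mem _, 1, one_mem _, by
      rw [Set.mem_singleton_iff.1 hz]; simpa using hty⟩)
    simpa using this
  obtain ⟨K, hK⟩ : ∃ K, K = (⊥ : Subgroup G) ⊔ Subgroup.closure {y} := ⟨_, rfl⟩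
  rw [← hK] at hrest htK
  have htmem : t ∈ K := htK.subset rfl
  obtain ⟨lam, hlam⟩ : ∃ lam : G → G, lam = fun a => if a = s then t⁻¹ else 1 := ⟨_, rfl⟩
  have hlamK : ∀ a, lam a ∈ K := fun a => by
    rw [hlam]; dsimp only; split_ifs
    · exact inv_mem htmem
    · exact one_mem _
  have hσ : ∀ c, ∃ d, c ∈ C → (φ c = c⁻¹ ∧ d = c) ∨ (φ c ≠ c⁻¹ ∧
      ∃ a a', (φ a = a⁻¹ ∧ (a = 1 ∨ a ∈ B)) ∧ (φ a' = a'⁻¹ ∧ (a' = 1 ∨ a' ∈ B)) ∧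
        φ c = a⁻¹ * c * a' ∧ d = lam a * c * (lam a')⁻¹) := by
    intro c
    by_cases hc : c ∈ C
    · by_cases hφc : φ c = c⁻¹
      · exact ⟨c, fun _ => Or.inl ⟨hφc, rfl⟩⟩
      · obtain ⟨a, a', h1, h2, h3⟩ := h.labels c ((hCB c).1 hc).1 hφc
        exact ⟨_, fun _ => Or.inr ⟨hφc, a, a', h1, h2, h3, rfl⟩⟩
    · exact ⟨1, fun h => absurd h hc⟩
  choose σ hσ using hσ
  have hσK : ∀ c ∈ C, ∃ l ∈ K, ∃ r ∈ K, σ c = l * c * r := by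
    intro c hc
    rcases hσ c hc with ⟨-, h1⟩ | ⟨-, a, a', -, -, -, h1⟩
    · exact ⟨1, one_mem _, 1, one_mem _, by rw [h1]; group⟩
    · exact ⟨_, hlamK a, _, inv_mem (hlamK a'), h1⟩
  have hrest' : IsExt K (σ '' C ∪ {s}) ⊤ := by
    have := hrest.image_mul_mul (fun x => if x = s then s else σ x) (by
      rintro x (hx | rfl)
      · obtain ⟨l, hl, r, hr, e⟩ := hσK x hx
        exact ⟨l, hl, r, hr, Or.inl (by rw [← e]; exact if_neg ((hCB x).1 hx).2.1)⟩
      · exact ⟨1, one_mem _, 1, one_mem _, Or.inl (by simp)⟩)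
    rw [Set.image_union, Set.image_singleton, if_pos rfl] at this
    rwa [Set.image_congr (g := σ) (fun x hx => if_neg ((hCB x).1 hx).2.1)] at this
  have hsσ : s ∉ σ '' C := by
    rintro ⟨c, hc, hcs⟩
    obtain ⟨l, hl, r, hr, e⟩ := hσK c hc
    refine hrest.notMem (z := s) (Or.inr rfl) ?_
    have : l * c * r ∈ K ⊔ Subgroup.closure ((C ∪ {s}) \ {s}) :=
      mul_mem (mul_mem (Subgroup.mem_sup_left hl) (Subgroup.mem_sup_right
        (Subgroup.subset_closure ⟨Or.inl hc, ((hCB c).1 hc).2.1⟩))) (Subgroup.mem_sup_left hr)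
    rwa [← e, hcs] at this
  have hCM : ∀ c ∈ C, σ c ∈ (⊥ : Subgroup G) ⊔ Subgroup.closure (σ '' C) := fun c hc =>
    Subgroup.mem_sup_right (Subgroup.subset_closure ⟨c, hc, rfl⟩)
  have hlabel : ∀ a, φ a = a⁻¹ → (a = 1 ∨ a ∈ B) → a ≠ s →
      a ∈ (⊥ : Subgroup G) ⊔ Subgroup.closure (σ '' C) := by
    rintro a ha (rfl | haB) has
    · exact one_mem _
    · have haC : a ∈ C := (hCB a).2 ⟨haB, has, fun e => hφy (e ▸ ha)⟩
      rcases hσ a haC with ⟨-, h1⟩ | ⟨h1, -⟩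
      · rw [← h1]; exact hCM a haC
      · exact absurd ha h1
  have heM := hlabel e he heB hes
  have hKM : IsExt (K ⊔ Subgroup.closure (σ '' C)) {φ t} ⊤ := by
    have := (hrest'.right_of_union (by rwa [Set.disjoint_singleton_right])).image_mul_mul
      (fun _ => φ t) (by
        rintro z rfl
        refine ⟨1, one_mem _, t * e, mul_mem (Subgroup.mem_sup_left htmem) ?_, Or.inr ?_⟩
        · rw [bot_sup_eq] at heM; exact Subgroup.mem_sup_right heM
        · rw [ht]; group)
    simpa using this
  have hσext : IsExt K (σ '' C) (K ⊔ Subgroup.closure (σ '' C)) := hrest'.left_of_union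
  have hne : t ≠ φ t := fun e => hKM.notMem_base (z := φ t) rfl
    (by rw [← e]; exact Subgroup.mem_sup_left htmem)
  have hall : IsExt ⊥ (σ '' C ∪ {t, φ t}) ⊤ := by
    have := (htK.trans hσext).trans hKM
    rwa [Set.union_comm {t}, Set.union_assoc, Set.singleton_union] at this
  have hpair : IsExt (⊥ ⊔ Subgroup.closure (σ '' C)) {t, φ t} ⊤ := hall.right_of_union (by
    rw [Set.disjoint_right]
    rintro x (rfl | rfl) hx
    · exact hσext.notMem_base hx htmem
    · exact hKM.notMem_base (z := φ t) rfl (Subgroup.mem_sup_right (Subgroup.subset_closure hx)))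
  have hlam' : ∀ a, φ a = a⁻¹ → (a = 1 ∨ a ∈ B) →
      ∃ m ∈ (⊥ : Subgroup G) ⊔ Subgroup.closure (σ '' C), φ (lam a) * a⁻¹ = m * lam a := by
    intro a ha haB
    by_cases has : a = s
    · refine ⟨e⁻¹, inv_mem heM, ?_⟩
      rw [hlam, has]
      simp only [if_true, map_inv, ht]
      group
    · refine ⟨a⁻¹, inv_mem (hlabel a ha haB has), ?_⟩
      rw [hlam]
      simp [has]
  refine not_isExt_pair (w := 1) (by simpa using hφ) hanti (Subgroup.map_mem_of_closure
    (by rintro x (rfl : x = 1); rw [map_one]; exact one_mem _) ?_) (one_mem _) hne hpair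
  rintro _ ⟨c, hc, rfl⟩
  rcases hσ c hc with ⟨h1, h2⟩ | ⟨-, a, a', ⟨h1, h2⟩, ⟨h3, h4⟩, h5, h6⟩
  · have := hCM c hc
    rw [h2] at this ⊢
    rw [h1]
    exact inv_mem this
  · obtain ⟨m, hm, hm'⟩ := hlam' a h1 h2
    obtain ⟨m', hn, hn'⟩ := hlam' a' h3 h4
    have : φ (σ c) = m * σ c * m'⁻¹ := by
      rw [h6, map_mul, map_mul, map_inv, h5]
      calc φ (lam a) * (a⁻¹ * c * a') * (φ (lam a'))⁻¹
          = (φ (lam a) * a⁻¹) * c * (φ (lam a') * a'⁻¹)⁻¹ := by group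
        _ = _ := by rw [hm', hn']; group
    rw [this]
    exact mul_mem (mul_mem hm (hCM c hc)) (inv_mem hn)

/-- The two labels of a basis element coincide. -/
theorem IsLabelledBasis.exists_label (hφ : ∀ x, φ (φ x) = x)
    (hanti : AntiCommSet {g : OutAut G | IsConj (toOut φ) g}) (h : IsLabelledBasis φ B)
    {y : G} (hy : y ∈ B) (hφy : φ y ≠ y⁻¹) :
    ∃ e, φ e = e⁻¹ ∧ (e = 1 ∨ e ∈ B) ∧ φ y = e⁻¹ * y * e := by
  obtain ⟨e, e', ⟨h1, h2⟩, ⟨h3, h4⟩, h5⟩ := h.labels y hy hφy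
  suffices hee : e' = e from ⟨e, h1, h2, by rw [h5, hee]⟩
  by_cases he : e = 1
  · by_cases he' : e' = 1
    · rw [he, he']
    · exact (h.label_eq hφ hanti (h4.resolve_left he') h3 hy hφy (Or.inr rfl) h1 h2
        (by rw [map_inv, h5]; group)).symm
  · exact h.label_eq hφ hanti (h2.resolve_left he) h1 hy hφy (Or.inl rfl) h3 h4 h5

end Labels

/-! ### Canonical bases -/

section Canonical

variable {X : Type u} {φ : MulAut (FreeGroup X)} {B : Set (FreeGroup X)}

theorem IsExt.isBasis (h : IsExt ⊥ B ⊤) : FreeGroup.IsBasis B := by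
  classical
  constructor
  · obtain ⟨f, -, hf⟩ := h.exists_hom_top (P := FreeGroup B) 1
      (fun x => if hx : x ∈ B then FreeGroup.of ⟨x, hx⟩ else 1)
    have : f.comp (FreeGroup.lift (fun s : B => (s : FreeGroup X))) = MonoidHom.id _ := by
      ext b
      simp [hf b b.2]
    exact Function.LeftInverse.injective (g := f) fun x => DFunLike.congr_fun this x
  · rw [← MonoidHom.range_eq_top, eq_top_iff]
    refine h.le_of bot_le fun b hb => ⟨FreeGroup.of ⟨b, hb⟩, by simp⟩

theorem IsLabelledBasis.exists_isCanonicalBasis (hφ : ∀ x, φ (φ x) = x)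
    (hanti : AntiCommSet {g : OutAut (FreeGroup X) | IsConj (toOut φ) g})
    (h : IsLabelledBasis φ B) : ∃ U S Y, IsCanonicalBasis φ U S Y := by
  classical
  have hlab : ∀ y, ∃ e, y ∈ B → φ y ≠ y⁻¹ →
      φ e = e⁻¹ ∧ (e = 1 ∨ e ∈ B) ∧ φ y = e⁻¹ * y * e := by
    intro y
    by_cases hy : y ∈ B ∧ φ y ≠ y⁻¹
    · obtain ⟨e, he⟩ := h.exists_label hφ hanti hy.1 hy.2
      exact ⟨e, fun _ _ => he⟩
    · exact ⟨1, fun h1 h2 => absurd ⟨h1, h2⟩ hy⟩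
  choose lab hlab using hlab
  refine ⟨{b | b ∈ B ∧ φ b ≠ b⁻¹ ∧ lab b = 1}, {x | φ x = x⁻¹ ∧ x⁻¹ ∈ B},
    fun x => {b | b ∈ B ∧ φ b ≠ b⁻¹ ∧ lab b ≠ 1 ∧ (lab b)⁻¹ = x}, ⟨?_, ?_, ?_, ?_, ?_⟩, ?_, ?_, ?_⟩
  · refine IsExt.isBasis ?_
    have := h.ext.image_mul_mul (fun b => if φ b = b⁻¹ then b⁻¹ else b) (fun b _ =>
      ⟨1, one_mem _, 1, one_mem _, by by_cases hb : φ b = b⁻¹ <;> simp [hb]⟩)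
    convert this using 1
    ext x
    simp only [Set.mem_union, Set.mem_iUnion, Set.mem_image, Set.mem_ofPred_eq, exists_prop]
    constructor
    · rintro ((⟨h1, h2, -⟩ | ⟨h1, h2⟩) | ⟨-, -, h1, h2, -⟩)
      · exact ⟨x, h1, if_neg h2⟩
      · exact ⟨x⁻¹, h2, by rw [if_pos (by rw [map_inv, h1]), inv_inv]⟩
      · exact ⟨x, h1, if_neg h2⟩
    · rintro ⟨b, hb, rfl⟩
      by_cases hφb : φ b = b⁻¹
      · rw [if_pos hφb]
        exact Or.inl (Or.inr ⟨by rw [map_inv, hφb], by rwa [inv_inv]⟩)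
      · rw [if_neg hφb]
        by_cases hb1 : lab b = 1
        · exact Or.inl (Or.inl ⟨hb, hφb, hb1⟩)
        · obtain ⟨h1, h2, -⟩ := hlab b hb hφb
          exact Or.inr ⟨(lab b)⁻¹, ⟨by rw [map_inv, h1], by
            rw [inv_inv]; exact h2.resolve_left hb1⟩, hb, hφb, hb1, rfl⟩
  · exact Set.disjoint_left.2 fun b hb hb' => hb.2.1 hb'.1
  · exact fun x _ => Set.disjoint_left.2 fun b hb hb' => hb'.2.2.1 hb.2.2
  · exact fun x _ => Set.disjoint_left.2 fun b hb hb' => hb'.2.1 hb.1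
  · exact fun x _ x' _ hxx => Set.disjoint_left.2 fun b hb hb' =>
      hxx (hb.2.2.2.symm.trans hb'.2.2.2)
  · rintro b ⟨h1, h2, h3⟩
    have := (hlab b h1 h2).2.2
    rw [this, h3]; group
  · exact fun x hx => hx.1
  · rintro x - b ⟨h1, h2, -, rfl⟩
    rw [(hlab b h1 h2).2.2, inv_inv]

end Canonical

section Lifts

variable {X : Type u} {φ : MulAut (FreeGroup X)} {w : FreeGroup X}

theorem FreeGroup.exists_finite_letters_mem (c : FreeGroup X) :
    ∃ S : Set X, S.Finite ∧ c ∈ Subgroup.closure (FreeGroup.of '' S) := by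
  obtain ⟨S, hS, h⟩ := FreeGroup.exists_finite_letters {c} (Set.finite_singleton c)
  exact ⟨S, hS, h rfl⟩

/-- The centre of a free group of infinite rank is trivial. -/
theorem FreeGroup.eq_one_of_central [Infinite X] {c : FreeGroup X} (hc : ∀ x, c * x = x * c) :
    c = 1 := by
  classical
  obtain ⟨S, hS, hcS⟩ := FreeGroup.exists_finite_letters_mem c
  obtain ⟨x, hx⟩ := hS.exists_notMem
  obtain ⟨p, hp⟩ : ∃ p : FreeGroup X →* Equiv.Perm (Option (FreeGroup X)),
      p = FreeGroup.lift (fun y => if y = x then Equiv.swap none (some 1)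
        else Equiv.optionCongr (Equiv.mulLeft (FreeGroup.of y))) := ⟨_, rfl⟩
  have hpx : p (FreeGroup.of x) = Equiv.swap none (some 1) := by simp [hp]
  have hpc : p c none = none ∧ ∀ a, p c (some a) = some (c * a) := by
    clear hc
    induction hcS using Subgroup.closure_induction with
    | mem g hg =>
      obtain ⟨y, hy, rfl⟩ := hg
      have : y ≠ x := fun e => hx (e ▸ hy)
      simp [hp, this]
    | one => simp
    | mul g g' _ _ h h' => exact ⟨by simp [h.1, h'.1], fun a => by simp [h.2, h'.2, mul_assoc]⟩
    | inv g _ h =>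
      refine ⟨?_, fun a => ?_⟩
      · rw [_root_.map_inv, Equiv.Perm.inv_eq_iff_eq, h.1]
      · rw [_root_.map_inv, Equiv.Perm.inv_eq_iff_eq, h.2, mul_inv_cancel_left]
  have h1 := DFunLike.congr_fun (congrArg p (hc (FreeGroup.of x))) none
  rw [_root_.map_mul, _root_.map_mul, Equiv.Perm.mul_apply, Equiv.Perm.mul_apply, hpx, hpc.1,
    Equiv.swap_apply_left, hpc.2, mul_one] at h1
  exact Option.some.inj h1

theorem FreeGroup.apply_eq_of_sq_eq_conj [Infinite X] (hφ : ∀ x, φ (φ x) = w * x * w⁻¹) :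
    φ w = w := by
  have key : w⁻¹ * φ w = 1 := FreeGroup.eq_one_of_central fun y => by
    obtain ⟨x, rfl⟩ := φ.surjective y
    have h1 := hφ (φ x)
    rw [hφ x, _root_.map_mul, _root_.map_mul, _root_.map_inv] at h1
    calc w⁻¹ * φ w * φ x = w⁻¹ * (φ w * φ x * (φ w)⁻¹) * φ w := by group
      _ = _ := by rw [h1]; group
  rw [inv_mul_eq_one] at key
  exact key.symm

theorem IsAdapted.empty_of_torsion {H : Subgroup (FreeGroup X)} (hH : ∀ x ∈ H, φ x ∈ H)
    (ht : ∀ a ∈ H, a * φ a * w = 1 → a = 1) : IsAdapted φ w H ∅ where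
  ext := by simpa using IsExt.empty H
  inv := by simpa using hH
  typed := by simp
  torsion := by
    intro a ha h
    have h1 := ht a (by simpa using ha) h
    exact ⟨1, one_mem _, 1, ⟨by rwa [h1] at h, Or.inl rfl⟩, by simp [h1]⟩

/-- An involution of a free group with an anti-commutative outer class has a canonical basis. -/
theorem exists_isCanonicalBasis_of_anticomm [Nonempty X] (hφ : ∀ x, φ (φ x) = x)
    (hanti : AntiCommSet {g : OutAut (FreeGroup X) | IsConj (toOut φ) g}) :
    ∃ U S Y, IsCanonicalBasis φ U S Y := by
  have hφ1 : ∀ x, φ (φ x) = 1 * x * 1⁻¹ := by simpa using hφ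
  have hcore : coreOf φ ∅ = ⊥ := by simp [coreOf]
  obtain ⟨B, hB, htop⟩ := exists_isAdapted_top hφ1 (map_one φ) Set.finite_empty (one_mem _)
    (IsAdapted.empty_of_torsion (coreOf_invariant hφ1 (one_mem _)) fun a ha _ => by
      rw [hcore] at ha; exact ha)
  rw [hcore] at hB htop
  refine IsLabelledBasis.exists_isCanonicalBasis (B := B) hφ hanti ⟨htop ▸ hB.ext, ?_⟩
  have hlab : ∀ {e}, IsLabel φ 1 B e → φ e = e⁻¹ ∧ (e = 1 ∨ e ∈ B) := fun h =>
    ⟨eq_inv_of_mul_eq_one_right (by simpa using h.1), h.2⟩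
  intro b hb hφb
  rcases hB.typed b hb with h1 | ⟨z, hz, hz', hne, -⟩ | ⟨e, e', he, he', h1⟩
  · exact absurd (eq_inv_of_mul_eq_one_right (by simpa using h1)) hφb
  · exact absurd (hB.eq_of_pair hφ1 hanti (one_mem _)
      (by rintro x (rfl : x = 1); rw [map_one]; exact one_mem _) htop hz hz') hne
  · exact ⟨e, e', hlab he, hlab he', h1⟩

/-- An automorphism whose outer class is an involution with anti-commutative conjugacy class can
be corrected by an inner automorphism to an involution. -/
theorem exists_torsion_of_anticomm [Infinite X] (hφ : ∀ x, φ (φ x) = w * x * w⁻¹)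
    (hanti : AntiCommSet {g : OutAut (FreeGroup X) | IsConj (toOut φ) g}) :
    ∃ a, a * φ a * w = 1 := by
  by_contra! hno
  have hφw := FreeGroup.apply_eq_of_sq_eq_conj hφ
  obtain ⟨S, hS, hw⟩ := FreeGroup.exists_finite_letters_mem w
  have hinv := coreOf_invariant hφ hw
  obtain ⟨B, hB, htop⟩ := exists_isAdapted_top hφ hφw hS hw
    (IsAdapted.empty_of_torsion hinv fun a _ h => absurd h (hno a))
  have hempty : B = ∅ := by
    refine Set.eq_empty_of_forall_notMem fun b hb => ?_
    rcases hB.typed b hb with h1 | ⟨z, hz, hz', hne, -⟩ | ⟨e, e', he, -, -⟩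
    · exact hno b h1
    · exact hne (hB.eq_of_pair hφ hanti (mem_coreOf hφw hw) hinv htop hz hz')
    · exact hno e he.1
  obtain ⟨x, hx⟩ := hS.exists_notMem
  have hxS : FreeGroup.of x ∈ Subgroup.closure (FreeGroup.of '' S) := by
    rw [hempty, Subgroup.closure_empty, sup_bot_eq] at htop
    have : FreeGroup.of x ∈ coreOf φ S := htop ▸ Subgroup.mem_top _
    exact this.1
  classical
  obtain ⟨p, hp⟩ : ∃ p : FreeGroup X →* Multiplicative ℤ, p = FreeGroup.lift
      (fun y => if y = x then Multiplicative.ofAdd 1 else 1) := ⟨_, rfl⟩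
  have hle : Subgroup.closure (FreeGroup.of '' S) ≤ p.ker := by
    rw [Subgroup.closure_le]
    rintro _ ⟨y, hy, rfl⟩
    have : y ≠ x := fun e => hx (e ▸ hy)
    simp [hp, this]
  have := MonoidHom.mem_ker.1 (hle hxS)
  rw [hp, FreeGroup.lift_apply_of, if_pos rfl] at this
  exact absurd this (by decide)

end Lifts

/-- If the conjugacy class in `Out F` of an involution `f ∈ Out F` is anti-commutative,
then `f` is a soft involution of `Out F`. -/
theorem anticommutative_class_soft (X : Type*) [Infinite X]
    (f : OutAut (FreeGroup X)) (hf : IsInvolution f)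
    (hanti : AntiCommSet {g : OutAut (FreeGroup X) | IsConj f g}) :
    IsSoftOutInvolution f := by
  obtain ⟨φ, rfl⟩ : ∃ φ, toOut φ = f := QuotientGroup.mk'_surjective _ f
  obtain ⟨w, hw⟩ : ∃ w, MulAut.conj w = φ * φ := by
    have := hf.2
    rw [sq, ← map_mul, ← map_one toOut] at this
    simpa using toOut_eq_iff.1 this.symm
  have hφ : ∀ x, φ (φ x) = w * x * w⁻¹ := fun x => (DFunLike.congr_fun hw x).symm
  obtain ⟨a, ha⟩ := exists_torsion_of_anticomm hφ hanti
  obtain ⟨ψ, hψ⟩ : ∃ ψ, ψ = MulAut.conj a * φ := ⟨_, rfl⟩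
  have hout : toOut ψ = toOut φ := by
    have : toOut (MulAut.conj a) = 1 := (QuotientGroup.eq_one_iff _).2 ⟨a, rfl⟩
    rw [hψ, map_mul, this, one_mul]
  have hψψ : ∀ x, ψ (ψ x) = x := fun x => by
    have happ : ∀ y, ψ y = a * φ y * a⁻¹ := fun y => by rw [hψ]; rfl
    rw [happ, happ, map_mul, map_mul, map_inv, hφ]
    calc a * (φ a * (w * x * w⁻¹) * (φ a)⁻¹) * a⁻¹
        = (a * φ a * w) * x * (a * φ a * w)⁻¹ := by group
      _ = x := by rw [ha]; group
  rw [← hout] at hf hanti ⊢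
  refine ⟨hf, ψ, ⟨⟨fun h => hf.1 (by rw [h, map_one]), ?_⟩,
    exists_isCanonicalBasis_of_anticomm hψψ hanti⟩, rfl⟩
  ext x
  simp [sq, hψψ]
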